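/- arXiv:2101.06388 — 3 statements merged into one kernel-verified Lean document; each statement's English description precedes it below -/
import Mathlib

section
/- There exist constants γ > 0, C > 0 and N₀ (depending only on fixed constants c, c₁, c₂, c₃, c₄ > 0) such that for all n ≥ N₀ the following holds. Let P be an n×n probability matrix satisfying: n p* ≥ c log n; |λ_r| ≥ c₁ n p*/√r and |λ_{r+1}| ≤ c₂ √(p* log n) (approximate low-rankness); ‖U‖_{2,∞} ≤ μ₀ √(r/n) with μ₀ ≥ 1 (incoherence); p* ≥ c₃ max{μ₀² r log n/n, μ₀² r²/n}; and |λ₁/λ_r| ≤ c₄. Let A be a random adjacency matrix generated from P and P̂ its rank-r spectral truncation. Then with probability at least 1 − (B(r)+2) n^{−γ}: ‖P̂ − P‖_{2,∞} ≤ C ( μ₀ √(r (log n + r) p*) + μ₀² r √(p*) ), where B(r) = 10·min{r, 1+log₂|λ₁/λ_r|}. -/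
open Matrix MeasureTheory ProbabilityTheory

noncomputable section

/-- Euclidean norm of the `i`-th row of a matrix. -/
def rowNorm {n m : ℕ} (M : Matrix (Fin n) (Fin m) ℝ) (i : Fin n) : ℝ :=
  Real.sqrt (∑ j, (M i j) ^ 2)

/-- Two-to-infinity norm: maximum Euclidean norm of the rows. -/
def twoInf {n m : ℕ} (M : Matrix (Fin n) (Fin m) ℝ) : ℝ :=
  ⨆ i, rowNorm M i

/-- Spectral norm of a square real matrix. -/
def specNorm {n : ℕ} (M : Matrix (Fin n) (Fin n) ℝ) : ℝ :=
  ‖LinearMap.toContinuousLinearMap (Matrix.toEuclideanLin M)‖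

/-- Frobenius norm. -/
def frobNorm {n : ℕ} (M : Matrix (Fin n) (Fin n) ℝ) : ℝ :=
  Real.sqrt (∑ i, ∑ j, (M i j) ^ 2)

/-- The centering matrix `H = I - (1/n) 11ᵗ`. -/
def centerH (n : ℕ) : Matrix (Fin n) (Fin n) ℝ :=
  1 - (n : ℝ)⁻¹ • Matrix.of (fun _ _ => (1 : ℝ))

/-- A probability matrix: symmetric, entries in `[0,1]`, zero diagonal. -/
def IsProbMatrix {n : ℕ} (P : Matrix (Fin n) (Fin n) ℝ) : Prop :=
  P.IsSymm ∧ (∀ i j, 0 ≤ P i j) ∧ (∀ i j, P i j ≤ 1) ∧ (∀ i, P i i = 0)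

/-- Maximum entry `p* = max_{i,j} P_ij`. -/
def pstar {n : ℕ} (P : Matrix (Fin n) (Fin n) ℝ) : ℝ := ⨆ i, ⨆ j, P i j

/-- Expected degree `d_i = Σ_j P_ij`. -/
def deg {n : ℕ} (P : Matrix (Fin n) (Fin n) ℝ) (i : Fin n) : ℝ := ∑ j, P i j

open Classical in
/-- ER-type periphery set. -/
def peripheryER {n : ℕ} (P : Matrix (Fin n) (Fin n) ℝ) : Finset (Fin n) :=
  Finset.univ.filter fun i => ∀ j k, j ≠ i → k ≠ i → P i j = P i k

/-- ER-type core set. -/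
def coreER {n : ℕ} (P : Matrix (Fin n) (Fin n) ℝ) : Finset (Fin n) :=
  (peripheryER P)ᶜ

/-- `h(n) = min_{i ∈ core} ‖P_{i,*} H‖₂`. -/
def hSignal {n : ℕ} (P : Matrix (Fin n) (Fin n) ℝ) : ℝ :=
  ⨅ i : {i // i ∈ coreER P}, rowNorm (P * centerH n) i.1

open Classical in
/-- Configuration-type periphery set. -/
def peripheryConfig {n : ℕ} (P : Matrix (Fin n) (Fin n) ℝ) : Finset (Fin n) :=
  Finset.univ.filter fun i => ∀ j, j ≠ i → P i j = deg P i * deg P j / ∑ k, deg P k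

/-- Configuration-type core set. -/
def coreConfig {n : ℕ} (P : Matrix (Fin n) (Fin n) ℝ) : Finset (Fin n) :=
  (peripheryConfig P)ᶜ

/-- Diagonal matrix with entries `(d i)⁻¹`, i.e. `D⁻¹`. -/
def degInv {n : ℕ} (d : Fin n → ℝ) : Matrix (Fin n) (Fin n) ℝ :=
  Matrix.diagonal fun i => (d i)⁻¹

/-- `h'(n) = min_{i ∈ core} ‖P_{i,*} D⁻¹ H‖₂`. -/
def hSignal' {n : ℕ} (P : Matrix (Fin n) (Fin n) ℝ) : ℝ :=
  ⨅ i : {i // i ∈ coreConfig P}, rowNorm (P * degInv (deg P) * centerH n) i.1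

/-- Eigendecomposition `P = V Λ Vᵗ` with eigenvalues ordered by decreasing absolute value. -/
def IsEigenDecomp {n : ℕ} (P V : Matrix (Fin n) (Fin n) ℝ) (lam : Fin n → ℝ) : Prop :=
  V * Vᵀ = 1 ∧ P = V * Matrix.diagonal lam * Vᵀ ∧
    ∀ i j : Fin n, i ≤ j → |lam j| ≤ |lam i|

/-- `T` is a rank-`r` spectral truncation of `A`: it retains, from an eigendecomposition of `A`
ordered by decreasing absolute value, the `r` leading eigenvalues and their eigenvectors. -/
def IsSpecTrunc {n : ℕ} (r : ℕ) (A T : Matrix (Fin n) (Fin n) ℝ) : Prop :=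
  ∃ (W : Matrix (Fin n) (Fin n) ℝ) (mu : Fin n → ℝ), IsEigenDecomp A W mu ∧
    T = W * Matrix.diagonal (fun i : Fin n => if (i : ℕ) < r then mu i else 0) * Wᵀ

/-- `U`: the `n × r` matrix of the top-`r` eigenvectors (first `r` columns of `V`). -/
def topEig {n : ℕ} (V : Matrix (Fin n) (Fin n) ℝ) (r : ℕ) (h : r ≤ n) :
    Matrix (Fin n) (Fin r) ℝ :=
  fun i k => V i (Fin.castLE h k)

/-- `A` is a random adjacency matrix generated from `P`: symmetric, zero diagonal, 0/1 entries,
with `A_ij ~ Bernoulli(P_ij)` independently over pairs `i < j`. -/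
def IsAdjacencyModel {n : ℕ} {Ω : Type*} [MeasurableSpace Ω] (μ : Measure Ω)
    (P : Matrix (Fin n) (Fin n) ℝ) (A : Ω → Matrix (Fin n) (Fin n) ℝ) : Prop :=
  (∀ ω, (A ω).IsSymm) ∧ (∀ ω i, A ω i i = 0) ∧
  (∀ ω i j, A ω i j = 0 ∨ A ω i j = 1) ∧
  (∀ i j : Fin n, Measurable fun ω => A ω i j) ∧
  (∀ i j : Fin n, i < j → μ {ω | A ω i j = 1} = ENNReal.ofReal (P i j)) ∧
  iIndepFun
    (fun (p : {q : Fin n × Fin n // q.1 < q.2}) => fun ω => A ω p.1.1 p.1.2) μ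

/-- Exact recovery: every core score strictly exceeds every non-core score, so the
`N_core` indices with largest scores are exactly the core. -/
def ExactRecovery {n : ℕ} (S : Fin n → ℝ) (core : Finset (Fin n)) : Prop :=
  ∀ i ∈ core, ∀ j ∉ core, S j < S i

/-- `B(r) = 10 min{r, 1 + log₂ ratio}` where `ratio = |λ₁/λ_r|`. -/
def Bconst (ratio : ℝ) (r : ℕ) : ℝ := 10 * min (r : ℝ) (1 + Real.logb 2 ratio)

section PartA
open scoped Matrix.Norms.L2Operator
variable {n : ℕ}

/-- The coordinate projection `e_i e_iᵀ`. -/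
def Dm (i : Fin n) : Matrix (Fin n) (Fin n) ℝ := Matrix.diagonal (Pi.single i 1)

lemma Dm_mul_apply (i : Fin n) (M : Matrix (Fin n) (Fin n) ℝ) (j k : Fin n) :
    (Dm i * M) j k = if j = i then M i k else 0 := by
  unfold Dm
  rw [Matrix.diagonal_mul]
  by_cases h : j = i
  · subst h; simp
  · simp [h]

lemma norm_transpose_real (M : Matrix (Fin n) (Fin n) ℝ) : ‖Mᵀ‖ = ‖M‖ := by
  have := Matrix.l2_opNorm_conjTranspose M
  rwa [Matrix.conjTranspose_eq_transpose_of_trivial] at this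

lemma norm_mul_transpose_self (M : Matrix (Fin n) (Fin n) ℝ) : ‖M * Mᵀ‖ = ‖M‖ * ‖M‖ := by
  have := Matrix.l2_opNorm_conjTranspose_mul_self Mᵀ
  rwa [Matrix.conjTranspose_eq_transpose_of_trivial, Matrix.transpose_transpose,
    norm_transpose_real] at this

lemma norm_single_real (i : Fin n) (a : ℝ) : ‖(Pi.single i a : Fin n → ℝ)‖ = |a| := by
  apply le_antisymm
  · rw [pi_norm_le_iff_of_nonneg (abs_nonneg a)]
    intro j
    by_cases h : j = i
    · subst h; simp
    · simp [h]
  · have := norm_le_pi_norm (Pi.single i a : Fin n → ℝ) i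
    simpa using this

lemma rowNorm_nonneg {m : ℕ} (M : Matrix (Fin n) (Fin m) ℝ) (i : Fin n) : 0 ≤ rowNorm M i :=
  Real.sqrt_nonneg _

lemma rowNorm_eq (M : Matrix (Fin n) (Fin n) ℝ) (i : Fin n) : rowNorm M i = ‖Dm i * M‖ := by
  have h1 : (Dm i * M) * (Dm i * M)ᵀ =
      Matrix.diagonal (Pi.single i (∑ j, (M i j) ^ 2)) := by
    ext a b
    rw [Matrix.mul_apply]
    simp only [Matrix.transpose_apply, Dm_mul_apply, Matrix.diagonal_apply]
    by_cases ha : a = i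
    · subst ha
      by_cases hb : b = a
      · subst hb; simp [pow_two]
      · simp [hb, Ne.symm hb]
    · simp [ha]
  have h2 := norm_mul_transpose_self (Dm i * M)
  rw [h1, Matrix.l2_opNorm_diagonal, norm_single_real,
    abs_of_nonneg (Finset.sum_nonneg fun j _ => sq_nonneg _)] at h2
  unfold rowNorm
  rw [h2, Real.sqrt_mul_self (norm_nonneg _)]

lemma norm_Dm_le (i : Fin n) : ‖(Dm i : Matrix (Fin n) (Fin n) ℝ)‖ ≤ 1 := by
  unfold Dm
  rw [Matrix.l2_opNorm_diagonal, norm_single_real]; simp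

lemma norm_one_sub_Dm_le (i : Fin n) : ‖(1 - Dm i : Matrix (Fin n) (Fin n) ℝ)‖ ≤ 1 := by
  have : (1 - Dm i : Matrix (Fin n) (Fin n) ℝ) = Matrix.diagonal (fun j => 1 - (Pi.single i 1 : Fin n → ℝ) j) := by
    unfold Dm
    rw [← Matrix.diagonal_one, Matrix.diagonal_sub]
  rw [this, Matrix.l2_opNorm_diagonal, pi_norm_le_iff_of_nonneg zero_le_one]
  intro j
  by_cases h : j = i
  · subst h; simp
  · simp [h]

/-- functional calculus for a decomposition -/
def fnW (W : Matrix (Fin n) (Fin n) ℝ) (g : Fin n → ℝ) : Matrix (Fin n) (Fin n) ℝ :=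
  W * Matrix.diagonal g * Wᵀ

lemma fnW_mul {W : Matrix (Fin n) (Fin n) ℝ} (hW : W * Wᵀ = 1) (g h : Fin n → ℝ) :
    fnW W g * fnW W h = fnW W (fun i => g i * h i) := by
  have hW' : Wᵀ * W = 1 := mul_eq_one_comm.mp hW
  unfold fnW
  calc W * diagonal g * Wᵀ * (W * diagonal h * Wᵀ)
      = W * diagonal g * (Wᵀ * W) * diagonal h * Wᵀ := by simp only [Matrix.mul_assoc]
    _ = W * (diagonal g * diagonal h) * Wᵀ := by rw [hW']; simp only [Matrix.mul_assoc, Matrix.one_mul]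
    _ = _ := by rw [Matrix.diagonal_mul_diagonal]

lemma fnW_one {W : Matrix (Fin n) (Fin n) ℝ} (hW : W * Wᵀ = 1) : fnW W (fun _ => 1) = 1 := by
  unfold fnW
  rw [show (Matrix.diagonal fun _ : Fin n => (1:ℝ)) = 1 from Matrix.diagonal_one, Matrix.mul_one, hW]

lemma fnW_sub (W : Matrix (Fin n) (Fin n) ℝ) (g h : Fin n → ℝ) :
    fnW W g - fnW W h = fnW W (fun i => g i - h i) := by
  unfold fnW
  rw [← Matrix.diagonal_sub, Matrix.mul_sub, Matrix.sub_mul]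

lemma norm_orth_le {W : Matrix (Fin n) (Fin n) ℝ} (hW : W * Wᵀ = 1) : ‖W‖ ≤ 1 := by
  have h := norm_mul_transpose_self W
  have h1 : ‖(1 : Matrix (Fin n) (Fin n) ℝ)‖ ≤ 1 := by
    rw [← Matrix.diagonal_one, Matrix.l2_opNorm_diagonal, pi_norm_le_iff_of_nonneg zero_le_one]
    intro j; simp
  rw [hW] at h
  nlinarith [norm_nonneg W]

lemma norm_fnW_le {W : Matrix (Fin n) (Fin n) ℝ} (hW : W * Wᵀ = 1) (g : Fin n → ℝ) {b : ℝ}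
    (hb : 0 ≤ b) (hg : ∀ i, |g i| ≤ b) : ‖fnW W g‖ ≤ b := by
  unfold fnW
  have h1 := norm_orth_le hW
  have h2 : ‖Wᵀ‖ ≤ 1 := by rw [norm_transpose_real]; exact h1
  have h3 : ‖(Matrix.diagonal g : Matrix (Fin n) (Fin n) ℝ)‖ ≤ b := by
    rw [Matrix.l2_opNorm_diagonal, pi_norm_le_iff_of_nonneg hb]; exact hg
  calc ‖W * diagonal g * Wᵀ‖ ≤ ‖W * diagonal g‖ * ‖Wᵀ‖ := Matrix.l2_opNorm_mul _ _
    _ ≤ (‖W‖ * ‖(diagonal g : Matrix (Fin n) (Fin n) ℝ)‖) * ‖Wᵀ‖ := by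
        gcongr; exact Matrix.l2_opNorm_mul _ _
    _ ≤ (1 * b) * 1 := by gcongr
    _ = b := by ring

/-- spectral projection -/
def Qp (W : Matrix (Fin n) (Fin n) ℝ) (r : ℕ) : Matrix (Fin n) (Fin n) ℝ :=
  fnW W (fun i => if (i : ℕ) < r then 1 else 0)

/-- truncated inverse -/
def Gp (W : Matrix (Fin n) (Fin n) ℝ) (mu : Fin n → ℝ) (r : ℕ) : Matrix (Fin n) (Fin n) ℝ :=
  fnW W (fun i => if (i : ℕ) < r then (mu i)⁻¹ else 0)

variable {A W : Matrix (Fin n) (Fin n) ℝ} {mu : Fin n → ℝ} {r : ℕ}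

lemma Qp_mul_self (h : IsEigenDecomp A W mu) : Qp W r * Qp W r = Qp W r := by
  unfold Qp
  rw [fnW_mul h.1]; congr 1; ext i; split_ifs <;> simp

lemma A_mul_Qp (h : IsEigenDecomp A W mu) :
    A * Qp W r = fnW W (fun i => if (i : ℕ) < r then mu i else 0) := by
  have : A = fnW W mu := h.2.1
  rw [this]; unfold Qp
  rw [fnW_mul h.1]; congr 1; ext i; split_ifs <;> simp

lemma Qp_mul_A (h : IsEigenDecomp A W mu) : Qp W r * A = A * Qp W r := by
  rw [A_mul_Qp h]
  have : A = fnW W mu := h.2.1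
  rw [this]; unfold Qp
  rw [fnW_mul h.1]; congr 1; ext i; split_ifs <;> simp

lemma Qp_mul_Gp (h : IsEigenDecomp A W mu) : Qp W r * Gp W mu r = Gp W mu r := by
  unfold Qp Gp
  rw [fnW_mul h.1]; congr 1; ext i; split_ifs <;> simp

lemma A_mul_Gp (h : IsEigenDecomp A W mu) (hm : ∀ i : Fin n, (i : ℕ) < r → mu i ≠ 0) :
    A * Gp W mu r = Qp W r := by
  have : A = fnW W mu := h.2.1
  rw [this]; unfold Qp Gp
  rw [fnW_mul h.1]; congr 1; ext i
  split_ifs with hi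
  · exact mul_inv_cancel₀ (hm i hi)
  · simp

lemma norm_Gp_le (h : IsEigenDecomp A W mu) {m : ℝ} (hm0 : 0 < m)
    (hm : ∀ i : Fin n, (i : ℕ) < r → m ≤ |mu i|) : ‖Gp W mu r‖ ≤ m⁻¹ := by
  apply norm_fnW_le h.1 _ (by positivity)
  intro i
  split_ifs with hi
  · rw [abs_inv]; exact inv_anti₀ hm0 (hm i hi)
  · simp; positivity

lemma norm_Qp_le (h : IsEigenDecomp A W mu) : ‖Qp W r‖ ≤ 1 := by
  apply norm_fnW_le h.1 _ zero_le_one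
  intro i; split_ifs <;> simp

lemma one_sub_Qp (h : IsEigenDecomp A W mu) :
    1 - Qp W r = fnW W (fun i => if (i : ℕ) < r then 0 else 1) := by
  unfold Qp
  rw [← fnW_one h.1, fnW_sub]; congr 1; ext i; split_ifs <;> simp

lemma norm_one_sub_Qp_le (h : IsEigenDecomp A W mu) : ‖1 - Qp W r‖ ≤ 1 := by
  rw [one_sub_Qp h]
  apply norm_fnW_le h.1 _ zero_le_one
  intro i; split_ifs <;> simp

lemma norm_A_one_sub_Qp_le (h : IsEigenDecomp A W mu) (hr : r < n) :
    ‖A * (1 - Qp W r)‖ ≤ |mu ⟨r, hr⟩| := by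
  rw [one_sub_Qp h]
  have : A = fnW W mu := h.2.1
  rw [this, fnW_mul h.1]
  apply norm_fnW_le h.1 _ (abs_nonneg _)
  intro i; split_ifs with hi
  · simp
  · simp only [mul_one]; apply h.2.2; rw [Fin.le_def]; simp; omega

lemma norm_A_le (h : IsEigenDecomp A W mu) (hn : 0 < n) : ‖A‖ ≤ |mu ⟨0, hn⟩| := by
  have : A = fnW W mu := h.2.1
  rw [this]
  apply norm_fnW_le h.1 _ (abs_nonneg _)
  intro i; apply h.2.2; rw [Fin.le_def]; simp

lemma le_mu_of_le (h : IsEigenDecomp A W mu) (hr1 : 1 ≤ r) (hr : r - 1 < n) {m : ℝ}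
    (hm : m ≤ |mu ⟨r - 1, hr⟩|) : ∀ i : Fin n, (i : ℕ) < r → m ≤ |mu i| := by
  intro i hi
  refine hm.trans (h.2.2 _ _ ?_)
  rw [Fin.le_def]; simp; omega

/-- Squared norm of `A x` in the eigenbasis. -/
lemma dot_fnW {W : Matrix (Fin n) (Fin n) ℝ} (hW : W * Wᵀ = 1) (g : Fin n → ℝ) (x : Fin n → ℝ) :
    (fnW W g *ᵥ x) ⬝ᵥ (fnW W g *ᵥ x) = ∑ i, (g i) ^ 2 * ((Wᵀ *ᵥ x) i) ^ 2 := by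
  have hW' : Wᵀ * W = 1 := mul_eq_one_comm.mp hW
  unfold fnW
  rw [← Matrix.mulVec_mulVec, ← Matrix.mulVec_mulVec, Matrix.dotProduct_mulVec,
    Matrix.vecMul_mulVec, hW', Matrix.vecMul_one]
  simp only [dotProduct, Matrix.mulVec_diagonal]
  refine Finset.sum_congr rfl fun i _ => by ring

lemma sq_norm_toLp (x : Fin n → ℝ) : ‖(WithLp.toLp 2 x : EuclideanSpace ℝ (Fin n))‖ ^ 2 = x ⬝ᵥ x := by
  rw [EuclideanSpace.real_norm_sq_eq]
  simp [dotProduct, pow_two]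

/-- Weyl's inequality for singular values of symmetric matrices. -/
lemma weyl {P V : Matrix (Fin n) (Fin n) ℝ} {lam : Fin n → ℝ}
    (hP : IsEigenDecomp P V lam) (hA : IsEigenDecomp A W mu) (k : Fin n) :
    |lam k| ≤ |mu k| + ‖A - P‖ := by
  have hV' : Vᵀ * V = 1 := mul_eq_one_comm.mp hP.1
  -- a nonzero coefficient vector
  let J : Matrix (Fin n) (Fin (k + 1)) ℝ := fun i j => if (i : ℕ) = j then 1 else 0
  let T : (Fin (k + 1) → ℝ) →ₗ[ℝ] (Fin k → ℝ) :=
    (LinearMap.funLeft ℝ ℝ (Fin.castLE k.2.le : Fin k → Fin n)) ∘ₗ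
      (Matrix.toLin' (Wᵀ * V * J))
  have hT : LinearMap.ker T ≠ ⊥ := by
    apply LinearMap.ker_ne_bot_of_finrank_lt
    simp
  obtain ⟨c, hcT, hc0⟩ := (Submodule.ne_bot_iff _).mp hT
  rw [LinearMap.mem_ker] at hcT
  set d : Fin n → ℝ := J *ᵥ c with hd
  have hdk : ∀ i : Fin n, k < i → d i = 0 := by
    intro i hi
    simp only [hd, Matrix.mulVec, dotProduct]
    apply Finset.sum_eq_zero
    intro j _
    have : (i : ℕ) ≠ j := by have := j.2; rw [Fin.lt_def] at hi; omega
    simp [J, this]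
  have hdc : ∀ j : Fin (k+1), d (Fin.castLE k.2 j) = c j := by
    intro j
    simp only [hd, Matrix.mulVec, dotProduct]
    rw [Finset.sum_eq_single j]
    · simp [J]
    · intro b _ hb
      have : (j : ℕ) ≠ b := fun h => hb (Fin.ext h.symm)
      simp [J, this]
    · simp
  have hd0 : d ≠ 0 := by
    intro h; apply hc0; ext j; rw [← hdc j, h]; rfl
  set x := V *ᵥ d with hx
  have hVx : Vᵀ *ᵥ x = d := by rw [hx, Matrix.mulVec_mulVec, hV', Matrix.one_mulVec]
  have hWx : ∀ i : Fin n, i < k → (Wᵀ *ᵥ x) i = 0 := by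
    intro i hi
    have := congrFun hcT ⟨i, hi⟩
    simp only [T, LinearMap.comp_apply, LinearMap.funLeft_apply, Matrix.toLin'_apply] at this
    rw [hx, hd, Matrix.mulVec_mulVec, Matrix.mulVec_mulVec]
    exact this
  have hxx : x ⬝ᵥ x = ∑ i, (d i)^2 := by
    have := dot_fnW hP.1 (fun _ => 1) x
    rw [fnW_one hP.1, Matrix.one_mulVec, hVx] at this
    simpa using this
  have hxx2 : x ⬝ᵥ x = ∑ i, ((Wᵀ *ᵥ x) i)^2 := by
    have := dot_fnW hA.1 (fun _ => 1) x
    rw [fnW_one hA.1, Matrix.one_mulVec] at this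
    simpa using this
  have hxpos : 0 < x ⬝ᵥ x := by
    rw [hxx]
    obtain ⟨i, hi⟩ := Function.ne_iff.mp hd0
    have hi' : d i ≠ 0 := hi
    exact Finset.sum_pos' (fun _ _ => sq_nonneg _) ⟨i, Finset.mem_univ _, by positivity⟩
  set X : EuclideanSpace ℝ (Fin n) := WithLp.toLp 2 x with hX
  have hXn : ‖X‖ ^ 2 = x ⬝ᵥ x := sq_norm_toLp x
  have hXpos : 0 < ‖X‖ := by
    rcases (norm_nonneg X).lt_or_eq with h | h
    · exact h
    · rw [← h] at hXn; simp at hXn; linarith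
  have hPx : |lam k| * ‖X‖ ≤ ‖(WithLp.toLp 2 (P *ᵥ x) : EuclideanSpace ℝ (Fin n))‖ := by
    apply le_of_sq_le_sq _ (norm_nonneg _)
    rw [sq_norm_toLp, mul_pow, hXn, sq_abs, hxx]
    have : P = fnW V lam := hP.2.1
    rw [this, dot_fnW hP.1, hVx, Finset.mul_sum]
    apply Finset.sum_le_sum
    intro i _
    by_cases hi : k < i
    · rw [hdk i hi]; simp
    · gcongr ?_ * _
      exact sq_le_sq.mpr (hP.2.2 _ _ (not_lt.mp hi))
  have hAx : ‖(WithLp.toLp 2 (A *ᵥ x) : EuclideanSpace ℝ (Fin n))‖ ≤ |mu k| * ‖X‖ := by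
    apply le_of_sq_le_sq _ (by positivity)
    rw [sq_norm_toLp, mul_pow, hXn, sq_abs, hxx2]
    have : A = fnW W mu := hA.2.1
    rw [this, dot_fnW hA.1, Finset.mul_sum]
    apply Finset.sum_le_sum
    intro i _
    by_cases hi : i < k
    · rw [hWx i hi]; simp
    · gcongr ?_ * _
      exact sq_le_sq.mpr (hA.2.2 _ _ (not_lt.mp hi))
  have hEx : ‖(WithLp.toLp 2 ((A - P) *ᵥ x) : EuclideanSpace ℝ (Fin n))‖ ≤ ‖A - P‖ * ‖X‖ :=
    Matrix.l2_opNorm_mulVec (A - P) X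
  have hsub : (WithLp.toLp 2 (P *ᵥ x) : EuclideanSpace ℝ (Fin n)) =
      WithLp.toLp 2 (A *ᵥ x) - WithLp.toLp 2 ((A - P) *ᵥ x) := by
    rw [← WithLp.toLp_sub, Matrix.sub_mulVec]; simp
  have h4 := norm_sub_le (WithLp.toLp 2 (A *ᵥ x) : EuclideanSpace ℝ (Fin n)) (WithLp.toLp 2 ((A - P) *ᵥ x))
  rw [← hsub] at h4
  have : |lam k| * ‖X‖ ≤ (|mu k| + ‖A - P‖) * ‖X‖ := by rw [add_mul]; linarith
  exact le_of_mul_le_mul_right this hXpos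

end PartA

section PartA2
open scoped Matrix.Norms.L2Operator
variable {n : ℕ}

local notation "Mat" => Matrix (Fin n) (Fin n) ℝ

lemma nmul (A B : Mat) : ‖A * B‖ ≤ ‖A‖ * ‖B‖ := Matrix.l2_opNorm_mul _ _

/-- One-sided Davis-Kahan. -/
lemma davis_kahan {A B W W' : Mat} {mu mu' : Fin n → ℝ} {r : ℕ}
    (hA : IsEigenDecomp A W mu) (hB : IsEigenDecomp B W' mu') (hr1 : 1 ≤ r) (hr : r < n)
    {l : ℝ} (hl : 0 < l) (h1 : |mu ⟨r, hr⟩| ≤ l / 8)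
    (h2 : l / 2 ≤ |mu' ⟨r - 1, by omega⟩|) :
    ‖(1 - Qp W r) * Qp W' r‖ ≤ 4 / l * ‖(A - B) * Qp W' r‖ := by
  have hm := le_mu_of_le hB hr1 (by omega) h2
  have hG : ‖Gp W' mu' r‖ ≤ (l / 2)⁻¹ := norm_Gp_le hB (by positivity) hm
  have hBG : B * Gp W' mu' r = Qp W' r := A_mul_Gp hB (fun i hi h0 => by
    have := hm i hi; rw [h0, abs_zero] at this; linarith)
  have hQG := Qp_mul_Gp (r := r) hB
  have hA1 := (norm_A_one_sub_Qp_le hA hr).trans h1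
  set Q := Qp W r
  set Q' := Qp W' r
  set G := Gp W' mu' r
  have hc : Q * A = A * Q := Qp_mul_A hA
  have key : (1 - Q) * Q' = A * (1 - Q) * ((1 - Q) * Q') * G - (1 - Q) * ((A - B) * Q') * G := by
    have hQQ : (1 - Q) * (1 - Q) = 1 - Q := by
      have : Q * Q = Q := Qp_mul_self hA
      noncomm_ring; rw [this]; abel
    have e1 : A * (1 - Q) * ((1 - Q) * Q') * G = (1 - Q) * A * Q' * G := by
      have : (1 - Q) * A = A * (1 - Q) := by rw [sub_mul, mul_sub, hc]; simp
      rw [this]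
      calc A * (1 - Q) * ((1 - Q) * Q') * G = A * ((1 - Q) * (1 - Q)) * Q' * G := by noncomm_ring
        _ = _ := by rw [hQQ]
    rw [e1]
    calc (1 - Q) * Q' = (1 - Q) * (B * G) := by rw [hBG]
      _ = (1 - Q) * (B * (Q' * G)) := by rw [hQG]
      _ = _ := by noncomm_ring
  have hQn : ‖1 - Q‖ ≤ 1 := norm_one_sub_Qp_le hA
  set X := (1 - Q) * Q'
  have b1 : ‖A * (1 - Q) * X * G‖ ≤ (l / 8) * ‖X‖ * (l / 2)⁻¹ := by
    refine (nmul _ _).trans ?_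
    gcongr
    refine (nmul _ _).trans ?_
    gcongr
  have b2 : ‖(1 - Q) * ((A - B) * Q') * G‖ ≤ (1 * ‖(A - B) * Q'‖) * (l / 2)⁻¹ := by
    refine (nmul _ _).trans ?_
    gcongr
    refine (nmul _ _).trans ?_
    gcongr
  have b3 : ‖X‖ ≤ (l / 8) * ‖X‖ * (l / 2)⁻¹ + (1 * ‖(A - B) * Q'‖) * (l / 2)⁻¹ := by
    calc ‖X‖ = ‖A * (1 - Q) * X * G - (1 - Q) * ((A - B) * Q') * G‖ := by rw [← key]
      _ ≤ _ := (norm_sub_le _ _).trans (add_le_add b1 b2)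
  have e2 : (l / 8) * ‖X‖ * (l / 2)⁻¹ = ‖X‖ / 4 := by field_simp; ring
  have e3 : (1 * ‖(A - B) * Q'‖) * (l / 2)⁻¹ = 2 / l * ‖(A - B) * Q'‖ := by field_simp
  have e4 : 4 / l * ‖(A - B) * Q'‖ = 2 * (2 / l * ‖(A - B) * Q'‖) := by ring
  have : 0 ≤ 2 / l * ‖(A - B) * Q'‖ := by positivity
  rw [e2, e3] at b3
  rw [e4]; linarith

/-- row bound of the spectral projection -/
lemma row_Qp {A W : Mat} {mu : Fin n → ℝ} {r : ℕ}
    (hA : IsEigenDecomp A W mu) (hr1 : 1 ≤ r) (hr : r < n)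
    {l : ℝ} (hl : 0 < l) (h2 : l / 2 ≤ |mu ⟨r - 1, by omega⟩|) (i : Fin n) :
    ‖Dm i * Qp W r‖ ≤ 2 / l * ‖Dm i * A * Qp W r‖ := by
  have hm := le_mu_of_le hA hr1 (by omega) h2
  have hG : ‖Gp W mu r‖ ≤ (l / 2)⁻¹ := norm_Gp_le hA (by positivity) hm
  have hAG : A * Gp W mu r = Qp W r := A_mul_Gp hA (fun i hi h0 => by
    have := hm i hi; rw [h0, abs_zero] at this; linarith)
  have hQG := Qp_mul_Gp (r := r) hA
  have e : Dm i * Qp W r = (Dm i * A * Qp W r) * Gp W mu r := by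
    calc Dm i * Qp W r = Dm i * (A * Gp W mu r) := by rw [hAG]
      _ = Dm i * (A * (Qp W r * Gp W mu r)) := by rw [hQG]
      _ = _ := by noncomm_ring
  rw [e]
  refine (nmul _ _).trans ?_
  rw [mul_comm, show 2 / l = (l / 2)⁻¹ by field_simp]
  gcongr

/-- The leave-one-out matrix. -/
def looMat (P E : Mat) (i : Fin n) : Mat := P + (1 - Dm i) * E * (1 - Dm i)

lemma Dm_mul_Dm (i : Fin n) : (Dm i : Mat) * Dm i = Dm i := by
  unfold Dm
  rw [Matrix.diagonal_mul_diagonal]; congr 1; ext j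
  by_cases h : j = i
  · subst h; simp
  · simp [h]

lemma x_algebra {t x y π z : ℝ} (ht0 : 0 ≤ t) (ht : t ≤ 1 / 16) (hx0 : 0 ≤ x) (hπ0 : 0 ≤ π)
    (h1 : x ≤ y + 4 * t * (x + z)) (h5 : z ≤ 2 * t * (π + x)) : x ≤ 2 * y + t * π := by
  have h6 : 4 * t * (x + z) ≤ 4 * t * (x + 2 * t * (π + x)) := by gcongr
  have h7 : t * x ≤ x / 16 := by nlinarith
  have h9 : t * (t * x) ≤ x / 256 := by nlinarith
  have h11 : 0 ≤ t * π := by positivity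
  have h10 : t * (t * π) ≤ t * π / 16 := by nlinarith
  nlinarith

set_option maxHeartbeats 1000000 in
lemma det_bound (hn : 0 < n) {P E V W : Mat} {lam mu : Fin n → ℝ} {r : ℕ}
    (hP : IsEigenDecomp P V lam) (hA : IsEigenDecomp (P + E) W mu)
    (W' : Fin n → Mat) (mu' : Fin n → Fin n → ℝ)
    (hA' : ∀ i, IsEigenDecomp (looMat P E i) (W' i) (mu' i))
    (hr1 : 1 ≤ r) (hr : r < n) {l : ℝ} (hl : 0 < l)
    (hl1 : l = |lam ⟨r - 1, by omega⟩|) (hτ : |lam ⟨r, hr⟩| ≤ l / 16) (hε : ‖E‖ ≤ l / 16)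
    {α β u : ℝ} (hβ : 0 ≤ β) (hβl : β * (8 / l) ≤ 1 / 2)
    (hy : ∀ i b, (∀ j, ‖Dm j * Qp (W' i) r‖ ≤ b) → ‖Dm i * E * Qp (W' i) r‖ ≤ α + β * b)
    (hu : ∀ i, ‖Dm i * Qp V r‖ ≤ u) :
    ∀ i, ‖Dm i * ((P + E) * Qp W r - P)‖ ≤
      4 * α + (32 * β / l + ‖E‖ / l) * (u * |lam ⟨0, hn⟩| + |lam ⟨r, hr⟩|)
        + u * (|lam ⟨r, hr⟩| + 2 * ‖E‖) + |lam ⟨r, hr⟩| := by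
  set ε := ‖E‖ with hεdef
  set τ := |lam ⟨r, hr⟩| with hτdef
  have hε0 : 0 ≤ ε := norm_nonneg _
  have hτ0 : 0 ≤ τ := abs_nonneg _
  set M := u * |lam ⟨0, hn⟩| + τ with hM
  -- rows of P
  have hPQ : ‖P * (1 - Qp V r)‖ ≤ τ := norm_A_one_sub_Qp_le hP hr
  have hDn := fun i : Fin n => norm_Dm_le i
  have hπ : ∀ i, ‖Dm i * P‖ ≤ M := by
    intro i
    have e : Dm i * P = Dm i * Qp V r * P + Dm i * (P * (1 - Qp V r)) := by
      have := Qp_mul_A (r := r) hP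
      rw [Matrix.mul_assoc (Dm i) (Qp V r) P, this]; noncomm_ring
    rw [e]
    refine (norm_add_le _ _).trans (add_le_add ?_ ?_)
    · exact (nmul _ _).trans (mul_le_mul (hu i) (norm_A_le hP hn) (norm_nonneg _)
        ((norm_nonneg _).trans (hu i)))
    · refine (nmul _ _).trans ?_
      calc _ ≤ 1 * τ := mul_le_mul (hDn i) hPQ (norm_nonneg _) zero_le_one
        _ = τ := one_mul _
  have hM0 : 0 ≤ M := (norm_nonneg _).trans (hπ ⟨0, hn⟩)
  have hloo : ∀ i, ‖looMat P E i - P‖ ≤ ε := by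
    intro i
    unfold looMat
    rw [add_sub_cancel_left]
    have := norm_one_sub_Dm_le i
    refine (nmul _ _).trans ?_
    calc _ ≤ ‖(1 - Dm i) * E‖ * 1 := by gcongr
      _ ≤ (‖1 - Dm i‖ * ‖E‖) * 1 := by gcongr; exact nmul _ _
      _ ≤ (1 * ε) * 1 := by gcongr
      _ = ε := by ring
  have hAP : ‖P + E - P‖ ≤ ε := by rw [add_sub_cancel_left]
  have wy1 : ∀ {B W1 : Mat} {m1 : Fin n → ℝ}, IsEigenDecomp B W1 m1 → ‖B - P‖ ≤ ε →
      l / 2 ≤ |m1 ⟨r - 1, by omega⟩| := by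
    intro B W1 m1 h h'
    have := weyl hP h ⟨r - 1, by omega⟩
    rw [← hl1] at this; linarith
  have wy2 : ∀ {B W1 : Mat} {m1 : Fin n → ℝ}, IsEigenDecomp B W1 m1 → ‖B - P‖ ≤ ε →
      |m1 ⟨r, hr⟩| ≤ τ + ε := by
    intro B W1 m1 h h'
    have := weyl h hP ⟨r, hr⟩
    rw [norm_sub_rev] at this; linarith
  have m1 := wy1 hA hAP
  have m2 := wy2 hA hAP
  have m1' := fun i => wy1 (hA' i) (hloo i)
  have m2' := fun i => wy2 (hA' i) (hloo i)
  -- the difference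
  have hΔ : ∀ (i : Fin n) (X : Mat), ‖((P + E) - looMat P E i) * X‖ ≤
      ‖Dm i * E * X‖ + ε * ‖Dm i * X‖ := by
    intro i X
    have e : ((P + E) - looMat P E i) * X = Dm i * E * X + (1 - Dm i) * E * (Dm i * X) := by
      unfold looMat; noncomm_ring
    rw [e]
    refine (norm_add_le _ _).trans ?_
    gcongr
    refine (nmul _ _).trans ?_
    gcongr
    refine (nmul _ _).trans ?_
    calc _ ≤ 1 * ‖E‖ := by gcongr; exact norm_one_sub_Dm_le i
      _ = ε := one_mul _
  have hQn : ‖Qp W r‖ ≤ 1 := norm_Qp_le hA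
  have hQn' : ∀ i, ‖Qp (W' i) r‖ ≤ 1 := fun i => norm_Qp_le (hA' i)
  have hεl : ε / l ≤ 1 / 16 := by rw [div_le_iff₀ hl]; linarith
  have hεl0 : 0 ≤ ε / l := by positivity
  -- q
  have hq : ∀ i, ‖Dm i * Qp W r‖ ≤ 2 / l * (‖Dm i * P‖ + ‖Dm i * E * Qp W r‖) := by
    intro i
    refine (row_Qp hA hr1 hr hl m1 i).trans ?_
    gcongr
    have e : Dm i * (P + E) * Qp W r = Dm i * P * Qp W r + Dm i * E * Qp W r := by noncomm_ring
    rw [e]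
    refine (norm_add_le _ _).trans ?_
    gcongr
    refine (nmul _ _).trans ?_
    calc _ ≤ ‖Dm i * P‖ * 1 := by gcongr
      _ = _ := mul_one _
  have hq' : ∀ i, ‖Dm i * Qp (W' i) r‖ ≤ 2 / l * ‖Dm i * P‖ := by
    intro i
    refine (row_Qp (hA' i) hr1 hr hl (m1' i) i).trans ?_
    gcongr
    have hz : Dm i * looMat P E i = Dm i * P := by
      unfold looMat
      have := Dm_mul_Dm i
      have h3 : Dm i * (1 - Dm i) = (0 : Mat) := by rw [mul_sub, this]; simp
      rw [mul_add, ← Matrix.mul_assoc, ← Matrix.mul_assoc, h3]; simp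
    rw [hz]
    refine (nmul _ _).trans ?_
    calc _ ≤ ‖Dm i * P‖ * 1 := by gcongr; exact hQn' i
      _ = _ := mul_one _
  -- x
  have hx : ∀ i, ‖Dm i * E * Qp W r‖ ≤ 2 * ‖Dm i * E * Qp (W' i) r‖ + ε / l * ‖Dm i * P‖ := by
    intro i
    have dk := davis_kahan (hA' i) hA hr1 hr hl (by linarith [m2' i]) m1
    have h1 := hΔ i (Qp W r)
    rw [← norm_neg, ← neg_mul, neg_sub] at h1
    have e : Dm i * E * Qp W r = Dm i * E * Qp (W' i) r * Qp W r +
        Dm i * E * ((1 - Qp (W' i) r) * Qp W r) := by noncomm_ring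
    have hDE : ‖Dm i * E‖ ≤ ε := by
      refine (nmul _ _).trans ?_
      calc _ ≤ 1 * ‖E‖ := by gcongr; exact hDn i
        _ = ε := one_mul _
    have h2 : ‖Dm i * E * Qp W r‖ ≤ ‖Dm i * E * Qp (W' i) r‖ * 1 +
        ε * ‖(1 - Qp (W' i) r) * Qp W r‖ := by
      conv_lhs => rw [e]
      refine (norm_add_le _ _).trans (add_le_add ?_ ?_)
      · refine (nmul _ _).trans ?_
        gcongr
      · refine (nmul _ _).trans ?_
        gcongr
    have h3 := hq i
    set x := ‖Dm i * E * Qp W r‖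
    set y := ‖Dm i * E * Qp (W' i) r‖
    set q := ‖Dm i * Qp W r‖
    set π := ‖Dm i * P‖
    have hx0 : 0 ≤ x := norm_nonneg _
    have hπ0 : 0 ≤ π := norm_nonneg _
    have hy0 : 0 ≤ y := norm_nonneg _
    have h4 : ε * ‖(1 - Qp (W' i) r) * Qp W r‖ ≤ 4 * (ε / l) * (x + ε * q) := by
      calc _ ≤ ε * (4 / l * (x + ε * q)) := by gcongr; exact dk.trans (by gcongr)
        _ = _ := by ring
    have h5 : ε * q ≤ 2 * (ε / l) * (π + x) := by
      calc _ ≤ ε * (2 / l * (π + x)) := by gcongr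
        _ = _ := by ring
    exact x_algebra hεl0 hεl hx0 hπ0 (by linarith) h5
  -- maximum of y
  have hne : (Finset.univ : Finset (Fin n)).Nonempty := ⟨⟨0, hn⟩, Finset.mem_univ _⟩
  obtain ⟨i₀, -, hmax⟩ := Finset.exists_max_image Finset.univ
    (fun i => ‖Dm i * E * Qp (W' i) r‖) hne
  set Y := ‖Dm i₀ * E * Qp (W' i₀) r‖ with hY
  have hY0 : 0 ≤ Y := norm_nonneg _
  have hyY : ∀ i, ‖Dm i * E * Qp (W' i) r‖ ≤ Y := fun i => hmax i (Finset.mem_univ _)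
  have hxY : ∀ i, ‖Dm i * E * Qp W r‖ ≤ 2 * Y + ε / l * M := by
    intro i
    refine (hx i).trans ?_
    gcongr
    · exact hyY i
    · exact hπ i
  have hb : ∀ j, ‖Dm j * Qp (W' i₀) r‖ ≤ 8 / l * (Y + M) := by
    intro j
    have dk := davis_kahan hA (hA' i₀) hr1 hr hl (by linarith) (m1' i₀)
    have h1 := hΔ i₀ (Qp (W' i₀) r)
    have e : Dm j * Qp (W' i₀) r = Dm j * Qp W r * Qp (W' i₀) r +
        Dm j * ((1 - Qp W r) * Qp (W' i₀) r) := by noncomm_ring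
    have h2 : ‖Dm j * Qp (W' i₀) r‖ ≤ ‖Dm j * Qp W r‖ * 1 +
        1 * ‖(1 - Qp W r) * Qp (W' i₀) r‖ := by
      conv_lhs => rw [e]
      refine (norm_add_le _ _).trans (add_le_add ?_ ?_)
      · refine (nmul _ _).trans ?_
        gcongr
        exact hQn' i₀
      · refine (nmul _ _).trans ?_
        gcongr
        exact hDn j
    have h3 := (hq j).trans (mul_le_mul_of_nonneg_left (add_le_add (hπ j) (hxY j))
      (by positivity : 0 ≤ 2 / l))
    have h4 : ε * ‖Dm i₀ * Qp (W' i₀) r‖ ≤ 2 * (ε / l) * M := by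
      calc _ ≤ ε * (2 / l * M) := by
            gcongr; exact (hq' i₀).trans (by gcongr; exact hπ i₀)
        _ = _ := by ring
    have h5 : ‖(1 - Qp W r) * Qp (W' i₀) r‖ ≤ 4 / l * (Y + 2 * (ε / l) * M) := by
      refine dk.trans ?_
      gcongr
      exact h1.trans (by gcongr)
    have h6 : ε / l * M ≤ M / 16 := by nlinarith
    have h7 : 2 / l * (M + (2 * Y + ε / l * M)) ≤ 2 / l * (M + (2 * Y + M / 16)) := by gcongr
    have h8 : 4 / l * (Y + 2 * (ε / l) * M) ≤ 4 / l * (Y + M / 8) := by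
      gcongr; linarith
    have h9 : 8 / l * (Y + M) = 2 / l * (M + (2 * Y + M / 16)) + 4 / l * (Y + M / 8) +
      1 / l * (8 * M - 2 * M - M / 8 - M / 2) := by ring
    have h10 : 0 ≤ 1 / l * (8 * M - 2 * M - M / 8 - M / 2) := by
      apply mul_nonneg (by positivity); linarith
    linarith
  have hYb : Y ≤ 2 * α + 16 * β / l * M := by
    have := hy i₀ _ hb
    have e : β * (8 / l * (Y + M)) = β * (8 / l) * Y + 8 * β / l * M := by ring
    rw [e] at this
    have h2 : β * (8 / l) * Y ≤ 1 / 2 * Y := by gcongr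
    have h3 : 16 * β / l * M = 2 * (8 * β / l * M) := by ring
    linarith
  intro i
  have e : Dm i * ((P + E) * Qp W r - P) =
      Dm i * E * Qp W r - (Dm i * Qp V r * (P * (1 - Qp W r)) + Dm i * (P * (1 - Qp V r) * (1 - Qp W r))) := by
    have := Qp_mul_A (r := r) hP
    have h2 : Dm i * Qp V r * (P * (1 - Qp W r)) = Dm i * (P * Qp V r) * (1 - Qp W r) := by
      rw [← this]; noncomm_ring
    rw [h2]; noncomm_ring
  rw [e]
  have hPW : ‖P * (1 - Qp W r)‖ ≤ τ + 2 * ε := by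
    have e2 : P * (1 - Qp W r) = (P + E) * (1 - Qp W r) - E * (1 - Qp W r) := by noncomm_ring
    rw [e2]
    have h1 := norm_A_one_sub_Qp_le hA hr
    have h2 : ‖E * (1 - Qp W r)‖ ≤ ε * 1 := by
      refine (nmul _ _).trans ?_
      gcongr
      exact norm_one_sub_Qp_le hA
    have := norm_sub_le ((P + E) * (1 - Qp W r)) (E * (1 - Qp W r))
    linarith
  have t1 : ‖Dm i * Qp V r * (P * (1 - Qp W r))‖ ≤ u * (τ + 2 * ε) :=
    (nmul _ _).trans (mul_le_mul (hu i) hPW (norm_nonneg _) ((norm_nonneg _).trans (hu i)))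
  have t2 : ‖Dm i * (P * (1 - Qp V r) * (1 - Qp W r))‖ ≤ τ := by
    refine (nmul _ _).trans ?_
    calc _ ≤ 1 * (τ * 1) := by
          gcongr
          · exact hDn i
          · refine (nmul _ _).trans ?_
            gcongr
            exact norm_one_sub_Qp_le hA
      _ = τ := by ring
  have t3 := norm_add_le (Dm i * Qp V r * (P * (1 - Qp W r))) (Dm i * (P * (1 - Qp V r) * (1 - Qp W r)))
  have t4 := norm_sub_le (Dm i * E * Qp W r) (Dm i * Qp V r * (P * (1 - Qp W r)) + Dm i * (P * (1 - Qp V r) * (1 - Qp W r)))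
  have t5 := hxY i
  have e3 : (32 * β / l + ε / l) * M = 2 * (16 * β / l * M) + ε / l * M := by ring
  rw [e3]
  linarith

end PartA2

section PartB

/-- finite product expectation -/
def Ex {ι S : Type} [Fintype ι] [DecidableEq ι] [Fintype S] (w : ι → S → ℝ)
    (f : (ι → S) → ℝ) : ℝ := ∑ x, (∏ e, w e (x e)) * f x

/-- finite product probability -/
def Pr {ι S : Type} [Fintype ι] [DecidableEq ι] [Fintype S] (w : ι → S → ℝ)
    (G : Set (ι → S)) : ℝ := Ex w (G.indicator 1)

section gen
variable {ι S : Type} [Fintype ι] [DecidableEq ι] [Fintype S] {w : ι → S → ℝ}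

lemma Ex_prod (w : ι → S → ℝ) (g : ι → S → ℝ) :
    Ex w (fun x => ∏ e, g e (x e)) = ∏ e, ∑ s, w e s * g e s := by
  unfold Ex
  rw [Finset.prod_univ_sum, Fintype.piFinset_univ]
  refine Finset.sum_congr rfl fun x _ => ?_
  rw [Finset.prod_mul_distrib]

lemma Ex_one (hw : ∀ e, ∑ s, w e s = 1) : Ex w (fun _ => 1) = 1 := by
  have := Ex_prod w (fun _ _ => 1)
  simpa [hw] using this

lemma Ex_mono (hw : ∀ e s, 0 ≤ w e s) {f g : (ι → S) → ℝ} (h : ∀ x, f x ≤ g x) :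
    Ex w f ≤ Ex w g := by
  unfold Ex
  refine Finset.sum_le_sum fun x _ => ?_
  exact mul_le_mul_of_nonneg_left (h x) (Finset.prod_nonneg fun e _ => hw _ _)

lemma Ex_sum {κ : Type*} (s : Finset κ) (f : κ → (ι → S) → ℝ) :
    Ex w (fun x => ∑ k ∈ s, f k x) = ∑ k ∈ s, Ex w (f k) := by
  unfold Ex
  rw [Finset.sum_comm]
  refine Finset.sum_congr rfl fun x _ => ?_
  rw [Finset.mul_sum]

lemma Ex_const_mul (c : ℝ) (f : (ι → S) → ℝ) : Ex w (fun x => c * f x) = c * Ex w f := by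
  unfold Ex
  rw [Finset.mul_sum]
  refine Finset.sum_congr rfl fun x _ => by ring

lemma Pr_union_le (hw : ∀ e s, 0 ≤ w e s) {κ : Type*} (s : Finset κ) (B : κ → Set (ι → S))
    (G : Set (ι → S)) (hG : ∀ x ∈ G, ∃ k ∈ s, x ∈ B k) :
    Pr w G ≤ ∑ k ∈ s, Pr w (B k) := by
  unfold Pr
  rw [← Ex_sum]
  apply Ex_mono hw
  intro x
  by_cases hx : x ∈ G
  · obtain ⟨k, hk, hkx⟩ := hG x hx
    have h0 : ∀ k ∈ s, 0 ≤ (B k).indicator (1 : (ι → S) → ℝ) x := fun k _ =>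
      Set.indicator_nonneg (fun _ _ => zero_le_one) _
    have := Finset.single_le_sum h0 hk
    simp only [Set.indicator_of_mem hx]
    simpa [Set.indicator_of_mem hkx] using this
  · rw [Set.indicator_of_notMem hx]
    exact Finset.sum_nonneg fun k _ => Set.indicator_nonneg (fun _ _ => zero_le_one) _

lemma Pr_le_Ex (hw : ∀ e s, 0 ≤ w e s) (G : Set (ι → S)) (f : (ι → S) → ℝ)
    (h0 : ∀ x, 0 ≤ f x) (h1 : ∀ x ∈ G, 1 ≤ f x) : Pr w G ≤ Ex w f := by
  apply Ex_mono hw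
  intro x
  by_cases hx : x ∈ G
  · rw [Set.indicator_of_mem hx]; exact h1 x hx
  · rw [Set.indicator_of_notMem hx]; exact h0 x

lemma Ex_cond (hw : ∀ e s, 0 ≤ w e s) (hw1 : ∀ e, ∑ s, w e s = 1)
    (p : ι → Prop) [DecidablePred p]
    (F : (ι → S) → ℝ) (B : ℝ)
    (h : ∀ z : {e // ¬ p e} → S, ∑ y : {e // p e} → S, (∏ e, w e.1 (y e)) *
      F ((Equiv.piEquivPiSubtypeProd p (fun _ => S)).symm (y, z)) ≤ B) :
    Ex w F ≤ B := by
  unfold Ex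
  rw [← (Equiv.piEquivPiSubtypeProd p (fun _ => S)).symm.sum_comp, Fintype.sum_prod_type_right]
  have key : ∀ (z : {e // ¬ p e} → S) (y : {e // p e} → S),
      ∏ e, w e ((Equiv.piEquivPiSubtypeProd p (fun _ => S)).symm (y, z) e) =
      (∏ e, w e.1 (z e)) * ∏ e, w e.1 (y e) := by
    intro z y
    rw [← Fintype.prod_subtype_mul_prod_subtype p, mul_comm]
    congr 1
    · refine Finset.prod_congr rfl fun e _ => ?_
      simp [Equiv.piEquivPiSubtypeProd, e.2]
    · refine Finset.prod_congr rfl fun e _ => ?_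
      simp [Equiv.piEquivPiSubtypeProd, e.2]
  have h2 : ∀ z : {e // ¬ p e} → S,
      ∑ y : {e // p e} → S, (∏ e, w e ((Equiv.piEquivPiSubtypeProd p (fun _ => S)).symm (y, z) e)) *
        F ((Equiv.piEquivPiSubtypeProd p (fun _ => S)).symm (y, z)) ≤ (∏ e, w e.1 (z e)) * B := by
    intro z
    simp_rw [key z, mul_assoc]
    rw [← Finset.mul_sum]
    exact mul_le_mul_of_nonneg_left (h z) (Finset.prod_nonneg fun e _ => hw _ _)
  refine (Finset.sum_le_sum fun z _ => h2 z).trans ?_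
  rw [← Finset.sum_mul]
  have : ∑ z : {e // ¬ p e} → S, ∏ e, w e.1 (z e) = 1 := by
    have := Ex_one (w := fun (e : {e // ¬ p e}) s => w e.1 s) (fun e => hw1 e.1)
    simpa [Ex] using this
  rw [this, one_mul]

end gen

/-- pairs -/
abbrev Pair (n : ℕ) : Type := {q : Fin n × Fin n // q.1 < q.2}

variable {n : ℕ}

/-- symmetric hollow matrix from values on pairs -/
def symM (v : Pair n → ℝ) : Matrix (Fin n) (Fin n) ℝ := fun i j =>
  if h : i < j then v ⟨(i, j), h⟩ else if h : j < i then v ⟨(j, i), h⟩ else 0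

lemma symM_symm (v : Pair n → ℝ) : (symM v)ᵀ = symM v := by
  ext i j
  simp only [symM, Matrix.transpose_apply]
  rcases lt_trichotomy i j with h | h | h
  · simp [h, not_lt.mpr h.le]
  · subst h; simp
  · simp [h, not_lt.mpr h.le]

lemma symM_eq_sum (v : Pair n → ℝ) (i j : Fin n) :
    symM v i j = ∑ e : Pair n, v e * ((if e.1.1 = i then (if e.1.2 = j then 1 else 0) else 0)
      + (if e.1.2 = i then (if e.1.1 = j then 1 else 0) else 0)) := by
  unfold symM
  rcases lt_trichotomy i j with h | h | h
  · rw [dif_pos h, Finset.sum_eq_single ⟨(i, j), h⟩]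
    · simp [h.ne']
    · rintro ⟨⟨a, b⟩, hab⟩ _ hne
      have h1 : ¬ (a = i ∧ b = j) := by rintro ⟨rfl, rfl⟩; exact hne rfl
      have h2 : ¬ (b = i ∧ a = j) := by rintro ⟨rfl, rfl⟩; exact absurd h (not_lt.mpr (le_of_lt hab))
      simp only [mul_eq_zero]
      right
      split_ifs <;> simp_all
    · simp
  · subst h
    rw [dif_neg (lt_irrefl _), dif_neg (lt_irrefl _)]
    symm
    apply Finset.sum_eq_zero
    rintro ⟨⟨a, b⟩, hab⟩ _
    have h1 : ¬ (a = i ∧ b = i) := by rintro ⟨rfl, rfl⟩; exact absurd hab (lt_irrefl _)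
    have h2 : ¬ (b = i ∧ a = i) := by rintro ⟨rfl, rfl⟩; exact absurd hab (lt_irrefl _)
    simp only [mul_eq_zero]
    right
    split_ifs <;> simp_all
  · rw [dif_neg (not_lt.mpr h.le), dif_pos h, Finset.sum_eq_single ⟨(j, i), h⟩]
    · simp [h.ne]
    · rintro ⟨⟨a, b⟩, hab⟩ _ hne
      have h1 : ¬ (b = i ∧ a = j) := by rintro ⟨rfl, rfl⟩; exact hne rfl
      have h2 : ¬ (a = i ∧ b = j) := by rintro ⟨rfl, rfl⟩; exact absurd h (not_lt.mpr (le_of_lt hab))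
      simp only [mul_eq_zero]
      right
      split_ifs <;> simp_all
    · simp

/-- coefficient of pair `e` in row `i` -/
def coef (i : Fin n) (W : Fin n → ℝ) (e : Pair n) : ℝ :=
  (if e.1.1 = i then W e.1.2 else 0) + (if e.1.2 = i then W e.1.1 else 0)

lemma row_sum_eq (v : Pair n → ℝ) (i : Fin n) (W : Fin n → ℝ) :
    ∑ j, symM v i j * W j = ∑ e, v e * coef i W e := by
  simp_rw [symM_eq_sum, Finset.sum_mul]
  rw [Finset.sum_comm]
  refine Finset.sum_congr rfl fun e _ => ?_
  simp_rw [mul_assoc]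
  rw [← Finset.mul_sum]
  congr 1
  unfold coef
  simp_rw [add_mul, ite_mul, zero_mul, one_mul]
  rw [Finset.sum_add_distrib]
  congr 1
  · split_ifs <;> simp
  · split_ifs <;> simp

lemma coef_sq (i : Fin n) (W : Fin n → ℝ) (e : Pair n) :
    (coef i W e) ^ 2 = coef i (fun j => (W j) ^ 2) e := by
  unfold coef
  obtain ⟨⟨a, b⟩, hab⟩ := e
  have : ¬ (a = i ∧ b = i) := by rintro ⟨rfl, rfl⟩; exact absurd hab (lt_irrefl _)
  split_ifs <;> simp_all

lemma coef_sq_sum_le (i : Fin n) (W : Fin n → ℝ) : ∑ e, (coef i W e) ^ 2 ≤ ∑ j, (W j) ^ 2 := by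
  simp_rw [coef_sq]
  have := row_sum_eq (fun _ => 1) i (fun j => (W j) ^ 2)
  simp only [one_mul] at this
  rw [← this]
  refine Finset.sum_le_sum fun j _ => ?_
  have : symM (fun _ => 1) i j ≤ 1 := by unfold symM; split_ifs <;> simp
  calc _ ≤ 1 * W j ^ 2 := by gcongr
    _ = _ := one_mul _

lemma abs_coef_le (i : Fin n) (W : Fin n → ℝ) {b : ℝ} (hb : 0 ≤ b) (hW : ∀ j, |W j| ≤ b)
    (e : Pair n) : |coef i W e| ≤ b := by
  unfold coef
  obtain ⟨⟨a, b'⟩, hab⟩ := e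
  have : ¬ (a = i ∧ b' = i) := by rintro ⟨rfl, rfl⟩; exact absurd hab (lt_irrefl _)
  split_ifs <;> simp_all

lemma coef_zero (i : Fin n) (W : Fin n → ℝ) (e : Pair n) (h : ¬ (e.1.1 = i ∨ e.1.2 = i)) :
    coef i W e = 0 := by
  unfold coef
  push Not at h
  simp [h.1, h.2]

lemma exp_sub_le (t : ℝ) : Real.exp t - 1 - t ≤ t ^ 2 * Real.exp |t| := by
  have h := Complex.norm_exp_sub_sum_le_norm_mul_exp (t : ℂ) 2
  have h2 : Complex.exp (t : ℂ) - ∑ m ∈ Finset.range 2, (t : ℂ) ^ m / (m.factorial : ℂ) =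
      ((Real.exp t - 1 - t : ℝ) : ℂ) := by
    simp [Finset.sum_range_succ]; ring
  rw [h2, Complex.norm_real, Complex.norm_real, Real.norm_eq_abs, Real.norm_eq_abs, sq_abs] at h
  exact (le_abs_self _).trans h

/-- Bernoulli weights -/
def bw (P : Matrix (Fin n) (Fin n) ℝ) (e : Pair n) (s : Bool) : ℝ :=
  if s then P e.1.1 e.1.2 else 1 - P e.1.1 e.1.2

/-- centred Bernoulli values -/
def bv (P : Matrix (Fin n) (Fin n) ℝ) (e : Pair n) (s : Bool) : ℝ :=
  (if s then 1 else 0) - P e.1.1 e.1.2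

lemma bern_mgf {p t : ℝ} :
    p * Real.exp (t * (1 - p)) + (1 - p) * Real.exp (t * (0 - p)) ≤
      Real.exp (p * (Real.exp t - 1 - t)) := by
  have h1 : p * Real.exp (t * (1 - p)) + (1 - p) * Real.exp (t * (0 - p)) =
      Real.exp (- (t * p)) * (p * (Real.exp t - 1) + 1) := by
    rw [show t * (1 - p) = - (t * p) + t by ring, Real.exp_add,
      show t * (0 - p) = - (t * p) by ring]; ring
  rw [h1, show p * (Real.exp t - 1 - t) = - (t * p) + p * (Real.exp t - 1) by ring, Real.exp_add]
  gcongr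
  exact Real.add_one_le_exp _

lemma bw_nonneg {P : Matrix (Fin n) (Fin n) ℝ} (hP : IsProbMatrix P) (e : Pair n) (s : Bool) :
    0 ≤ bw P e s := by
  unfold bw
  split_ifs
  · exact hP.2.1 _ _
  · linarith [hP.2.2.1 e.1.1 e.1.2]

lemma bw_sum (P : Matrix (Fin n) (Fin n) ℝ) (e : Pair n) : ∑ s, bw P e s = 1 := by
  simp [bw]

set_option maxHeartbeats 2000000 in
/-- conditional Chernoff bound for one row -/
lemma row_tail {P : Matrix (Fin n) (Fin n) ℝ} (hP : IsProbMatrix P) {p L H : ℝ}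
    (hp : 0 < p) (hPp : ∀ i j, P i j ≤ p) (hL : 0 < L) (hH : 0 < H) (i : Fin n)
    (W : (Pair n → Bool) → Fin n → ℝ) (b : (Pair n → Bool) → ℝ)
    (hW : ∀ x y, (∀ e : Pair n, ¬ (e.1.1 = i ∨ e.1.2 = i) → x e = y e) → W x = W y ∧ b x = b y)
    (hb0 : ∀ x, 0 ≤ b x) (hb : ∀ x j, |W x j| ≤ b x) (hW2 : ∀ x, ∑ j, (W x j) ^ 2 ≤ 1) :
    Pr (bw P) {x | (1 + Real.exp H) * Real.sqrt (p * L) + L * b x / H <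
      ∑ j, symM (fun e => bv P e (x e)) i j * W x j} ≤ Real.exp (-L) := by
  classical
  let s : (Pair n → Bool) → ℝ := fun x => (b x / H + Real.sqrt (p / L))⁻¹
  have hpL : 0 < Real.sqrt (p / L) := Real.sqrt_pos.mpr (by positivity)
  have hs0 : ∀ x, 0 < s x := fun x => by
    have := hb0 x
    simp only [s]; positivity
  have hsb : ∀ x, s x * b x ≤ H := by
    intro x
    have h1 := hb0 x
    simp only [s]
    rw [inv_mul_le_iff₀ (by positivity)]
    have : (b x / H + Real.sqrt (p / L)) * H = b x + Real.sqrt (p / L) * H := by field_simp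
    rw [this]
    nlinarith
  have hsp : ∀ x, s x * Real.sqrt (p / L) ≤ 1 := by
    intro x
    have h1 := hb0 x
    simp only [s]
    rw [inv_mul_le_iff₀ (by positivity)]
    have : 0 ≤ b x / H := by positivity
    linarith
  -- threshold
  have ht : ∀ x, L + p * (s x) ^ 2 * Real.exp H ≤
      s x * ((1 + Real.exp H) * Real.sqrt (p * L) + L * b x / H) := by
    intro x
    have e1 : Real.sqrt (p * L) = L * Real.sqrt (p / L) := by
      rw [show p * L = L ^ 2 * (p / L) by field_simp, Real.sqrt_mul (by positivity),
        Real.sqrt_sq hL.le]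
    have e2 : s x * (L * b x / H + L * Real.sqrt (p / L)) = L := by
      have h1 := hb0 x
      simp only [s]
      field_simp
    have e3 : p = L * Real.sqrt (p / L) ^ 2 := by
      rw [Real.sq_sqrt (by positivity)]; field_simp
    have e4 : p * (s x) ^ 2 ≤ s x * (L * Real.sqrt (p / L)) := by
      have := hsp x
      have h5 : p * (s x) ^ 2 = (s x * (L * Real.sqrt (p / L))) * (s x * Real.sqrt (p / L)) := by
        rw [show (s x * (L * Real.sqrt (p / L))) * (s x * Real.sqrt (p / L)) =
          (L * Real.sqrt (p / L) ^ 2) * (s x) ^ 2 by ring, ← e3]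
      rw [h5]
      have := hs0 x
      calc _ ≤ (s x * (L * Real.sqrt (p / L))) * 1 := by gcongr
        _ = _ := mul_one _
    rw [e1]
    have h6 := mul_le_mul_of_nonneg_right e4 (Real.exp_pos H).le
    nlinarith
  set F : (Pair n → Bool) → ℝ := fun x =>
    Real.exp (-(L + p * (s x) ^ 2 * Real.exp H)) *
      Real.exp (∑ e, s x * coef i (W x) e * bv P e (x e)) with hF
  have hPrF : Pr (bw P) {x | (1 + Real.exp H) * Real.sqrt (p * L) + L * b x / H <
      ∑ j, symM (fun e => bv P e (x e)) i j * W x j} ≤ Ex (bw P) F := by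
    apply Pr_le_Ex (bw_nonneg hP)
    · intro x; positivity
    · intro x hx
      rw [Set.mem_ofPred_eq, row_sum_eq] at hx
      simp only [hF]
      rw [← Real.exp_add]
      apply Real.one_le_exp
      have h1 := mul_lt_mul_of_pos_left hx (hs0 x)
      have h2 := ht x
      have h3 : s x * ∑ e, bv P e (x e) * coef i (W x) e =
          ∑ e, s x * coef i (W x) e * bv P e (x e) := by
        rw [Finset.mul_sum]; refine Finset.sum_congr rfl fun e _ => by ring
      rw [h3] at h1
      linarith
  refine hPrF.trans ?_
  apply Ex_cond (bw_nonneg hP) (bw_sum P) (fun e : Pair n => e.1.1 = i ∨ e.1.2 = i)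
  intro z
  set mg := (Equiv.piEquivPiSubtypeProd (fun e : Pair n => e.1.1 = i ∨ e.1.2 = i) (fun _ => Bool)).symm
    with hmg
  have hmgoff : ∀ y e, ∀ h : ¬ (e.1.1 = i ∨ e.1.2 = i), mg (y, z) e = z ⟨e, h⟩ := by
    intro y e h
    simp [hmg, Equiv.piEquivPiSubtypeProd, h]
  have hmgon : ∀ y e, ∀ h : (e.1.1 = i ∨ e.1.2 = i), mg (y, z) e = y ⟨e, h⟩ := by
    intro y e h
    simp [hmg, Equiv.piEquivPiSubtypeProd, h]
  set x0 := mg (fun _ => true, z) with hx0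
  have hWb : ∀ y, W (mg (y, z)) = W x0 ∧ b (mg (y, z)) = b x0 := by
    intro y
    apply hW
    intro e he
    rw [hmgoff _ _ he, hx0, hmgoff _ _ he]
  have hFy : ∀ y, F (mg (y, z)) = Real.exp (-(L + p * (s x0) ^ 2 * Real.exp H)) *
      ∏ e : {e : Pair n // e.1.1 = i ∨ e.1.2 = i},
        Real.exp (s x0 * coef i (W x0) e.1 * bv P e.1 (y e)) := by
    intro y
    have hs : s (mg (y, z)) = s x0 := by simp only [s]; rw [(hWb y).2]
    simp only [hF, hs, (hWb y).1]
    congr 1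
    rw [← Real.exp_sum]
    congr 1
    rw [← Fintype.sum_subtype_add_sum_subtype (fun e : Pair n => e.1.1 = i ∨ e.1.2 = i)]
    rw [Finset.sum_eq_zero (s := (Finset.univ : Finset {e : Pair n // ¬ (e.1.1 = i ∨ e.1.2 = i)}))]
    · rw [add_zero]
      refine Finset.sum_congr rfl fun e _ => ?_
      rw [hmgon y e.1 e.2]
    · intro e _
      rw [coef_zero i _ e.1 e.2]; simp
  simp_rw [hFy]
  have hre : ∀ y : {e : Pair n // e.1.1 = i ∨ e.1.2 = i} → Bool,
      (∏ e, bw P e.1 (y e)) * (Real.exp (-(L + p * (s x0) ^ 2 * Real.exp H)) *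
      ∏ e : {e : Pair n // e.1.1 = i ∨ e.1.2 = i},
        Real.exp (s x0 * coef i (W x0) e.1 * bv P e.1 (y e))) =
      Real.exp (-(L + p * (s x0) ^ 2 * Real.exp H)) * ((∏ e, bw P e.1 (y e)) *
      ∏ e : {e : Pair n // e.1.1 = i ∨ e.1.2 = i},
        Real.exp (s x0 * coef i (W x0) e.1 * bv P e.1 (y e))) := fun y => by ring
  simp_rw [hre]
  rw [← Finset.mul_sum]
  have hprod := Ex_prod (ι := {e : Pair n // e.1.1 = i ∨ e.1.2 = i}) (fun e => bw P e.1)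
    (fun e c => Real.exp (s x0 * coef i (W x0) e.1 * bv P e.1 c))
  unfold Ex at hprod
  rw [hprod]
  have hfac : ∀ e : {e : Pair n // e.1.1 = i ∨ e.1.2 = i},
      ∑ c, bw P e.1 c * Real.exp (s x0 * coef i (W x0) e.1 * bv P e.1 c) ≤
      Real.exp (p * (s x0) ^ 2 * Real.exp H * (coef i (W x0) e.1) ^ 2) := by
    intro e
    set t := s x0 * coef i (W x0) e.1 with htdef
    set q := P e.1.1.1 e.1.1.2 with hq
    have hq0 : 0 ≤ q := hP.2.1 _ _
    have h1 : ∑ c, bw P e.1 c * Real.exp (t * bv P e.1 c) =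
        q * Real.exp (t * (1 - q)) + (1 - q) * Real.exp (t * (0 - q)) := by
      simp [bw, bv, hq]
    rw [h1]
    refine bern_mgf.trans ?_
    apply Real.exp_le_exp.mpr
    have h2 := exp_sub_le t
    have h3 : |t| ≤ H := by
      rw [htdef, abs_mul, abs_of_pos (hs0 x0)]
      refine le_trans ?_ (hsb x0)
      have := hs0 x0
      gcongr
      exact abs_coef_le i _ (hb0 _) (hb x0) _
    calc q * (Real.exp t - 1 - t) ≤ q * (t ^ 2 * Real.exp |t|) := by gcongr
      _ ≤ p * (t ^ 2 * Real.exp H) := by gcongr; exact hPp _ _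
      _ = _ := by rw [htdef]; ring
  have hprodle : ∏ e : {e : Pair n // e.1.1 = i ∨ e.1.2 = i},
      ∑ c, bw P e.1 c * Real.exp (s x0 * coef i (W x0) e.1 * bv P e.1 c) ≤
      Real.exp (p * (s x0) ^ 2 * Real.exp H) := by
    refine (Finset.prod_le_prod (fun e _ => Finset.sum_nonneg fun c _ =>
      mul_nonneg (bw_nonneg hP _ _) (Real.exp_pos _).le) (fun e _ => hfac e)).trans ?_
    rw [← Real.exp_sum]
    apply Real.exp_le_exp.mpr
    rw [← Finset.mul_sum]
    have h1 : ∑ e : {e : Pair n // e.1.1 = i ∨ e.1.2 = i}, (coef i (W x0) e.1) ^ 2 ≤ 1 := by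
      refine le_trans ?_ ((coef_sq_sum_le i (W x0)).trans (hW2 x0))
      rw [← Fintype.sum_subtype_add_sum_subtype (fun e : Pair n => e.1.1 = i ∨ e.1.2 = i)]
      have : 0 ≤ ∑ e : {e : Pair n // ¬ (e.1.1 = i ∨ e.1.2 = i)}, (coef i (W x0) e.1) ^ 2 :=
        Finset.sum_nonneg fun _ _ => sq_nonneg _
      linarith
    have h2 : 0 ≤ p * (s x0) ^ 2 * Real.exp H := by positivity
    nlinarith
  calc _ ≤ Real.exp (-(L + p * (s x0) ^ 2 * Real.exp H)) * Real.exp (p * (s x0) ^ 2 * Real.exp H) := by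
        gcongr
    _ = Real.exp (-L) := by rw [← Real.exp_add]; congr 1; ring

end PartB

section PartB2

lemma Pr_compl {ι S : Type} [Fintype ι] [DecidableEq ι] [Fintype S] {w : ι → S → ℝ}
    (hw : ∀ e, ∑ s, w e s = 1) (G : Set (ι → S)) : Pr w G = 1 - Pr w Gᶜ := by
  rw [← Ex_one hw]
  unfold Pr Ex
  rw [← Finset.sum_sub_distrib]
  refine Finset.sum_congr rfl fun x _ => ?_
  by_cases hx : x ∈ G
  · simp [hx]
  · simp [hx]

variable {n : ℕ}

open Classical in
/-- configuration of the random graph -/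
def cfg (B : Matrix (Fin n) (Fin n) ℝ) (e : Pair n) : Bool := decide (B e.1.1 e.1.2 = 1)

lemma adj_eq {Ω : Type} [MeasurableSpace Ω] {μ : Measure Ω}
    {P : Matrix (Fin n) (Fin n) ℝ} {A : Ω → Matrix (Fin n) (Fin n) ℝ} (hP : IsProbMatrix P)
    (hA : IsAdjacencyModel μ P A) (ω : Ω) :
    A ω = P + symM (fun e => bv P e (cfg (A ω) e)) := by
  have key : ∀ i j, (if A ω i j = 1 then (1:ℝ) else 0) = A ω i j := by
    intro i j
    rcases hA.2.2.1 ω i j with h | h <;> simp [h]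
  ext i j
  simp only [Matrix.add_apply, symM, bv, cfg, decide_eq_true_eq, key]
  split_ifs with h1 h2
  · ring
  · rw [hP.1.apply, (hA.1 ω).apply]; ring
  · have : i = j := le_antisymm (not_lt.mp h2) (not_lt.mp h1)
    subst this
    rw [hA.2.1, hP.2.2.2]; ring

lemma transfer {Ω : Type} [MeasurableSpace Ω] {μ : Measure Ω} [IsProbabilityMeasure μ]
    {P : Matrix (Fin n) (Fin n) ℝ} {A : Ω → Matrix (Fin n) (Fin n) ℝ} (hP : IsProbMatrix P)
    (hA : IsAdjacencyModel μ P A) (G : Set (Pair n → Bool)) :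
    μ {ω | cfg (A ω) ∈ G} = ENNReal.ofReal (Pr (bw P) G) := by
  classical
  have hmeas : ∀ (e : Pair n) (s : Bool), MeasurableSet {ω | cfg (A ω) e = s} := by
    intro e s
    have h1 : MeasurableSet {ω | A ω e.1.1 e.1.2 = 1} :=
      hA.2.2.2.1 e.1.1 e.1.2 (measurableSet_singleton (1:ℝ))
    cases s
    · convert h1.compl using 1
      ext ω; simp [cfg]
    · convert h1 using 1
      ext ω; simp [cfg]
  have hone : ∀ (e : Pair n) (s : Bool), μ {ω | cfg (A ω) e = s} = ENNReal.ofReal (bw P e s) := by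
    intro e s
    have h1 : MeasurableSet {ω | A ω e.1.1 e.1.2 = 1} :=
      hA.2.2.2.1 e.1.1 e.1.2 (measurableSet_singleton (1:ℝ))
    have h2 := hA.2.2.2.2.1 e.1.1 e.1.2 e.2
    cases s
    · have : {ω | cfg (A ω) e = false} = {ω | A ω e.1.1 e.1.2 = 1}ᶜ := by
        ext ω; simp [cfg]
      rw [this, measure_compl h1 (measure_ne_top _ _), h2, measure_univ]
      simp only [bw, Bool.false_eq_true, if_false]
      rw [ENNReal.ofReal_sub _ (hP.2.1 _ _), ENNReal.ofReal_one]
    · have : {ω | cfg (A ω) e = true} = {ω | A ω e.1.1 e.1.2 = 1} := by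
        ext ω; simp [cfg]
      rw [this, h2]
      simp [bw]
  have hx : ∀ x : Pair n → Bool, μ {ω | cfg (A ω) = x} = ENNReal.ofReal (∏ e, bw P e (x e)) := by
    intro x
    have hind := hA.2.2.2.2.2
    have : {ω | cfg (A ω) = x} = ⋂ e, {ω | cfg (A ω) e = x e} := by
      ext ω; simp [funext_iff]
    rw [this, hind.meas_iInter, ENNReal.ofReal_prod_of_nonneg (fun e _ => bw_nonneg hP _ _)]
    · exact Finset.prod_congr rfl fun e _ => hone e (x e)
    · intro e
      refine ⟨if x e then {1} else {1}ᶜ, ?_, ?_⟩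
      · split_ifs
        · exact measurableSet_singleton _
        · exact (measurableSet_singleton _).compl
      · ext ω
        cases h : x e <;> simp [cfg]
  have hU : {ω | cfg (A ω) ∈ G} = ⋃ x ∈ Finset.univ.filter (· ∈ G), {ω | cfg (A ω) = x} := by
    ext ω; simp
  rw [hU, measure_biUnion_finset]
  · simp_rw [hx]
    rw [← ENNReal.ofReal_sum_of_nonneg (fun x _ => Finset.prod_nonneg fun e _ => bw_nonneg hP _ _)]
    congr 1
    unfold Pr Ex
    rw [Finset.sum_filter]
    refine Finset.sum_congr rfl fun x _ => ?_
    by_cases h : x ∈ G <;> simp [h]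
  · intro x _ y _ hxy
    rw [Function.onFun, Set.disjoint_left]
    intro ω h1 h2
    exact hxy (h1.symm.trans h2)
  · intro x _
    have : {ω | cfg (A ω) = x} = ⋂ e, {ω | cfg (A ω) e = x e} := by
      ext ω; simp [funext_iff]
    rw [this]
    exact MeasurableSet.iInter fun e => hmeas e _

end PartB2

section PartC0
open scoped Matrix.Norms.L2Operator
variable {n : ℕ}

lemma exists_eigenDecomp (A : Matrix (Fin n) (Fin n) ℝ) (hA : Aᵀ = A) :
    ∃ W mu, IsEigenDecomp A W mu := by
  have hH : A.IsHermitian := by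
    rw [Matrix.IsHermitian, Matrix.conjTranspose_eq_transpose_of_trivial]; exact hA
  let U : Matrix (Fin n) (Fin n) ℝ := hH.eigenvectorUnitary
  have hUU : U * Uᵀ = 1 := by
    have := (Unitary.mem_iff.mp hH.eigenvectorUnitary.2).2
    rwa [Matrix.star_eq_conjTranspose, Matrix.conjTranspose_eq_transpose_of_trivial] at this
  have hUA : A = U * Matrix.diagonal hH.eigenvalues * Uᵀ := by
    have := hH.spectral_theorem
    rw [Unitary.conjStarAlgAut_apply, Matrix.star_eq_conjTranspose,
      Matrix.conjTranspose_eq_transpose_of_trivial] at this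
    exact this
  let σ := Tuple.sort (fun i => - |hH.eigenvalues i|)
  have hσ := Tuple.monotone_sort (fun i => - |hH.eigenvalues i|)
  refine ⟨U.submatrix id σ, hH.eigenvalues ∘ σ, ?_, ?_, ?_⟩
  · rw [Matrix.transpose_submatrix, Matrix.submatrix_mul_equiv, hUU]; simp
  · have h1 : Matrix.diagonal (hH.eigenvalues ∘ σ) =
        (Matrix.diagonal hH.eigenvalues).submatrix σ σ := by
      rw [Matrix.submatrix_diagonal_equiv]
    rw [h1, Matrix.transpose_submatrix, Matrix.submatrix_mul_equiv, Matrix.submatrix_mul_equiv,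
      ← hUA]
    simp
  · intro i j hij
    have := hσ hij
    simp only [Function.comp] at this
    simpa using neg_le_neg this

lemma fnW_pow {W : Matrix (Fin n) (Fin n) ℝ} (hW : W * Wᵀ = 1) (g : Fin n → ℝ) (m : ℕ) :
    (fnW W g) ^ m = fnW W (fun i => g i ^ m) := by
  induction m with
  | zero => simp [fnW_one hW]
  | succ m ih => rw [pow_succ, ih, fnW_mul hW]; simp only [pow_succ]

lemma pow_norm_le_trace (hn : 0 < n) (A : Matrix (Fin n) (Fin n) ℝ) (hA : Aᵀ = A) (k : ℕ) :
    ‖A‖ ^ (2 * k) ≤ Matrix.trace (A ^ (2 * k)) := by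
  obtain ⟨W, mu, h⟩ := exists_eigenDecomp A hA
  have h1 := norm_A_le h hn
  have hW' : Wᵀ * W = 1 := mul_eq_one_comm.mp h.1
  have h2 : A = fnW W mu := h.2.1
  have h3 : Matrix.trace (A ^ (2 * k)) = ∑ i, mu i ^ (2 * k) := by
    rw [h2, fnW_pow h.1]
    unfold fnW
    rw [Matrix.trace_mul_cycle, hW', Matrix.one_mul, Matrix.trace_diagonal]
  rw [h3]
  calc ‖A‖ ^ (2 * k) ≤ |mu ⟨0, hn⟩| ^ (2 * k) := by gcongr
    _ = mu ⟨0, hn⟩ ^ (2 * k) := by rw [pow_mul, sq_abs, ← pow_mul]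
    _ ≤ _ := Finset.single_le_sum (f := fun i => mu i ^ (2 * k))
      (fun i _ => by rw [pow_mul]; positivity) (Finset.mem_univ _)

lemma abs_dot_le (A : Matrix (Fin n) (Fin n) ℝ) (x y : Fin n → ℝ) :
    |x ⬝ᵥ (A *ᵥ y)| ≤ Real.sqrt (x ⬝ᵥ x) * (‖A‖ * Real.sqrt (y ⬝ᵥ y)) := by
  have h1 : x ⬝ᵥ (A *ᵥ y) = inner ℝ (WithLp.toLp 2 (A *ᵥ y) : EuclideanSpace ℝ (Fin n))
      (WithLp.toLp 2 x) := by
    simp [PiLp.inner_apply, dotProduct]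
  have hs : ∀ z : Fin n → ℝ, Real.sqrt (z ⬝ᵥ z) = ‖(WithLp.toLp 2 z : EuclideanSpace ℝ (Fin n))‖ := by
    intro z; rw [← sq_norm_toLp, Real.sqrt_sq (norm_nonneg _)]
  rw [h1, hs, hs]
  refine (abs_real_inner_le_norm _ _).trans ?_
  rw [mul_comm]
  gcongr
  exact Matrix.l2_opNorm_mulVec A (WithLp.toLp 2 y)

lemma exists_unit (hn : 0 < n) (A : Matrix (Fin n) (Fin n) ℝ) (hA : Aᵀ = A) :
    ∃ x : Fin n → ℝ, x ⬝ᵥ x = 1 ∧ ‖A‖ ≤ |x ⬝ᵥ (A *ᵥ x)| := by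
  obtain ⟨W, mu, h⟩ := exists_eigenDecomp A hA
  have hW' : Wᵀ * W = 1 := mul_eq_one_comm.mp h.1
  refine ⟨fun i => W i ⟨0, hn⟩, ?_, ?_⟩
  · have := congrFun (congrFun hW' ⟨0, hn⟩) ⟨0, hn⟩
    simpa [Matrix.mul_apply, dotProduct] using this
  · have h1 : A * W = W * diagonal mu := by
      conv_lhs => rw [h.2.1]
      rw [Matrix.mul_assoc, hW', Matrix.mul_one]
    have h2 : A *ᵥ (fun i => W i ⟨0, hn⟩) = fun i => W i ⟨0, hn⟩ * mu ⟨0, hn⟩ := by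
      ext i
      have := congrFun (congrFun h1 i) ⟨0, hn⟩
      rw [Matrix.mul_diagonal] at this
      rw [← this]; rfl
    have h3 : (fun i => W i ⟨0, hn⟩) ⬝ᵥ (fun i => W i ⟨0, hn⟩) = (1:ℝ) := by
      have := congrFun (congrFun hW' ⟨0, hn⟩) ⟨0, hn⟩
      simpa [Matrix.mul_apply, dotProduct] using this
    have h4 : (fun i => W i ⟨0, hn⟩) ⬝ᵥ (A *ᵥ fun i => W i ⟨0, hn⟩) = mu ⟨0, hn⟩ := by
      rw [h2]
      have : (fun i => W i ⟨0, hn⟩ * mu ⟨0, hn⟩) = mu ⟨0, hn⟩ • (fun i => W i ⟨0, hn⟩) := by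
        ext i; simp [mul_comm]
      rw [this, dotProduct_smul, h3]; simp
    rw [h4]
    exact norm_A_le h hn

lemma trace_pow_le (A : Matrix (Fin n) (Fin n) ℝ) (k : ℕ) (hk : 0 < k) :
    Matrix.trace (A ^ k) ≤ n * ‖A‖ ^ k := by
  have h1 : ∀ i, (A ^ k) i i ≤ ‖A‖ ^ k := by
    intro i
    have h := abs_dot_le (A ^ k) (Pi.single i 1) (Pi.single i 1)
    simp at h
    exact (le_abs_self _).trans (h.trans (norm_pow_le' A hk))
  calc Matrix.trace (A ^ k) = ∑ i, (A ^ k) i i := rfl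
    _ ≤ ∑ i : Fin n, ‖A‖ ^ k := Finset.sum_le_sum fun i _ => h1 i
    _ = _ := by simp

end PartC0

section PartC1
open scoped Matrix.Norms.L2Operator
variable {n : ℕ}

lemma quad_eq (v : Pair n → ℝ) (z : Fin n → ℝ) :
    z ⬝ᵥ (symM v *ᵥ z) = ∑ e, v e * (2 * z e.1.1 * z e.1.2) := by
  have h : ∀ i, (symM v *ᵥ z) i = ∑ e, v e * coef i z e := fun i => row_sum_eq v i z
  simp only [dotProduct, h, Finset.mul_sum]
  rw [Finset.sum_comm]
  refine Finset.sum_congr rfl fun e _ => ?_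
  have : ∀ i, z i * (v e * coef i z e) = v e * ((if e.1.1 = i then z i * z e.1.2 else 0)
      + (if e.1.2 = i then z i * z e.1.1 else 0)) := by
    intro i; unfold coef; split_ifs <;> ring
  simp_rw [this]
  rw [← Finset.mul_sum, Finset.sum_add_distrib]
  simp
  left; ring

lemma quad_sq_sum (z : Fin n → ℝ) (hz : ∑ i, z i ^ 2 ≤ 1) :
    ∑ e : Pair n, (2 * z e.1.1 * z e.1.2) ^ 2 ≤ 2 := by
  have h := quad_eq (fun _ : Pair n => 1) (fun i => z i ^ 2)
  have h2 : (fun i => z i ^ 2) ⬝ᵥ (symM (fun _ : Pair n => 1) *ᵥ (fun i => z i ^ 2)) ≤ 1 := by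
    have hle : ∀ i j, symM (fun _ : Pair n => (1:ℝ)) i j ≤ 1 := by
      intro i j; unfold symM; split_ifs <;> simp
    have h0 : 0 ≤ ∑ i, z i ^ 2 := Finset.sum_nonneg fun i _ => sq_nonneg _
    have : ∀ i, (symM (fun _ : Pair n => (1:ℝ)) *ᵥ (fun i => z i ^ 2)) i ≤ 1 := by
      intro i
      calc _ = ∑ j, symM (fun _ : Pair n => (1:ℝ)) i j * z j ^ 2 := rfl
        _ ≤ ∑ j, 1 * z j ^ 2 := by gcongr; exact hle _ _
        _ ≤ 1 := by simpa using hz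
    calc _ = ∑ i, z i ^ 2 * (symM (fun _ : Pair n => (1:ℝ)) *ᵥ (fun i => z i ^ 2)) i := rfl
      _ ≤ ∑ i, z i ^ 2 * 1 := by gcongr; exact this _
      _ ≤ 1 := by simpa using hz
  rw [h] at h2
  calc ∑ e : Pair n, (2 * z e.1.1 * z e.1.2) ^ 2
      = 2 * ∑ e : Pair n, 1 * (2 * z e.1.1 ^ 2 * z e.1.2 ^ 2) := by
        rw [Finset.mul_sum]; refine Finset.sum_congr rfl fun e _ => by ring
    _ ≤ 2 := by linarith

lemma exp_le_add_exp_sq (y : ℝ) : Real.exp y ≤ y + Real.exp (y ^ 2) := by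
  have h0 := Real.add_one_le_exp (y ^ 2)
  by_cases h : |y| ≤ 1
  · have := (abs_le.mp (Real.abs_exp_sub_one_sub_id_le h)).2
    linarith
  · rcases lt_abs.mp (not_le.mp h) with h | h
    · have : Real.exp y ≤ Real.exp (y ^ 2) := Real.exp_le_exp.mpr (by nlinarith)
      linarith
    · have : Real.exp y ≤ 1 := Real.exp_le_one_iff.mpr (by linarith)
      nlinarith

/-- comparison weights -/
def yw (s : Bool) : ℝ := if s then 1/3 else 2/3
/-- comparison values -/
def yv (s : Bool) : ℝ := if s then 2 else -1

lemma y_mgf (x : ℝ) : ∑ s, yw s * Real.exp (x * yv s) ≤ Real.exp (4 * x ^ 2) := by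
  simp [yw, yv]
  have h1 := exp_le_add_exp_sq (x * 2)
  have h2 := exp_le_add_exp_sq (-x)
  have h3 : Real.exp ((-x) ^ 2) ≤ Real.exp (4 * x ^ 2) := Real.exp_le_exp.mpr (by nlinarith)
  rw [show (x * 2) ^ 2 = 4 * x ^ 2 by ring] at h1
  linarith

lemma yw_nonneg (s : Bool) : 0 ≤ yw s := by unfold yw; split_ifs <;> norm_num
lemma yw_sum : ∑ s, yw s = 1 := by simp [yw]; norm_num

lemma Ex_exp_quad (z : Fin n → ℝ) (hz : ∑ i, z i ^ 2 ≤ 1) (t : ℝ) :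
    Ex (fun _ : Pair n => yw) (fun x => Real.exp (t * (z ⬝ᵥ (symM (fun e => yv (x e)) *ᵥ z)))) ≤
      Real.exp (8 * t ^ 2) := by
  simp_rw [quad_eq]
  have h1 : ∀ x : Pair n → Bool, Real.exp (t * ∑ e, yv (x e) * (2 * z e.1.1 * z e.1.2)) =
      ∏ e, (fun (e : Pair n) (s : Bool) => Real.exp ((t * (2 * z e.1.1 * z e.1.2)) * yv s)) e (x e) := by
    intro x
    rw [← Real.exp_sum, Finset.mul_sum]
    congr 1
    refine Finset.sum_congr rfl fun e _ => by ring
  rw [show (fun x : Pair n → Bool => Real.exp (t * ∑ e, yv (x e) * (2 * z e.1.1 * z e.1.2))) = _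
    from funext h1]
  refine (Ex_prod (fun _ : Pair n => yw) (fun (e : Pair n) (s : Bool) =>
    Real.exp ((t * (2 * z e.1.1 * z e.1.2)) * yv s))).trans_le ?_
  calc _ ≤ ∏ e : Pair n, Real.exp (4 * (t * (2 * z e.1.1 * z e.1.2)) ^ 2) := by
        refine Finset.prod_le_prod (fun e _ => Finset.sum_nonneg fun s _ => ?_) fun e _ => y_mgf _
        exact mul_nonneg (yw_nonneg _) (Real.exp_pos _).le
    _ = Real.exp (4 * t ^ 2 * ∑ e : Pair n, (2 * z e.1.1 * z e.1.2) ^ 2) := by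
        rw [← Real.exp_sum, Finset.mul_sum]
        congr 1
        refine Finset.sum_congr rfl fun e _ => by ring
    _ ≤ _ := by
        apply Real.exp_le_exp.mpr
        have := quad_sq_sum z hz
        nlinarith [sq_nonneg t]

lemma Ex_add {ι S : Type} [Fintype ι] [DecidableEq ι] [Fintype S] (w : ι → S → ℝ)
    (f g : (ι → S) → ℝ) : Ex w (fun x => f x + g x) = Ex w f + Ex w g := by
  unfold Ex
  rw [← Finset.sum_add_distrib]
  refine Finset.sum_congr rfl fun x _ => by ring

lemma Ex_pow_quad (hn : 0 < n) (z : Fin n → ℝ) (hz : ∑ i, z i ^ 2 ≤ 1) (k : ℕ) :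
    (n:ℝ) ^ k * Ex (fun _ : Pair n => yw) (fun x => (z ⬝ᵥ (symM (fun e => yv (x e)) *ᵥ z)) ^ (2 * k)) ≤
      (2 * k) ^ (2 * k) * (2 * Real.exp (8 * n)) := by
  have hs : (Real.sqrt n) ^ 2 = n := Real.sq_sqrt (by positivity)
  have h1 := Ex_exp_quad z hz (Real.sqrt n)
  have h2 := Ex_exp_quad z hz (- Real.sqrt n)
  rw [neg_sq] at h2
  rw [hs] at h1 h2
  rw [← Ex_const_mul]
  have hfac : ((2 * k).factorial : ℝ) ≤ (2 * k) ^ (2 * k) := by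
    exact_mod_cast Nat.factorial_le_pow (2 * k)
  calc _ ≤ Ex (fun _ : Pair n => yw) (fun x => (2 * k) ^ (2 * k) *
        (Real.exp (Real.sqrt n * (z ⬝ᵥ (symM (fun e => yv (x e)) *ᵥ z))) +
        Real.exp (- Real.sqrt n * (z ⬝ᵥ (symM (fun e => yv (x e)) *ᵥ z))))) := by
        apply Ex_mono (fun _ => yw_nonneg)
        intro x
        set Z := z ⬝ᵥ (symM (fun e => yv (x e)) *ᵥ z)
        have a1 := Real.pow_div_factorial_le_exp |Real.sqrt n * Z| (abs_nonneg _) (2 * k)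
        rw [div_le_iff₀ (by positivity)] at a1
        have a2 : |Real.sqrt n * Z| ^ (2 * k) = (n:ℝ) ^ k * Z ^ (2 * k) := by
          rw [pow_mul, sq_abs, mul_pow, hs, mul_pow, ← pow_mul]
        have a3 : Real.exp |Real.sqrt n * Z| ≤ Real.exp (Real.sqrt n * Z) + Real.exp (-Real.sqrt n * Z) := by
          rw [neg_mul]
          rcases abs_choice (Real.sqrt n * Z) with h | h <;> rw [h]
          · linarith [Real.exp_pos (-(Real.sqrt n * Z))]
          · linarith [Real.exp_pos ((Real.sqrt n * Z))]
        rw [a2] at a1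
        calc _ ≤ _ := a1
          _ ≤ (Real.exp (Real.sqrt n * Z) + Real.exp (-Real.sqrt n * Z)) * (2 * k) ^ (2 * k) := by
            gcongr
          _ = _ := by ring
    _ ≤ _ := by
        rw [Ex_const_mul, Ex_add]
        gcongr
        linarith

lemma int_trunc (y : ℝ) : ∃ v : ℤ, |(v:ℝ)| ≤ |y| ∧ |y - v| ≤ 1 := by
  rcases le_total 0 y with h | h
  · have h0 : (0:ℝ) ≤ ⌊y⌋ := by exact_mod_cast Int.floor_nonneg.mpr h
    refine ⟨⌊y⌋, ?_, ?_⟩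
    · rw [abs_of_nonneg h0, abs_of_nonneg h]; exact Int.floor_le y
    · rw [abs_le]; constructor <;> linarith [Int.floor_le y, Int.lt_floor_add_one y]
  · have h0 : (⌈y⌉:ℝ) ≤ 0 := by exact_mod_cast Int.ceil_le.mpr (by simpa using h)
    refine ⟨⌈y⌉, ?_, ?_⟩
    · rw [abs_of_nonpos h0, abs_of_nonpos h]; linarith [Int.le_ceil y]
    · rw [abs_le]; constructor <;> linarith [Int.le_ceil y, Int.ceil_lt_add_one y]

/-- lattice net -/
def Net (R : ℕ) : Finset (Fin R → ℤ) :=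
  (Fintype.piFinset fun _ => Finset.Icc (-(4 * R : ℤ)) (4 * R)).filter
    fun v => ∑ j, (v j) ^ 2 ≤ 16 * R

lemma sum_exp_le (M : ℕ) : ∑ m ∈ Finset.Icc (-(M : ℤ)) M, Real.exp (-(m:ℝ) ^ 2) ≤ 4 := by
  have hsub : Finset.Icc (-(M : ℤ)) M ⊆ (Finset.range (M + 1)).image (fun a : ℕ => (a : ℤ)) ∪
      (Finset.range (M + 1)).image (fun a : ℕ => -(a : ℤ)) := by
    intro m hm
    rw [Finset.mem_Icc] at hm
    simp only [Finset.mem_union, Finset.mem_image, Finset.mem_range]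
    rcases le_total 0 m with h | h
    · left; exact ⟨m.toNat, by omega, by omega⟩
    · right; exact ⟨(-m).toNat, by omega, by omega⟩
  have hg : ∑ a ∈ Finset.range (M + 1), Real.exp (-((a:ℤ):ℝ) ^ 2) ≤ 2 := by
    calc _ ≤ ∑ a ∈ Finset.range (M + 1), ((1:ℝ) / 2) ^ a := by
          refine Finset.sum_le_sum fun a _ => ?_
          have h1 : Real.exp (-((a:ℤ):ℝ) ^ 2) ≤ Real.exp (-(a:ℝ)) := by
            apply Real.exp_le_exp.mpr
            have : (a:ℝ) ≤ (a:ℝ) ^ 2 := by exact_mod_cast Nat.le_self_pow (by norm_num) a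
            push_cast; linarith
          have h2 : Real.exp (-(a:ℝ)) = (Real.exp (-1)) ^ a := by
            rw [← Real.exp_nat_mul]; congr 1; ring
          rw [h2] at h1
          refine h1.trans ?_
          gcongr
          rw [Real.exp_neg, one_div]
          apply inv_anti₀ (by norm_num)
          linarith [Real.add_one_le_exp (1:ℝ)]
      _ ≤ ∑' a : ℕ, ((1:ℝ) / 2) ^ a := by
          apply Summable.sum_le_tsum _ (fun _ _ => by positivity)
          exact summable_geometric_two
      _ = 2 := tsum_geometric_two
  calc _ ≤ ∑ m ∈ (Finset.range (M + 1)).image (fun a : ℕ => (a : ℤ)) ∪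
      (Finset.range (M + 1)).image (fun a : ℕ => -(a : ℤ)), Real.exp (-(m:ℝ) ^ 2) :=
        Finset.sum_le_sum_of_subset_of_nonneg hsub fun _ _ _ => (Real.exp_pos _).le
    _ ≤ ∑ m ∈ (Finset.range (M + 1)).image (fun a : ℕ => (a : ℤ)), Real.exp (-(m:ℝ) ^ 2) +
        ∑ m ∈ (Finset.range (M + 1)).image (fun a : ℕ => -(a : ℤ)), Real.exp (-(m:ℝ) ^ 2) := by
        rw [← Finset.sum_union_inter]
        have : 0 ≤ ∑ m ∈ (Finset.range (M + 1)).image (fun a : ℕ => (a : ℤ)) ∩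
          (Finset.range (M + 1)).image (fun a : ℕ => -(a : ℤ)), Real.exp (-(m:ℝ) ^ 2) :=
            Finset.sum_nonneg fun _ _ => (Real.exp_pos _).le
        linarith
    _ ≤ 2 + 2 := by
        rw [Finset.sum_image (by intro a _ b _ h; simpa using h),
          Finset.sum_image (by intro a _ b _ h; simpa using h)]
        apply add_le_add hg
        refine le_trans (le_of_eq ?_) hg
        refine Finset.sum_congr rfl fun a _ => by push_cast; ring_nf
    _ = 4 := by norm_num

lemma card_Net (R : ℕ) : ((Net R).card : ℝ) ≤ Real.exp (16 * R) * 4 ^ R := by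
  have h1 : ((Net R).card : ℝ) ≤ ∑ v ∈ Net R, Real.exp (16 * R) * ∏ j, Real.exp (-((v j : ℤ):ℝ) ^ 2) := by
    rw [Finset.card_eq_sum_ones]
    push_cast
    refine Finset.sum_le_sum fun v hv => ?_
    rw [← Real.exp_sum, ← Real.exp_add]
    apply Real.one_le_exp
    have := (Finset.mem_filter.mp hv).2
    have h2 : (∑ j, ((v j : ℤ):ℝ) ^ 2) ≤ 16 * R := by exact_mod_cast this
    rw [Finset.sum_neg_distrib]
    linarith
  refine h1.trans ?_
  rw [← Finset.mul_sum]
  gcongr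
  calc _ ≤ ∑ v ∈ Fintype.piFinset fun _ : Fin R => Finset.Icc (-(4 * R : ℤ)) (4 * R),
        ∏ j, Real.exp (-((v j : ℤ):ℝ) ^ 2) :=
        Finset.sum_le_sum_of_subset_of_nonneg (Finset.filter_subset _ _)
          fun _ _ _ => Finset.prod_nonneg fun _ _ => (Real.exp_pos _).le
    _ = ∏ j : Fin R, ∑ m ∈ Finset.Icc (-(4 * R : ℤ)) (4 * R), Real.exp (-((m : ℤ):ℝ) ^ 2) := by
        rw [Finset.prod_univ_sum]
    _ ≤ ∏ j : Fin R, 4 := by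
        refine Finset.prod_le_prod (fun _ _ => Finset.sum_nonneg fun _ _ => (Real.exp_pos _).le)
          fun _ _ => ?_
        have := sum_exp_le (4 * R)
        push_cast at this
        exact this
    _ = 4 ^ R := by simp

/-- net point as a real vector -/
def netPt {R : ℕ} (v : Fin R → ℤ) (j : Fin R) : ℝ := (v j : ℝ) / (4 * Real.sqrt R)

lemma netPt_sq {R : ℕ} (hR : 0 < R) {v : Fin R → ℤ} (hv : v ∈ Net R) :
    ∑ j, netPt v j ^ 2 ≤ 1 := by
  have hs : (Real.sqrt R) ^ 2 = R := Real.sq_sqrt (by positivity)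
  have hR' : (0:ℝ) < R := by exact_mod_cast hR
  have h2 : (∑ j, ((v j : ℤ):ℝ) ^ 2) ≤ 16 * R := by exact_mod_cast (Finset.mem_filter.mp hv).2
  unfold netPt
  simp_rw [div_pow, mul_pow, hs]
  rw [← Finset.sum_div, div_le_one (by positivity)]
  linarith

lemma net_approx {R : ℕ} (hR : 0 < R) (A : Matrix (Fin R) (Fin R) ℝ) (hA : Aᵀ = A) :
    ∃ v ∈ Net R, ‖A‖ ≤ 2 * |netPt v ⬝ᵥ (A *ᵥ netPt v)| := by
  obtain ⟨x, hx1, hx⟩ := exists_unit hR A hA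
  have hs : (Real.sqrt R) ^ 2 = R := Real.sq_sqrt (by positivity)
  have hR' : (0:ℝ) < R := by exact_mod_cast hR
  have hsR : 0 < Real.sqrt R := Real.sqrt_pos.mpr hR'
  choose v hv1 hv2 using fun j => int_trunc (4 * Real.sqrt R * x j)
  have hxx : ∑ j, x j ^ 2 = 1 := by rw [← hx1]; simp [dotProduct, pow_two]
  have hvs : (∑ j, ((v j : ℤ):ℝ) ^ 2) ≤ 16 * R := by
    calc (∑ j, ((v j : ℤ):ℝ) ^ 2) ≤ ∑ j, (4 * Real.sqrt (R:ℝ) * x j) ^ 2 := by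
          refine Finset.sum_le_sum fun j _ => ?_
          exact sq_le_sq.mpr (hv1 j)
      _ = 16 * R := by
          simp_rw [mul_pow, hs]
          rw [← Finset.mul_sum, hxx]; ring
  have hvs' : ∑ j, v j ^ 2 ≤ 16 * (R:ℤ) := by exact_mod_cast hvs
  have hv : v ∈ Net R := by
    refine Finset.mem_filter.mpr ⟨?_, hvs'⟩
    rw [Fintype.mem_piFinset]
    intro j
    rw [Finset.mem_Icc, ← abs_le]
    have h1 : v j ^ 2 ≤ 16 * (R:ℤ) := 
      (Finset.single_le_sum (f := fun j => v j ^ 2) (fun j _ => sq_nonneg _) (Finset.mem_univ j)).trans hvs'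
    apply abs_le_of_sq_le_sq _ (by positivity)
    have : (1:ℤ) ≤ R := by exact_mod_cast hR
    nlinarith
  refine ⟨v, hv, ?_⟩
  set z := netPt v with hz
  have hz1 := netPt_sq hR hv
  have hd : (x - z) ⬝ᵥ (x - z) ≤ (1/4) ^ 2 := by
    have : ∀ j, ((x - z) j) * ((x - z) j) ≤ 1 / (16 * R) := by
      intro j
      have e1 : (x - z) j = (4 * Real.sqrt R * x j - v j) / (4 * Real.sqrt R) := by
        simp only [Pi.sub_apply, hz, netPt]
        field_simp
      rw [e1, ← pow_two, div_pow, mul_pow, hs]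
      have := (sq_le_one_iff_abs_le_one _).mpr (hv2 j)
      rw [show (4:ℝ) ^ 2 = 16 by norm_num]
      gcongr
    calc _ ≤ ∑ j : Fin R, 1 / (16 * (R:ℝ)) := Finset.sum_le_sum fun j _ => this j
      _ = _ := by simp; field_simp; norm_num
  have e2 : x ⬝ᵥ (A *ᵥ x) = z ⬝ᵥ (A *ᵥ z) + ((x - z) ⬝ᵥ (A *ᵥ x) + z ⬝ᵥ (A *ᵥ (x - z))) := by
    rw [Matrix.mulVec_sub, sub_dotProduct, dotProduct_sub]; ring
  have b1 := abs_dot_le A (x - z) x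
  have b2 := abs_dot_le A z (x - z)
  have s1 : Real.sqrt ((x - z) ⬝ᵥ (x - z)) ≤ 1/4 := Real.sqrt_le_left (by norm_num) |>.mpr hd
  have s2 : Real.sqrt (z ⬝ᵥ z) ≤ 1 := by
    rw [Real.sqrt_le_one]; simpa [dotProduct, pow_two] using hz1
  rw [hx1, Real.sqrt_one, mul_one] at b1
  have hA0 := norm_nonneg A
  have c1 : |(x - z) ⬝ᵥ (A *ᵥ x)| ≤ 1/4 * ‖A‖ := b1.trans (by gcongr)
  have c2 : |z ⬝ᵥ (A *ᵥ (x - z))| ≤ 1 * (‖A‖ * (1/4)) := b2.trans (by gcongr)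
  rw [e2] at hx
  have := abs_add_three (z ⬝ᵥ (A *ᵥ z)) ((x - z) ⬝ᵥ (A *ᵥ x)) (z ⬝ᵥ (A *ᵥ (x - z)))
  rw [add_assoc] at this
  linarith

lemma Ex_trace_Y (k : ℕ) (hk : 0 < k) :
    Ex (fun _ : Pair (2 * k) => yw) (fun x => Matrix.trace (symM (fun e => yv (x e)) ^ (2 * k))) ≤
      (2 * k) * (256 * Real.exp 48 * k) ^ k := by
  have hk' : (0:ℝ) < k := by exact_mod_cast hk
  have h2k : 0 < 2 * k := by omega
  have hstep : ∀ x : Pair (2 * k) → Bool, Matrix.trace (symM (fun e => yv (x e)) ^ (2 * k)) ≤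
      ∑ v ∈ Net (2 * k), (2 * k * 2 ^ (2 * k)) *
        (netPt v ⬝ᵥ (symM (fun e => yv (x e)) *ᵥ netPt v)) ^ (2 * k) := by
    intro x
    obtain ⟨v, hv, hle⟩ := net_approx h2k (symM (fun e => yv (x e))) (symM_symm _)
    have h1 := trace_pow_le (symM (fun e => yv (x e))) (2 * k) h2k
    refine h1.trans ?_
    refine le_trans ?_ (Finset.single_le_sum (f := fun v => ((2:ℝ) * k * 2 ^ (2 * k)) *
        (netPt v ⬝ᵥ (symM (fun e => yv (x e)) *ᵥ netPt v)) ^ (2 * k)) (fun v _ => ?_) hv)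
    · push_cast
      rw [mul_assoc (2 * (k:ℝ))]
      gcongr
      calc _ ≤ (2 * |netPt v ⬝ᵥ (symM (fun e => yv (x e)) *ᵥ netPt v)|) ^ (2 * k) := by gcongr
        _ = _ := by rw [mul_pow, pow_mul |_|, sq_abs, ← pow_mul]
    · have : 0 ≤ (netPt v ⬝ᵥ (symM (fun e => yv (x e)) *ᵥ netPt v)) ^ (2 * k) := by
        rw [pow_mul]; positivity
      positivity
  have hq : ∀ v ∈ Net (2 * k), Ex (fun _ : Pair (2 * k) => yw)
      (fun x => (netPt v ⬝ᵥ (symM (fun e => yv (x e)) *ᵥ netPt v)) ^ (2 * k)) ≤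
      (2 * k) ^ k * (2 * Real.exp (16 * k)) := by
    intro v hv
    have h := Ex_pow_quad h2k (netPt v) (netPt_sq h2k hv) k
    push_cast at h
    have hpos : (0:ℝ) < (2 * k) ^ k := by positivity
    have e1 : (2 * (k:ℝ)) ^ (2 * k) * (2 * Real.exp (8 * (2 * k))) =
        (2 * k) ^ k * ((2 * k) ^ k * (2 * Real.exp (16 * k))) := by
      rw [show (8:ℝ) * (2 * k) = 16 * k by ring]; ring
    rw [e1] at h
    exact le_of_mul_le_mul_left h hpos
  calc _ ≤ Ex (fun _ : Pair (2 * k) => yw) (fun x => ∑ v ∈ Net (2 * k), (2 * k * 2 ^ (2 * k)) *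
        (netPt v ⬝ᵥ (symM (fun e => yv (x e)) *ᵥ netPt v)) ^ (2 * k)) :=
        Ex_mono (fun _ => yw_nonneg) hstep
    _ ≤ ∑ v ∈ Net (2 * k), ((2:ℝ) * k * 2 ^ (2 * k)) * ((2 * k) ^ k * (2 * Real.exp (16 * k))) := by
        rw [Ex_sum]
        refine Finset.sum_le_sum fun v hv => ?_
        rw [Ex_const_mul]
        gcongr
        exact hq v hv
    _ = (Net (2 * k)).card * (((2:ℝ) * k * 2 ^ (2 * k)) * ((2 * k) ^ k * (2 * Real.exp (16 * k)))) := by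
        rw [Finset.sum_const, nsmul_eq_mul]
    _ ≤ (Real.exp (16 * (2 * k)) * 4 ^ (2 * k)) *
        (((2:ℝ) * k * 2 ^ (2 * k)) * ((2 * k) ^ k * (2 ^ k * Real.exp (16 * k)))) := by
        have := card_Net (2 * k)
        push_cast at this
        gcongr
        exact le_self_pow₀ (by norm_num) hk.ne'
    _ = (2 * k) * (256 * Real.exp 48 * k) ^ k := by
        have e1 : Real.exp (16 * (2 * (k:ℝ))) = (Real.exp 32) ^ k := by
          rw [← Real.exp_nat_mul]; congr 1; ring
        have e2 : Real.exp (16 * (k:ℝ)) = (Real.exp 16) ^ k := by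
          rw [← Real.exp_nat_mul]; congr 1; ring
        have e3 : Real.exp 48 = Real.exp 32 * Real.exp 16 := by
          rw [← Real.exp_add]; norm_num
        rw [e1, e2, e3, pow_mul, pow_mul]
        rw [show (256:ℝ) * (Real.exp 32 * Real.exp 16) * k =
          Real.exp 32 * 4 ^ 2 * 2 ^ 2 * (2 * k) * 2 * Real.exp 16 by ring]
        simp only [mul_pow]
        ring

end PartC1

section PartC2
variable {n : ℕ}

/-- walk product -/
def wp {K : ℕ} (M : Matrix (Fin n) (Fin n) ℝ) (u : Fin (K + 1) → Fin n) : ℝ :=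
  ∏ t : Fin K, M (u t.castSucc) (u t.succ)

lemma pow_apply_walk (M : Matrix (Fin n) (Fin n) ℝ) (K : ℕ) (i j : Fin n) :
    (M ^ K) i j = ∑ u : Fin (K + 1) → Fin n, if u 0 = i ∧ u (Fin.last K) = j then wp M u else 0 := by
  induction K generalizing i with
  | zero =>
    rw [← (Equiv.funUnique (Fin 1) (Fin n)).symm.sum_comp]
    simp only [wp, Matrix.one_apply, pow_zero, Finset.univ_eq_empty, Finset.prod_empty]
    split_ifs with h
    · subst h
      rw [Finset.sum_eq_single i] <;> simp +contextual
    · symm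
      apply Finset.sum_eq_zero
      intro x _
      rw [if_neg]; rintro ⟨h1, h2⟩; exact h (h1.symm.trans h2)
  | succ K ih =>
    rw [pow_succ', Matrix.mul_apply, ← (Fin.consEquiv (fun _ => Fin n)).sum_comp,
      Fintype.sum_prod_type]
    simp_rw [ih, Finset.mul_sum]
    rw [Finset.sum_comm]
    rw [Finset.sum_comm (s := Finset.univ (α := Fin n))]
    refine Finset.sum_congr rfl fun u _ => ?_
    have h1 : ∀ b, wp M (Fin.cons b u : Fin (K + 2) → Fin n) = M b (u 0) * wp M u := by
      intro b
      unfold wp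
      rw [Fin.prod_univ_succ]
      simp
    have h2 : ∀ b, (Fin.cons b u : Fin (K + 2) → Fin n) (Fin.last (K + 1)) = u (Fin.last K) := by
      intro b
      rw [← Fin.succ_last, Fin.cons_succ]
    have h3 : ∀ b, (Fin.consEquiv (fun _ : Fin (K + 2) => Fin n)) (b, u) = Fin.cons b u :=
      fun b => rfl
    simp only [h3, h1, h2, Fin.cons_zero]
    by_cases h : u (Fin.last K) = j
    · simp [h]
    · simp [h]

lemma trace_pow_walk (M : Matrix (Fin n) (Fin n) ℝ) (K : ℕ) :
    Matrix.trace (M ^ K) =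
      ∑ u : Fin (K + 1) → Fin n, if u 0 = u (Fin.last K) then wp M u else 0 := by
  unfold Matrix.trace
  simp only [Matrix.diag_apply, pow_apply_walk]
  rw [Finset.sum_comm]
  refine Finset.sum_congr rfl fun u _ => ?_
  split_ifs with h
  · rw [Finset.sum_eq_single (u 0)]
    · simp [h]
    · intro b _ hb; rw [if_neg]; rintro ⟨h1, _⟩; exact hb h1.symm
    · simp
  · apply Finset.sum_eq_zero
    intro b _; rw [if_neg]; rintro ⟨h1, h2⟩; exact h (h1.trans h2.symm)

/-- edge of a walk -/
def ed {V : Type} {K : ℕ} (u : Fin (K + 1) → V) (t : Fin K) : Sym2 V := s(u t.castSucc, u t.succ)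

/-- closed walk without loops and without edges of multiplicity one -/
def goodU {V : Type} {K : ℕ} (u : Fin (K + 1) → V) : Prop :=
  u 0 = u (Fin.last K) ∧ (∀ t : Fin K, u t.castSucc ≠ u t.succ) ∧
    ∀ t : Fin K, ∃ t', t' ≠ t ∧ ed u t' = ed u t

lemma goodU_comp {V V' : Type} {K : ℕ} {f : V → V'} (hf : Function.Injective f)
    (u : Fin (K + 1) → V) : goodU (f ∘ u) ↔ goodU u := by
  have he : ∀ t, ed (f ∘ u) t = Sym2.map f (ed u t) := fun t => rfl
  unfold goodU
  simp only [he, (Sym2.map.injective hf).eq_iff, Function.comp, hf.eq_iff, ne_eq]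

lemma card_vert_le {V : Type} [DecidableEq V] (K : ℕ) (u : Fin (K + 1) → V) :
    (Finset.univ.image u).card ≤ (Finset.univ.image (ed u)).card + 1 := by
  induction K with
  | zero => 
    refine Finset.card_image_le.trans ?_
    simp
  | succ K ih =>
    have h := ih (u ∘ Fin.succ)
    have hv : Finset.univ.image u = insert (u 0) (Finset.univ.image (u ∘ Fin.succ)) := by
      ext a
      simp [Fin.exists_fin_succ, eq_comm]
    have he : Finset.univ.image (ed u) = insert (ed u 0) (Finset.univ.image (ed (u ∘ Fin.succ))) := by
      ext a
      simp only [Finset.mem_image, Finset.mem_univ, true_and, Fin.exists_fin_succ, Finset.mem_insert]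
      rw [eq_comm]; rfl
    by_cases h0 : u 0 ∈ Finset.univ.image (u ∘ Fin.succ)
    · rw [hv, Finset.insert_eq_of_mem h0]
      refine h.trans ?_
      gcongr
      rw [he]
      exact Finset.subset_insert _ _
    · have h1 : ed u 0 ∉ Finset.univ.image (ed (u ∘ Fin.succ)) := by
        intro hc
        rw [Finset.mem_image] at hc
        obtain ⟨t, _, ht⟩ := hc
        have : u 0 ∈ ed u 0 := by unfold ed; simp
        rw [← ht] at this
        unfold ed at this
        rw [Sym2.mem_iff] at this
        apply h0
        rw [Finset.mem_image]
        rcases this with h2 | h2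
        · exact ⟨_, Finset.mem_univ _, h2.symm⟩
        · exact ⟨_, Finset.mem_univ _, h2.symm⟩
      rw [hv, he, Finset.card_insert_of_notMem h0, Finset.card_insert_of_notMem h1]
      omega

lemma two_mul_edges_le {V : Type} [DecidableEq V] (K : ℕ) (u : Fin (K + 1) → V) (hu : goodU u) :
    2 * (Finset.univ.image (ed u)).card ≤ K := by
  have h := Finset.card_eq_sum_card_image (ed u) Finset.univ
  rw [Finset.card_fin] at h
  have h2 : (Finset.univ.image (ed u)).card * 2 ≤
      ∑ b ∈ Finset.univ.image (ed u), (Finset.univ.filter fun t => ed u t = b).card := by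
    rw [← smul_eq_mul]
    apply Finset.card_nsmul_le_sum
    intro b hb
    rw [Finset.mem_image] at hb
    obtain ⟨t, _, rfl⟩ := hb
    obtain ⟨t', ht', he⟩ := hu.2.2 t
    have : ({t', t} : Finset (Fin K)) ⊆ Finset.univ.filter fun s => ed u s = ed u t := by
      intro s hs
      simp only [Finset.mem_insert, Finset.mem_singleton] at hs
      rcases hs with rfl | rfl <;> simp [he]
    calc 2 = ({t', t} : Finset (Fin K)).card := (Finset.card_pair ht').symm
      _ ≤ _ := Finset.card_le_card this
  omega

/-- Sym2 of a pair -/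
def pe (e : Pair n) : Sym2 (Fin n) := s(e.1.1, e.1.2)

lemma pe_inj : Function.Injective (pe : Pair n → Sym2 (Fin n)) := by
  rintro ⟨⟨a, b⟩, h⟩ ⟨⟨a', b'⟩, h'⟩ he
  simp only [pe, Sym2.eq_iff] at he
  rcases he with ⟨rfl, rfl⟩ | ⟨rfl, rfl⟩
  · rfl
  · exact absurd h (not_lt.mpr (le_of_lt h'))

lemma exists_pe {a b : Fin n} (h : a ≠ b) : ∃ e : Pair n, pe e = s(a, b) := by
  rcases lt_or_gt_of_ne h with h | h
  · exact ⟨⟨(a, b), h⟩, rfl⟩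
  · exact ⟨⟨(b, a), h⟩, Sym2.eq_swap⟩

lemma symM_pe (v : Pair n → ℝ) {a b : Fin n} {e : Pair n} (h : pe e = s(a, b)) :
    symM v a b = v e := by
  obtain ⟨⟨c, d⟩, hcd⟩ := e
  simp only [pe, Sym2.eq_iff] at h
  unfold symM
  rcases h with ⟨rfl, rfl⟩ | ⟨rfl, rfl⟩
  · simp only at hcd; rw [dif_pos hcd]
  · simp only at hcd; rw [dif_neg (not_lt.mpr hcd.le), dif_pos hcd]

lemma symM_ne (v : Pair n → ℝ) {a b : Fin n} (h : a ≠ b) :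
    symM v a b = ∏ e : Pair n, if s(a, b) = pe e then v e else 1 := by
  obtain ⟨e, he⟩ := exists_pe h
  rw [symM_pe v he, Finset.prod_eq_single e]
  · rw [if_pos he.symm]
  · intro e' _ hne
    rw [if_neg]
    intro h2
    exact hne (pe_inj (h2.symm.trans he.symm))
  · simp

/-- multiplicity -/
def mlt {K : ℕ} (u : Fin (K + 1) → Fin n) (e : Pair n) : ℕ :=
  (Finset.univ.filter fun t => ed u t = pe e).card

lemma wp_eq {K : ℕ} (v : Pair n → ℝ) (u : Fin (K + 1) → Fin n)
    (h : ∀ t : Fin K, u t.castSucc ≠ u t.succ) :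
    wp (symM v) u = ∏ e, v e ^ mlt u e := by
  unfold wp
  have : ∀ t : Fin K, symM v (u t.castSucc) (u t.succ) =
      ∏ e : Pair n, if ed u t = pe e then v e else 1 := fun t => symM_ne v (h t)
  simp_rw [this]
  rw [Finset.prod_comm]
  refine Finset.prod_congr rfl fun e _ => ?_
  rw [Finset.prod_ite]
  simp [mlt]

lemma wp_loop {K : ℕ} (v : Pair n → ℝ) (u : Fin (K + 1) → Fin n)
    (h : ¬ ∀ t : Fin K, u t.castSucc ≠ u t.succ) : wp (symM v) u = 0 := by
  push Not at h
  obtain ⟨t, ht⟩ := h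
  unfold wp
  apply Finset.prod_eq_zero (Finset.mem_univ t)
  rw [ht]; simp [symM]

section mom
variable {S : Type} [Fintype S] (w v : Pair n → S → ℝ)

/-- moments -/
def mom (e : Pair n) (m : ℕ) : ℝ := ∑ s, w e s * (v e s) ^ m

lemma Ex_wp {K : ℕ} (u : Fin (K + 1) → Fin n) (h : ∀ t : Fin K, u t.castSucc ≠ u t.succ) :
    Ex w (fun x => wp (symM (fun e => v e (x e))) u) = ∏ e, mom w v e (mlt u e) := by
  rw [show (fun x : Pair n → S => wp (symM (fun e => v e (x e))) u) =
    fun x => ∏ e, (fun (e : Pair n) (s : S) => v e s ^ mlt u e) e (x e) from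
      funext fun x => wp_eq _ u h]
  exact Ex_prod w (fun (e : Pair n) (s : S) => v e s ^ mlt u e)

lemma mlt_good {K : ℕ} {u : Fin (K + 1) → Fin n} (hu : goodU u) (e : Pair n) : mlt u e ≠ 1 := by
  intro h
  unfold mlt at h
  rw [Finset.card_eq_one] at h
  obtain ⟨t, ht⟩ := h
  have h1 : ed u t = pe e := by
    have : t ∈ Finset.univ.filter fun t => ed u t = pe e := by rw [ht]; simp
    simpa using this
  obtain ⟨t', hne, he⟩ := hu.2.2 t
  have : t' ∈ Finset.univ.filter fun t => ed u t = pe e := by simp [he, h1]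
  rw [ht] at this
  exact hne (by simpa using this)

lemma mlt_bad {K : ℕ} {u : Fin (K + 1) → Fin n} (h : ∀ t : Fin K, u t.castSucc ≠ u t.succ)
    (hb : ¬ ∀ t : Fin K, ∃ t', t' ≠ t ∧ ed u t' = ed u t) : ∃ e, mlt u e = 1 := by
  push Not at hb
  obtain ⟨t, ht⟩ := hb
  obtain ⟨e, he⟩ := exists_pe (h t)
  refine ⟨e, ?_⟩
  unfold mlt
  rw [Finset.card_eq_one]
  refine ⟨t, ?_⟩
  ext s
  simp only [Finset.mem_filter, Finset.mem_univ, true_and, Finset.mem_singleton, he]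
  constructor
  · intro hs
    by_contra hne
    exact ht s hne hs
  · rintro rfl; rfl

lemma Ex_wp_bad (h1 : ∀ e, mom w v e 1 = 0) {K : ℕ} {u : Fin (K + 1) → Fin n}
    (hu : ¬ goodU u) (hc : u 0 = u (Fin.last K)) :
    Ex w (fun x => wp (symM (fun e => v e (x e))) u) = 0 := by
  by_cases h : ∀ t : Fin K, u t.castSucc ≠ u t.succ
  · rw [Ex_wp w v u h]
    obtain ⟨e, he⟩ := mlt_bad h (fun h2 => hu ⟨hc, h, h2⟩)
    exact Finset.prod_eq_zero (Finset.mem_univ e) (by rw [he, h1])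
  · simp_rw [fun x : Pair n → S => wp_loop (fun e => v e (x e)) u h]
    simp [Ex]

lemma Ex_wp_upper (h0 : ∀ e, mom w v e 0 = 1) {p : ℝ} (hp0 : 0 ≤ p) (hp1 : p ≤ 1)
    (h2 : ∀ e m, 2 ≤ m → |mom w v e m| ≤ p) {K : ℕ} {u : Fin (K + 1) → Fin n} (hu : goodU u) :
    Ex w (fun x => wp (symM (fun e => v e (x e))) u) ≤ p ^ ((Finset.univ.image u).card - 1) := by
  rw [Ex_wp w v u hu.2.1]
  calc _ ≤ |∏ e, mom w v e (mlt u e)| := le_abs_self _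
    _ = ∏ e, |mom w v e (mlt u e)| := Finset.abs_prod _ _
    _ ≤ ∏ e : Pair n, if mlt u e = 0 then 1 else p := by
      refine Finset.prod_le_prod (fun _ _ => abs_nonneg _) fun e _ => ?_
      split_ifs with h
      · rw [h, h0]; simp
      · exact h2 e _ (by have := mlt_good hu e; omega)
    _ = p ^ (Finset.univ.filter fun e : Pair n => ¬ mlt u e = 0).card := by
      rw [Finset.prod_ite]; simp
    _ ≤ _ := by
      apply pow_le_pow_of_le_one hp0 hp1
      have hv := card_vert_le K u
      have : (Finset.univ.image (ed u)).card ≤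
          (Finset.univ.filter fun e : Pair n => ¬ mlt u e = 0).card := by
        rw [← Finset.card_image_of_injective _ pe_inj]
        apply Finset.card_le_card
        intro b hb
        rw [Finset.mem_image] at hb ⊢
        obtain ⟨t, _, rfl⟩ := hb
        obtain ⟨e, he⟩ := exists_pe (hu.2.1 t)
        refine ⟨e, ?_, he⟩
        simp only [Finset.mem_filter, Finset.mem_univ, true_and]
        unfold mlt
        rw [Finset.card_eq_zero, Finset.filter_eq_empty_iff]
        intro hc
        exact hc (Finset.mem_univ t) he.symm
      omega

lemma Ex_wp_lower (h0 : ∀ e, mom w v e 0 = 1) 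
    (h2 : ∀ e m, 2 ≤ m → 1 ≤ mom w v e m) {K : ℕ} {u : Fin (K + 1) → Fin n} (hu : goodU u) :
    1 ≤ Ex w (fun x => wp (symM (fun e => v e (x e))) u) := by
  rw [Ex_wp w v u hu.2.1]
  calc (1:ℝ) = ∏ e : Pair n, 1 := by simp
    _ ≤ _ := by
      refine Finset.prod_le_prod (fun _ _ => zero_le_one) fun e _ => ?_
      by_cases h : mlt u e = 0
      · rw [h, h0]
      · exact h2 e _ (by have := mlt_good hu e; omega)

open Classical in
lemma Ex_trace_upper (h0 : ∀ e, mom w v e 0 = 1) (h1 : ∀ e, mom w v e 1 = 0)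
    {p : ℝ} (hp0 : 0 ≤ p) (hp1 : p ≤ 1)
    (h2 : ∀ e m, 2 ≤ m → |mom w v e m| ≤ p) (K : ℕ) :
    Ex w (fun x => Matrix.trace ((symM (fun e => v e (x e))) ^ K)) ≤
      ∑ u : Fin (K + 1) → Fin n, if goodU u then p ^ ((Finset.univ.image u).card - 1) else 0 := by
  simp_rw [trace_pow_walk]
  rw [Ex_sum]
  refine Finset.sum_le_sum fun u _ => ?_
  split_ifs with hc hg hg
  · exact Ex_wp_upper w v h0 hp0 hp1 h2 hg
  · exact (Ex_wp_bad w v h1 hg hc).le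
  · exact absurd hg.1 hc
  · simp [Ex]

open Classical in
lemma Ex_trace_lower (h0 : ∀ e, mom w v e 0 = 1) (h1 : ∀ e, mom w v e 1 = 0)
    (h2 : ∀ e m, 2 ≤ m → 1 ≤ mom w v e m) (K : ℕ) :
    ∑ u : Fin (K + 1) → Fin n, (if goodU u then (1:ℝ) else 0) ≤
    Ex w (fun x => Matrix.trace ((symM (fun e => v e (x e))) ^ K)) := by
  simp_rw [trace_pow_walk]
  rw [Ex_sum]
  refine Finset.sum_le_sum fun u _ => ?_
  split_ifs with hg hc hc
  · exact Ex_wp_lower w v h0 h2 hg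
  · exact absurd hg.1 hc
  · exact (Ex_wp_bad w v h1 hg hc).ge
  · simp [Ex]
end mom

end PartC2

section PartC3
open scoped Matrix.Norms.L2Operator
variable {n : ℕ}

lemma finite_setoid (T : Type) [Finite T] : Finite (Setoid T) := by
  have : Function.Injective (fun (s : Setoid T) => (s.r : T → T → Prop)) := by
    intro a b h
    ext x y
    exact iff_of_eq (congrFun (congrFun h x) y)
  exact Finite.of_injective _ this

open Classical in
lemma card_ker (T : Type) [Fintype T] [DecidableEq T] (π : Setoid T) (n : ℕ) :
    (Finset.univ.filter fun u : T → Fin n => Setoid.ker u = π).card =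
      n.descFactorial (Fintype.card (Quotient π)) := by
  have h1 : Fintype.card (Quotient π ↪ Fin n) = n.descFactorial (Fintype.card (Quotient π)) := by
    rw [Fintype.card_embedding_eq, Fintype.card_fin]
  rw [← h1, ← Fintype.card_subtype]
  symm
  refine Fintype.card_congr (Equiv.ofBijective
    (fun f : Quotient π ↪ Fin n => (⟨fun t => f (Quotient.mk π t), ?_⟩ :
      {u : T → Fin n // Setoid.ker u = π})) ⟨?_, ?_⟩)
  · ext a b
    rw [Setoid.ker_def, f.injective.eq_iff]
    exact Quotient.eq
  · intro f g h
    ext q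
    induction q using Quotient.inductionOn with
    | h t => exact congrArg Fin.val (congrFun (congrArg Subtype.val h) t)
  · rintro ⟨u, rfl⟩
    refine ⟨⟨Setoid.kerLift u, Setoid.kerLift_injective u⟩, ?_⟩
    rfl

open Classical in
lemma sum_ker (T : Type) [Fintype T] [DecidableEq T] [Fintype (Setoid T)] (G : Setoid T → ℝ) (n : ℕ) :
    ∑ u : T → Fin n, G (Setoid.ker u) =
      ∑ π : Setoid T, (n.descFactorial (Fintype.card (Quotient π)) : ℝ) * G π := by
  rw [← Finset.sum_fiberwise (s := Finset.univ) (g := fun u : T → Fin n => Setoid.ker u)]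
  refine Finset.sum_congr rfl fun π _ => ?_
  rw [← card_ker T π n, ← nsmul_eq_mul, ← Finset.sum_const]
  refine Finset.sum_congr rfl fun u hu => ?_
  rw [(Finset.mem_filter.mp hu).2]

lemma goodU_ker {K : ℕ} (u : Fin (K + 1) → Fin n) :
    goodU u ↔ goodU (Quotient.mk (Setoid.ker u)) :=
  goodU_comp (Setoid.kerLift_injective u) (Quotient.mk (Setoid.ker u))

open Classical in
lemma card_image_ker {T : Type} [Fintype T] (u : T → Fin n) :
    (Finset.univ.image u).card = Fintype.card (Quotient (Setoid.ker u)) := by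
  have h : Finset.univ.image u = Finset.univ.image (Setoid.kerLift u) := by
    ext a
    simp only [Finset.mem_image, Finset.mem_univ, true_and]
    constructor
    · rintro ⟨t, rfl⟩; exact ⟨Quotient.mk _ t, rfl⟩
    · rintro ⟨q, rfl⟩
      induction q using Quotient.inductionOn with
      | h t => exact ⟨t, rfl⟩
  rw [h, Finset.card_image_of_injective _ (Setoid.kerLift_injective u), Finset.card_univ]

lemma desc_compare {n R k v : ℕ} {p : ℝ} (hp0 : 0 ≤ p) (hv1 : 1 ≤ v) (hvk : v ≤ k + 1)
    (hR : (n:ℝ) * p + k ≤ R) (hR1 : 1 ≤ R) :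
    (R:ℝ) * ((n.descFactorial v : ℝ) * p ^ (v - 1)) ≤ n * (R.descFactorial v : ℝ) := by
  obtain ⟨w, rfl⟩ := Nat.exists_eq_add_of_le' hv1
  obtain ⟨R', rfl⟩ := Nat.exists_eq_add_of_le' hR1
  have hwk : w ≤ k := by omega
  have hwk' : (w:ℝ) ≤ k := by exact_mod_cast hwk
  have h1 : (n.descFactorial (w + 1) : ℝ) ≤ (n:ℝ) ^ (w + 1) := by
    exact_mod_cast Nat.descFactorial_le_pow n (w + 1)
  have hnp : 0 ≤ (n:ℝ) * p := by positivity
  have hle : w ≤ R' + 1 := by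
    have : (w:ℝ) ≤ ((R' + 1 : ℕ) : ℝ) := by linarith
    exact_mod_cast this
  have h2 : ((n:ℝ) * p) ^ w ≤ (R'.descFactorial w : ℝ) := by
    have h3 : (((R' + 1 - w) ^ w : ℕ) : ℝ) ≤ (R'.descFactorial w : ℝ) := by
      exact_mod_cast Nat.pow_sub_le_descFactorial R' w
    refine le_trans ?_ h3
    rw [Nat.cast_pow, Nat.cast_sub hle]
    gcongr
    linarith
  rw [Nat.succ_descFactorial_succ]
  simp only [Nat.add_sub_cancel]
  push_cast
  calc ((R':ℝ) + 1) * ((n.descFactorial (w + 1) : ℝ) * p ^ w)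
      ≤ ((R':ℝ) + 1) * ((n:ℝ) ^ (w + 1) * p ^ w) := by gcongr
    _ = n * (((R':ℝ) + 1) * ((n:ℝ) * p) ^ w) := by rw [mul_pow]; ring
    _ ≤ _ := by gcongr

lemma bmom0 (P : Matrix (Fin n) (Fin n) ℝ) (e : Pair n) : mom (bw P) (bv P) e 0 = 1 := by
  simp [mom, bw]
lemma bmom1 (P : Matrix (Fin n) (Fin n) ℝ) (e : Pair n) : mom (bw P) (bv P) e 1 = 0 := by
  simp [mom, bw, bv]; ring
lemma bmom2 {P : Matrix (Fin n) (Fin n) ℝ} (hP : IsProbMatrix P) {p : ℝ} (hPp : ∀ i j, P i j ≤ p)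
    (e : Pair n) (m : ℕ) (hm : 2 ≤ m) : |mom (bw P) (bv P) e m| ≤ p := by
  refine le_trans ?_ (hPp e.1.1 e.1.2)
  have h0 := hP.2.1 e.1.1 e.1.2
  have h1 := hP.2.2.1 e.1.1 e.1.2
  obtain ⟨m, rfl⟩ := Nat.exists_eq_add_of_le hm
  simp [mom, bw, bv]
  set q := P e.1.1 e.1.2
  have hq : 0 ≤ 1 - q := by linarith
  have c1 : (1 - q) ^ (2 + m) ≤ (1 - q) ^ 2 := pow_le_pow_of_le_one hq (by linarith) (by omega)
  have c2 : q ^ (2 + m) ≤ q ^ 2 := pow_le_pow_of_le_one h0 h1 (by omega)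
  have b1 : |q * (1 - q) ^ (2 + m)| ≤ q * (1 - q) ^ 2 := by
    rw [abs_mul, abs_pow, abs_of_nonneg h0, abs_of_nonneg hq]
    exact mul_le_mul_of_nonneg_left c1 h0
  have b2 : |(1 - q) * (-q) ^ (2 + m)| ≤ (1 - q) * q ^ 2 := by
    rw [abs_mul, abs_pow, abs_neg, abs_of_nonneg h0, abs_of_nonneg hq]
    exact mul_le_mul_of_nonneg_left c2 hq
  refine (abs_add_le _ _).trans ?_
  nlinarith

lemma ymom0 (e : Pair n) : mom (fun _ => yw) (fun _ => yv) e 0 = 1 := by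
  simp [mom, yw]; norm_num
lemma ymom1 (e : Pair n) : mom (fun _ => yw) (fun _ => yv) e 1 = 0 := by
  simp [mom, yw, yv]; norm_num
lemma ymom2 (e : Pair n) (m : ℕ) (hm : 2 ≤ m) : 1 ≤ mom (fun _ => yw) (fun _ => yv) e m := by
  obtain ⟨m, rfl⟩ := Nat.exists_eq_add_of_le hm
  simp [mom, yw, yv]
  rcases Nat.eq_zero_or_pos m with rfl | h
  · norm_num
  · have h1 : (2:ℝ) ≤ 2 ^ m := le_self_pow₀ (by norm_num) h.ne'
    have h2 : (-1:ℝ) ≤ (-1) ^ (2 + m) := by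
      rcases neg_one_pow_eq_or ℝ (2 + m) with h | h <;> rw [h]; norm_num
    rw [pow_add]
    linarith

open Classical in
lemma trace_compare {P : Matrix (Fin n) (Fin n) ℝ} (hP : IsProbMatrix P) {p : ℝ} (hp0 : 0 ≤ p)
    (hp1 : p ≤ 1) (hPp : ∀ i j, P i j ≤ p) {k R : ℕ} (hR : (n:ℝ) * p + k ≤ R) (hR1 : 1 ≤ R) :
    (R:ℝ) * Ex (bw P) (fun x => Matrix.trace ((symM (fun e => bv P e (x e))) ^ (2 * k))) ≤
    n * Ex (fun _ : Pair R => yw) (fun x => Matrix.trace (symM (fun e => yv (x e)) ^ (2 * k))) := by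
  have hU := Ex_trace_upper (bw P) (bv P) (bmom0 P) (bmom1 P) hp0 hp1 (bmom2 hP hPp) (2 * k)
  have hL := Ex_trace_lower (n := R) (fun _ => yw) (fun _ => yv) ymom0 ymom1 ymom2 (2 * k)
  have : Fintype (Setoid (Fin (2 * k + 1))) := 
    have := finite_setoid (Fin (2 * k + 1)); Fintype.ofFinite _
  have e1 : ∑ u : Fin (2 * k + 1) → Fin n,
      (if goodU u then p ^ ((Finset.univ.image u).card - 1) else 0) =
      ∑ π : Setoid (Fin (2 * k + 1)), (n.descFactorial (Fintype.card (Quotient π)) : ℝ) *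
        (if goodU (Quotient.mk π) then p ^ (Fintype.card (Quotient π) - 1) else 0) := by
    rw [← sum_ker (Fin (2 * k + 1)) (fun π => if goodU (Quotient.mk π) then
      p ^ (Fintype.card (Quotient π) - 1) else 0) n]
    refine Finset.sum_congr rfl fun u _ => ?_
    rw [← card_image_ker u]
    simp only [goodU_ker u]
  have e2 : ∑ u : Fin (2 * k + 1) → Fin R, (if goodU u then (1:ℝ) else 0) =
      ∑ π : Setoid (Fin (2 * k + 1)), (R.descFactorial (Fintype.card (Quotient π)) : ℝ) *
        (if goodU (Quotient.mk π) then 1 else 0) := by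
    rw [← sum_ker (Fin (2 * k + 1)) (fun π => if goodU (Quotient.mk π) then 1 else 0) R]
    refine Finset.sum_congr rfl fun u _ => ?_
    simp only [goodU_ker u]
  rw [e1] at hU
  rw [e2] at hL
  calc _ ≤ (R:ℝ) * ∑ π : Setoid (Fin (2 * k + 1)), (n.descFactorial (Fintype.card (Quotient π)) : ℝ) *
        (if goodU (Quotient.mk π) then p ^ (Fintype.card (Quotient π) - 1) else 0) := by gcongr
    _ ≤ n * ∑ π : Setoid (Fin (2 * k + 1)), (R.descFactorial (Fintype.card (Quotient π)) : ℝ) *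
        (if goodU (Quotient.mk π) then 1 else 0) := by
        rw [Finset.mul_sum, Finset.mul_sum]
        refine Finset.sum_le_sum fun π _ => ?_
        split_ifs with hg
        · rw [mul_one]
          apply desc_compare hp0 (k := k) _ _ hR hR1
          · exact Fintype.card_pos_iff.mpr ⟨Quotient.mk π 0⟩
          · have a1 := card_vert_le (2 * k) (Quotient.mk π)
            have a2 := two_mul_edges_le (2 * k) (Quotient.mk π) hg
            have a3 : Finset.univ.image (Quotient.mk π) = Finset.univ := by
              apply Finset.image_univ_of_surjective
              exact Quotient.exists_rep
            rw [a3, Finset.card_univ] at a1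
            omega
        · simp
    _ ≤ _ := by gcongr

/-- tail bound for the spectral norm of the noise -/
lemma norm_tail (hn : 0 < n) {P : Matrix (Fin n) (Fin n) ℝ} (hP : IsProbMatrix P) {p : ℝ} (hp0 : 0 ≤ p)
    (hp1 : p ≤ 1) (hPp : ∀ i j, P i j ≤ p) {k : ℕ} (hk : 0 < k) (hk2 : (n:ℝ) * p ≤ k) {D : ℝ}
    (hD : 0 < D) :
    Pr (bw P) {x | D * (256 * Real.exp 48) * k ≤ ‖symM (fun e => bv P e (x e))‖ ^ 2} ≤
      n * (D⁻¹) ^ k := by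
  have hk' : (0:ℝ) < k := by exact_mod_cast hk
  have h1 := trace_compare hP hp0 hp1 hPp (k := k) (R := 2 * k) (by push_cast; linarith) (by omega)
  have h2 := Ex_trace_Y k hk
  have h3 : Ex (bw P) (fun x => Matrix.trace ((symM (fun e => bv P e (x e))) ^ (2 * k))) ≤
      n * (256 * Real.exp 48 * k) ^ k := by
    have : ((2 * k : ℕ):ℝ) * Ex (bw P) (fun x => Matrix.trace ((symM (fun e => bv P e (x e))) ^ (2 * k)))
        ≤ ((2 * k : ℕ):ℝ) * (n * (256 * Real.exp 48 * k) ^ k) := by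
      refine h1.trans ?_
      push_cast
      calc _ ≤ (n:ℝ) * ((2 * k) * (256 * Real.exp 48 * k) ^ k) := by gcongr
        _ = _ := by ring
    exact le_of_mul_le_mul_left this (by positivity)
  have hden : 0 < (D * (256 * Real.exp 48) * k) ^ k := by positivity
  have htr : ∀ x : Pair n → Bool, ‖symM (fun e => bv P e (x e))‖ ^ (2 * k) ≤
      Matrix.trace ((symM (fun e => bv P e (x e))) ^ (2 * k)) :=
    fun x => pow_norm_le_trace hn _ (symM_symm _) k
  calc _ ≤ Ex (bw P) (fun x => ((D * (256 * Real.exp 48) * k) ^ k)⁻¹ *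
        Matrix.trace ((symM (fun e => bv P e (x e))) ^ (2 * k))) := by
        apply Pr_le_Ex (bw_nonneg hP)
        · intro x
          have := htr x
          have : 0 ≤ ‖symM (fun e => bv P e (x e))‖ ^ (2 * k) := by positivity
          have := this.trans (htr x)
          positivity
        · intro x hx
          rw [Set.mem_ofPred_eq] at hx
          rw [inv_mul_eq_div, le_div_iff₀ hden, one_mul]
          refine le_trans ?_ (htr x)
          rw [pow_mul]
          gcongr
    _ ≤ ((D * (256 * Real.exp 48) * k) ^ k)⁻¹ * (n * (256 * Real.exp 48 * k) ^ k) := by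
        rw [Ex_const_mul]; gcongr
    _ = _ := by
        rw [mul_assoc D, mul_pow D, inv_pow]
        field_simp

end PartC3

section PartD1
open scoped Matrix.Norms.L2Operator
variable {n : ℕ}

lemma norm_mul_orthT {W : Matrix (Fin n) (Fin n) ℝ} (hW : W * Wᵀ = 1)
    (X : Matrix (Fin n) (Fin n) ℝ) : ‖X * Wᵀ‖ = ‖X‖ := by
  have hW' : Wᵀ * W = 1 := mul_eq_one_comm.mp hW
  have h1 := norm_orth_le hW
  have h2 : ‖Wᵀ‖ ≤ 1 := by rw [norm_transpose_real]; exact h1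
  apply le_antisymm
  · calc _ ≤ ‖X‖ * ‖Wᵀ‖ := norm_mul_le _ _
      _ ≤ ‖X‖ * 1 := by gcongr
      _ = _ := mul_one _
  · calc ‖X‖ = ‖X * Wᵀ * W‖ := by rw [Matrix.mul_assoc, hW', Matrix.mul_one]
      _ ≤ ‖X * Wᵀ‖ * ‖W‖ := norm_mul_le _ _
      _ ≤ ‖X * Wᵀ‖ * 1 := by gcongr
      _ = _ := mul_one _

lemma norm_row_Qp {W : Matrix (Fin n) (Fin n) ℝ} (hW : W * Wᵀ = 1)
    (M : Matrix (Fin n) (Fin n) ℝ) (i : Fin n) (r : ℕ) :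
    ‖Dm i * M * Qp W r‖ = Real.sqrt (∑ k : Fin n, if (k:ℕ) < r then ((M * W) i k) ^ 2 else 0) := by
  have h1 : Dm i * M * Qp W r =
      (Dm i * (M * W * Matrix.diagonal (fun k : Fin n => if (k:ℕ) < r then (1:ℝ) else 0))) * Wᵀ := by
    unfold Qp fnW; simp only [Matrix.mul_assoc]
  rw [h1, norm_mul_orthT hW, ← rowNorm_eq]
  unfold rowNorm
  congr 1
  refine Finset.sum_congr rfl fun k _ => ?_
  rw [Matrix.mul_diagonal]
  split_ifs <;> simp

lemma norm_row_Qp' {W : Matrix (Fin n) (Fin n) ℝ} (hW : W * Wᵀ = 1) (i : Fin n) (r : ℕ) :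
    ‖Dm i * Qp W r‖ = Real.sqrt (∑ k : Fin n, if (k:ℕ) < r then (W i k) ^ 2 else 0) := by
  have := norm_row_Qp hW 1 i r
  rwa [Matrix.mul_one, Matrix.one_mul] at this

lemma abs_W_le {W : Matrix (Fin n) (Fin n) ℝ} (hW : W * Wᵀ = 1) (j k : Fin n) {r : ℕ}
    (hk : (k:ℕ) < r) : |W j k| ≤ ‖Dm j * Qp W r‖ := by
  rw [norm_row_Qp' hW]
  apply Real.abs_le_sqrt
  have := Finset.single_le_sum (f := fun k : Fin n => if (k:ℕ) < r then (W j k) ^ 2 else 0)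
    (fun k _ => by split_ifs <;> positivity) (Finset.mem_univ k)
  simpa [hk] using this

lemma norm_topEig {V : Matrix (Fin n) (Fin n) ℝ} (hV : V * Vᵀ = 1) {r : ℕ} (hr : r ≤ n) (i : Fin n) :
    ‖Dm i * Qp V r‖ = rowNorm (topEig V r hr) i := by
  rw [norm_row_Qp' hV]
  unfold rowNorm topEig
  congr 1
  rw [← Finset.sum_filter]
  symm
  refine Finset.sum_bij (fun (k : Fin r) _ => Fin.castLE hr k) ?_ ?_ ?_ ?_
  · intro k _; simp
  · intro a _ b _ h; exact Fin.castLE_injective hr h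
  · intro b hb
    exact ⟨⟨b, (Finset.mem_filter.mp hb).2⟩, Finset.mem_univ _, rfl⟩
  · intro k _; rfl

lemma row_bound {W : Matrix (Fin n) (Fin n) ℝ} (hW : W * Wᵀ = 1)
    (M : Matrix (Fin n) (Fin n) ℝ) (i : Fin n) {r : ℕ} (hr : r ≤ n) {T : ℝ} (hT : 0 ≤ T)
    (h : ∀ k : Fin n, (k:ℕ) < r → |∑ j, M i j * W j k| ≤ T) :
    ‖Dm i * M * Qp W r‖ ≤ Real.sqrt r * T := by
  rw [norm_row_Qp hW, Real.sqrt_le_left (by positivity), mul_pow, Real.sq_sqrt (by positivity)]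
  calc _ ≤ ∑ k : Fin n, if (k:ℕ) < r then T ^ 2 else 0 := by
        refine Finset.sum_le_sum fun k _ => ?_
        split_ifs with hk
        · rw [← sq_abs]; exact pow_le_pow_left₀ (abs_nonneg _) (h k hk) 2
        · exact le_rfl
    _ = r * T ^ 2 := by
        rw [← Finset.sum_filter, Finset.sum_const, nsmul_eq_mul]
        congr 2
        rw [Fin.card_filter_val_lt]
        exact min_eq_right hr

open Classical in
/-- chosen eigenvectors -/
def evecs (A : Matrix (Fin n) (Fin n) ℝ) : Matrix (Fin n) (Fin n) ℝ :=
  if h : Aᵀ = A then (exists_eigenDecomp A h).choose else 1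

lemma evecs_spec (A : Matrix (Fin n) (Fin n) ℝ) (h : Aᵀ = A) :
    ∃ mu, IsEigenDecomp A (evecs A) mu := by
  unfold evecs
  rw [dif_pos h]
  exact (exists_eigenDecomp A h).choose_spec

lemma looMat_symm {P E : Matrix (Fin n) (Fin n) ℝ} (hP : Pᵀ = P) (hE : Eᵀ = E) (i : Fin n) :
    (looMat P E i)ᵀ = looMat P E i := by
  unfold looMat Dm
  simp only [Matrix.transpose_add, Matrix.transpose_mul, Matrix.transpose_sub, Matrix.transpose_one,
    Matrix.diagonal_transpose, hP, hE, Matrix.mul_assoc]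

lemma looMat_congr (P : Matrix (Fin n) (Fin n) ℝ) (v v' : Pair n → ℝ) (i : Fin n)
    (h : ∀ e : Pair n, ¬ (e.1.1 = i ∨ e.1.2 = i) → v e = v' e) :
    looMat P (symM v) i = looMat P (symM v') i := by
  have h1 : (1 - Dm i : Matrix (Fin n) (Fin n) ℝ) =
      Matrix.diagonal (fun j => if j = i then 0 else 1) := by
    unfold Dm
    rw [← Matrix.diagonal_one, Matrix.diagonal_sub]
    congr 1; ext j
    by_cases hj : j = i
    · subst hj; simp
    · simp [hj]
  unfold looMat
  congr 1
  rw [h1]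
  ext a b
  rw [Matrix.mul_diagonal, Matrix.mul_diagonal, Matrix.diagonal_mul, Matrix.diagonal_mul]
  by_cases ha : a = i
  · simp [ha]
  by_cases hb : b = i
  · simp [hb]
  simp only [ha, hb, if_false, one_mul, mul_one]
  by_cases hab : a = b
  · subst hab; simp [symM]
  obtain ⟨e, he⟩ := exists_pe hab
  rw [symM_pe v he, symM_pe v' he]
  apply h
  simp only [pe, Sym2.eq_iff] at he
  rcases he with ⟨h1, h2⟩ | ⟨h1, h2⟩ <;> rw [h1, h2] <;> tauto

/-- noise matrix -/
def Nz (P : Matrix (Fin n) (Fin n) ℝ) (x : Pair n → Bool) : Matrix (Fin n) (Fin n) ℝ :=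
  symM (fun e => bv P e (x e))

/-- leave-one-out eigenvectors -/
def LW (P : Matrix (Fin n) (Fin n) ℝ) (i : Fin n) (x : Pair n → Bool) : Matrix (Fin n) (Fin n) ℝ :=
  evecs (looMat P (Nz P x) i)

/-- leave-one-out coherence -/
def LB (P : Matrix (Fin n) (Fin n) ℝ) (r : ℕ) (i : Fin n) (x : Pair n → Bool) : ℝ :=
  ⨆ j, ‖Dm j * Qp (LW P i x) r‖

lemma LW_spec {P : Matrix (Fin n) (Fin n) ℝ} (hP : IsProbMatrix P) (i : Fin n) (x : Pair n → Bool) :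
    ∃ mu, IsEigenDecomp (looMat P (Nz P x) i) (LW P i x) mu :=
  evecs_spec _ (looMat_symm hP.1 (symM_symm _) i)

lemma le_LB (P : Matrix (Fin n) (Fin n) ℝ) (r : ℕ) (i : Fin n) (x : Pair n → Bool) (j : Fin n) :
    ‖Dm j * Qp (LW P i x) r‖ ≤ LB P r i x :=
  le_ciSup (f := fun j => ‖Dm j * Qp (LW P i x) r‖) (Set.finite_range _).bddAbove j

/-- good event -/
def Good (P : Matrix (Fin n) (Fin n) ℝ) (r : ℕ) (p H D : ℝ) : Set (Pair n → Bool) :=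
  {x | ‖Nz P x‖ ^ 2 ≤ D ∧ ∀ i k : Fin n, (k:ℕ) < r →
    |∑ j, Nz P x i j * LW P i x j k| ≤ (1 + Real.exp H) * Real.sqrt (p * (4 * Real.log n)) +
      (4 * Real.log n) * LB P r i x / H}

lemma good_prob (hn : 2 ≤ n) {P : Matrix (Fin n) (Fin n) ℝ} (hP : IsProbMatrix P) {p c H : ℝ}
    (hp : 0 < p) (hp1 : p ≤ 1) (hPp : ∀ i j, P i j ≤ p) (hc : 0 < c) (hH : 0 < H)
    (hnp : c * Real.log n ≤ n * p) (r : ℕ) :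
    Pr (bw P) (Good P r p H (Real.exp (2 / c) * (256 * Real.exp 48) * ⌈(n:ℝ) * p⌉₊))ᶜ ≤ 2 / n := by
  have hn' : (2:ℝ) ≤ n := by exact_mod_cast hn
  have hn0 : (0:ℝ) < n := by linarith
  have hlog : 0 < Real.log n := Real.log_pos (by linarith)
  set k0 := ⌈(n:ℝ) * p⌉₊ with hk0
  have hk0pos : 0 < k0 := Nat.ceil_pos.mpr (by positivity)
  set D := Real.exp (2 / c) * (256 * Real.exp 48) * k0 with hD
  let B0 : Set (Pair n → Bool) := {x | D ≤ ‖symM (fun e => bv P e (x e))‖ ^ 2}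
  let B1 : Fin n × Fin n × Bool → Set (Pair n → Bool) := fun q =>
    {x | (1 + Real.exp H) * Real.sqrt (p * (4 * Real.log n)) + (4 * Real.log n) * LB P r q.1 x / H <
      ∑ j, symM (fun e => bv P e (x e)) q.1 j *
        (if (q.2.1 : ℕ) < r then (if q.2.2 then 1 else -1) * LW P q.1 x j q.2.1 else 0)}
  have hB0 : Pr (bw P) B0 ≤ 1 / n := by
    refine (norm_tail (by omega) hP hp.le hp1 hPp hk0pos (Nat.le_ceil _) (Real.exp_pos (2 / c))).trans ?_
    rw [← Real.exp_neg, ← Real.exp_nat_mul]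
    have h1 : Real.exp (k0 * -(2 / c)) ≤ Real.exp (-(2 * Real.log n)) := by
      apply Real.exp_le_exp.mpr
      have : c * Real.log n ≤ k0 := hnp.trans (Nat.le_ceil _)
      have h2 : Real.log n ≤ k0 / c := by rw [le_div_iff₀ hc]; linarith
      have : (k0:ℝ) * -(2 / c) = -(2 * (k0 / c)) := by ring
      rw [this]; linarith
    have h2 : Real.exp (-(2 * Real.log n)) = ((n:ℝ) ^ 2)⁻¹ := by
      rw [Real.exp_neg, two_mul, Real.exp_add, Real.exp_log hn0, pow_two]
    rw [h2] at h1
    calc _ ≤ (n:ℝ) * ((n:ℝ) ^ 2)⁻¹ := by gcongr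
      _ = 1 / n := by field_simp
  have hB1 : ∀ q, Pr (bw P) (B1 q) ≤ ((n:ℝ) ^ 4)⁻¹ := by
    rintro ⟨i, k, s⟩
    have hW : ∀ x, LW P i x * (LW P i x)ᵀ = 1 := fun x => (LW_spec hP i x).choose_spec.1
    have h := row_tail hP hp hPp (L := 4 * Real.log n) (by positivity) hH i
      (fun x j => if (k : ℕ) < r then (if s then 1 else -1) * LW P i x j k else 0)
      (fun x => LB P r i x) ?_ ?_ ?_ ?_
    · refine h.trans (le_of_eq ?_)
      rw [Real.exp_neg, show 4 * Real.log n = ((4:ℕ):ℝ) * Real.log n by norm_num, Real.exp_nat_mul,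
        Real.exp_log hn0]
    · intro x y hxy
      have : LW P i x = LW P i y := by
        unfold LW Nz
        congr 1
        apply looMat_congr
        intro e he
        rw [hxy e he]
      constructor
      · simp only [this]
      · unfold LB; rw [this]
    · intro x
      exact (norm_nonneg _).trans (le_LB P r i x i)
    · intro x j
      have h0 : 0 ≤ LB P r i x := (norm_nonneg _).trans (le_LB P r i x i)
      split_ifs with hk hs
      · rw [one_mul]; exact (abs_W_le (hW x) j k hk).trans (le_LB P r i x j)
      · rw [neg_one_mul, abs_neg]; exact (abs_W_le (hW x) j k hk).trans (le_LB P r i x j)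
      · simpa using h0
    · intro x
      have hW' : (LW P i x)ᵀ * LW P i x = 1 := mul_eq_one_comm.mp (hW x)
      have h1 := congrFun (congrFun hW' k) k
      simp only [Matrix.mul_apply, Matrix.transpose_apply, Matrix.one_apply_eq] at h1
      refine le_trans (Finset.sum_le_sum (g := fun j => LW P i x j k * LW P i x j k)
        fun j _ => ?_) h1.le
      have := mul_self_nonneg (LW P i x j k)
      split_ifs
      · apply le_of_eq; ring
      · apply le_of_eq; ring
      · simpa using this
  have hunion := Pr_union_le (bw_nonneg hP) (Finset.univ : Finset (Option (Fin n × Fin n × Bool)))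
    (fun o => o.elim B0 B1) (Good P r p H D)ᶜ ?_
  · refine hunion.trans ?_
    rw [Fintype.sum_option]
    simp only [Option.elim]
    calc _ ≤ 1 / (n:ℝ) + ∑ q : Fin n × Fin n × Bool, ((n:ℝ) ^ 4)⁻¹ :=
          add_le_add hB0 (Finset.sum_le_sum fun q _ => hB1 q)
      _ = 1 / (n:ℝ) + (n * (n * 2)) * ((n:ℝ) ^ 4)⁻¹ := by
          simp [Finset.sum_const, Fintype.card_prod]
      _ ≤ 1 / (n:ℝ) + 1 / n := by
          gcongr
          rw [← div_eq_mul_inv, div_le_div_iff₀ (by positivity) hn0]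
          nlinarith [mul_nonneg (by positivity : (0:ℝ) ≤ (n:ℝ) ^ 3) (by linarith : 0 ≤ (n:ℝ) - 2)]
      _ = 2 / n := by ring
  · intro x hx
    by_contra hcon
    push Not at hcon
    apply hx
    refine ⟨?_, ?_⟩
    · have := hcon none (Finset.mem_univ _)
      simp only [Option.elim, B0, Set.mem_ofPred_eq, not_le] at this
      exact this.le
    · intro i k hk
      have h1 := hcon (some (i, k, true)) (Finset.mem_univ _)
      have h2 := hcon (some (i, k, false)) (Finset.mem_univ _)
      simp only [Option.elim, B1, Set.mem_ofPred_eq, not_lt, hk, if_true, one_mul,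
        Bool.false_eq_true, if_false, neg_one_mul, mul_neg, Finset.sum_neg_distrib] at h1 h2
      rw [abs_le]
      unfold Nz
      constructor <;> linarith

end PartD1

section PartD2
open scoped Matrix.Norms.L2Operator

/-- scalar side conditions -/
lemma scalar_side {c₁ c₂ s K a b g m l ε τ H : ℝ} (hc₁ : 0 < c₁) (hs : 0 < s)
    (ha : 1 ≤ a) (hb : 0 < b) (hg : 1 ≤ g) (hm : 0 < m)
    (h3 : s * (a * g) ≤ m * b) (hl : c₁ * (m * b) ^ 2 ≤ l * a)
    (hε : ε ≤ K * (m * b)) (hτ : τ ≤ c₂ * (b * g))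
    (hgK : 16 * K ≤ c₁ * s * g) (hmc : 16 * c₂ ≤ c₁ * s * m)
    (hH : H = 64 / (c₁ * s ^ 2)) :
    0 < l ∧ τ ≤ l / 16 ∧ ε ≤ l / 16 ∧ a * (4 * g ^ 2) / H * (8 / l) ≤ 1 / 2 := by
  have ha0 : 0 < a := by linarith
  have hg0 : 0 < g := by linarith
  have hmb : 0 < m * b := by positivity
  have hsag : 0 < s * (a * g) := by positivity
  have e1 : c₁ * (m * b) * (s * g) ≤ l := by
    have : c₁ * (m * b) * (s * g) * a ≤ l * a := by
      refine le_trans ?_ hl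
      have := mul_le_mul_of_nonneg_left h3 (by positivity : 0 ≤ c₁ * (m * b))
      nlinarith
    exact le_of_mul_le_mul_right this ha0
  have e2 : c₁ * s ^ 2 * (a * g ^ 2) ≤ l := by
    refine le_trans ?_ e1
    have := mul_le_mul_of_nonneg_left h3 (by positivity : 0 ≤ c₁ * (s * g))
    nlinarith
  have hl0 : 0 < l := lt_of_lt_of_le (by positivity) e1
  refine ⟨hl0, ?_, ?_, ?_⟩
  · have := mul_le_mul_of_nonneg_right hmc (by positivity : 0 ≤ b * g)
    nlinarith
  · have := mul_le_mul_of_nonneg_right hgK (by positivity : 0 ≤ m * b)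
    nlinarith
  · have : a * (4 * g ^ 2) / H * (8 / l) = (c₁ * s ^ 2 * (a * g ^ 2)) / (2 * l) := by
      rw [hH]; field_simp; norm_num
    rw [this, div_le_iff₀ (by positivity)]
    linarith

/-- scalar final bound -/
lemma scalar_final {c₂ c₄ s K a b g m l ε τ H μ l0 eH : ℝ} (hc₂ : 0 < c₂) (hs : 0 < s)
    (hK : 0 < K) (heH : 0 < eH)
    (hc₄ : 0 < c₄) (ha : 1 ≤ a) (hb : 0 < b) (hg : 1 ≤ g) (hm : 1 ≤ m) (hμ : 1 ≤ μ)
    (h3 : s * (a * g) ≤ m * b)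
    (hε0 : 0 ≤ ε) (hτ0 : 0 ≤ τ)
    (hε : ε ≤ K * (m * b)) (hτ : τ ≤ c₂ * (b * g)) (hH : 0 < H)
    (hl : 0 < l) (hεl : ε ≤ l / 16) (hβ : a * (4 * g ^ 2) / H * (8 / l) ≤ 1 / 2)
    (hl0 : l0 ≤ c₄ * l) :
    4 * (a * ((1 + eH) * (2 * (b * g)))) +
      (32 * (a * (4 * g ^ 2) / H) / l + ε / l) * (μ * (a / m) * l0 + τ) +
      μ * (a / m) * (τ + 2 * ε) + τ ≤
    (8 * (1 + eH) + 128 * c₄ / (H * s) + 2 * c₂ + c₄ * K + c₂ + c₂ + 2 * K + c₂) *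
      (μ * (a * b * g)) := by
  have ha0 : 0 < a := by linarith
  have hg0 : 0 < g := by linarith
  have hm0 : 0 < m := by linarith
  have hμ0 : 0 < μ := by linarith
  set X := μ * (a * b * g) with hX
  have hX0 : 0 < X := by positivity
  set β := a * (4 * g ^ 2) / H with hβd
  have hβ0 : 0 < β := by positivity
  set u := μ * (a / m) with hu
  have hu0 : 0 < u := by positivity
  have t1 : a * b * g ≤ X := by
    rw [hX]; nlinarith [(by positivity : 0 < a * b * g)]
  have tτ : τ ≤ c₂ * X := by
    refine hτ.trans (mul_le_mul_of_nonneg_left ?_ hc₂.le)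
    refine le_trans ?_ t1
    nlinarith [(by positivity : 0 < b * g)]
  have tuε : u * ε ≤ K * X := by
    have h1 : u * ε ≤ u * (K * (m * b)) := mul_le_mul_of_nonneg_left hε hu0.le
    have h2 : u * (K * (m * b)) = K * (μ * (a * b)) := by
      rw [hu]; field_simp
    rw [h2] at h1
    refine h1.trans (mul_le_mul_of_nonneg_left ?_ hK.le)
    rw [hX]
    refine mul_le_mul_of_nonneg_left ?_ hμ0.le
    nlinarith [(by positivity : 0 < a * b)]
  have tuτ : u * τ ≤ c₂ * X := by
    have h1 : u * τ ≤ u * (c₂ * (b * g)) := mul_le_mul_of_nonneg_left hτ hu0.le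
    have h2 : u * (c₂ * (b * g)) = c₂ * X / m := by
      rw [hu, hX]; field_simp
    rw [h2] at h1
    exact h1.trans (div_le_self (by positivity) hm)
  have tβu : β * u ≤ 4 / (H * s) * X := by
    have h2 : β * u = (4 * μ * a * g / (H * s * m)) * (s * (a * g)) := by
      rw [hu, hβd]; field_simp
    rw [h2]
    refine (mul_le_mul_of_nonneg_left h3 (by positivity)).trans (le_of_eq ?_)
    rw [hX]; field_simp
  have hβl : β / l ≤ 1 / 16 := by
    have : β * (8 / l) = 8 * (β / l) := by ring
    linarith
  have hεl' : ε / l ≤ 1 / 16 := by rw [div_le_iff₀ hl]; linarith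
  have hβl0 : 0 ≤ β / l := by positivity
  have hεl0 : 0 ≤ ε / l := by positivity
  have m2 : (32 * β / l + ε / l) * (u * l0 + τ) ≤
      (32 * (β * u) + u * ε) * c₄ + 3 * τ := by
    have h1 : u * l0 ≤ u * (c₄ * l) := mul_le_mul_of_nonneg_left hl0 hu0.le
    have h2 : 32 * β / l + ε / l ≤ 3 := by
      have : 32 * β / l = 32 * (β / l) := by ring
      linarith
    have h3 : 0 ≤ 32 * β / l + ε / l := by positivity
    calc _ ≤ (32 * β / l + ε / l) * (u * (c₄ * l) + τ) := by gcongr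
      _ = (32 * (β * u) + u * ε) * c₄ + (32 * β / l + ε / l) * τ := by field_simp
      _ ≤ _ := by gcongr
  have m1 : (32 * (β * u) + u * ε) * c₄ ≤ (32 * (4 / (H * s) * X) + K * X) * c₄ := by gcongr
  have e5 : (32 * (4 / (H * s) * X) + K * X) * c₄ = (128 * c₄ / (H * s) + c₄ * K) * X := by ring
  have e6 : 4 * (a * ((1 + eH) * (2 * (b * g)))) ≤ 8 * (1 + eH) * X := by
    have := mul_le_mul_of_nonneg_left t1 (by positivity : 0 ≤ 8 * (1 + eH))
    linarith
  nlinarith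

variable {n : ℕ}

lemma pstar_props (hn : 2 ≤ n) {P : Matrix (Fin n) (Fin n) ℝ} (hP : IsProbMatrix P) :
    (∀ i j, P i j ≤ pstar P) ∧ pstar P ≤ 1 := by
  have : Nonempty (Fin n) := ⟨⟨0, by omega⟩⟩
  constructor
  · intro i j
    exact (le_ciSup (f := fun j => P i j) (Set.finite_range _).bddAbove j).trans
      (le_ciSup (f := fun i => ⨆ j, P i j) (Set.finite_range _).bddAbove i)
  · exact ciSup_le fun i => ciSup_le fun j => hP.2.2.1 i j

/-- The deterministic part on the good event. -/
lemma good_bound {c₁ c₂ c₃ c₄ K H : ℝ} (hc₁ : 0 < c₁) (hc₂ : 0 < c₂) (hc₃ : 0 < c₃)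
    (hc₄ : 0 < c₄) (hK : 0 < K) (hH : H = 64 / (c₁ * Real.sqrt c₃ ^ 2))
    (hn : 2 ≤ n) (hL1 : 1 ≤ Real.log n)
    (hLK : 16 * K ≤ c₁ * Real.sqrt c₃ * Real.sqrt (Real.log n))
    (hnc : 16 * c₂ ≤ c₁ * Real.sqrt c₃ * Real.sqrt n)
    {P : Matrix (Fin n) (Fin n) ℝ} (hP : IsProbMatrix P) {r : ℕ} (hr1 : 1 ≤ r) (hrn : r < n)
    {V : Matrix (Fin n) (Fin n) ℝ} {lam : Fin n → ℝ} (hVlam : IsEigenDecomp P V lam)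
    {μ₀ p D : ℝ} (hμ₀ : 1 ≤ μ₀) (hp0 : 0 < p)
    (hlamr : c₁ * n * p / Real.sqrt r ≤ |lam ⟨r - 1, by omega⟩|)
    (hlamr1 : |lam ⟨r, hrn⟩| ≤ c₂ * Real.sqrt (p * Real.log n))
    (hU : twoInf (topEig V r (le_of_lt hrn)) ≤ μ₀ * Real.sqrt (r / n))
    (hp : c₃ * (r * Real.log n / n) ≤ p)
    (hratio : |lam ⟨0, by omega⟩ / lam ⟨r - 1, by omega⟩| ≤ c₄)
    (hD : D ≤ K ^ 2 * (n * p))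
    {x : Pair n → Bool} (hx : x ∈ Good P r p H D)
    {W : Matrix (Fin n) (Fin n) ℝ} {mu : Fin n → ℝ} (hW : IsEigenDecomp (P + Nz P x) W mu) :
    ∀ i, ‖Dm i * ((P + Nz P x) * Qp W r - P)‖ ≤
      (8 * (1 + Real.exp H) + 128 * c₄ / (H * Real.sqrt c₃) + 2 * c₂ + c₄ * K + c₂ + c₂ + 2 * K + c₂) *
        (μ₀ * (Real.sqrt r * Real.sqrt p * Real.sqrt (Real.log n))) := by
  have : Nonempty (Fin n) := ⟨⟨0, by omega⟩⟩
  have hn0 : (0:ℝ) < n := by positivity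
  have hr1' : (1:ℝ) ≤ r := by exact_mod_cast hr1
  have hr0 : (0:ℝ) < r := by linarith
  set L := Real.log n with hLd
  have hL0 : 0 < L := by linarith
  set s := Real.sqrt c₃ with hsd
  set a := Real.sqrt r with had
  set b := Real.sqrt p with hbd
  set g := Real.sqrt L with hgd
  set m := Real.sqrt n with hmd
  have hs : 0 < s := Real.sqrt_pos.mpr hc₃
  have ha1 : 1 ≤ a := Real.one_le_sqrt.mpr hr1'
  have hb0 : 0 < b := Real.sqrt_pos.mpr hp0
  have hg1 : 1 ≤ g := Real.one_le_sqrt.mpr hL1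
  have hm1 : 1 ≤ m := Real.one_le_sqrt.mpr (by exact_mod_cast (by omega : 1 ≤ n))
  have hs2 : s ^ 2 = c₃ := Real.sq_sqrt hc₃.le
  have ha2 : a ^ 2 = r := Real.sq_sqrt hr0.le
  have hb2 : b ^ 2 = p := Real.sq_sqrt hp0.le
  have hg2 : g ^ 2 = L := Real.sq_sqrt hL0.le
  have hm2 : m ^ 2 = n := Real.sq_sqrt hn0.le
  have hHpos : 0 < H := by rw [hH]; positivity
  have h3 : s * (a * g) ≤ m * b := by
    refine abs_le_of_sq_le_sq' ?_ (by positivity) |>.2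
    rw [mul_pow, mul_pow, mul_pow, hs2, ha2, hg2, hm2, hb2]
    rw [← mul_div_assoc, div_le_iff₀ hn0] at hp
    linarith
  have hla : c₁ * (m * b) ^ 2 ≤ |lam ⟨r - 1, by omega⟩| * a := by
    rw [mul_pow, hm2, hb2, ← mul_assoc]
    rwa [div_le_iff₀ (by linarith)] at hlamr
  have hε : ‖Nz P x‖ ≤ K * (m * b) := by
    refine abs_le_of_sq_le_sq' ?_ (by positivity) |>.2
    rw [mul_pow, mul_pow, hm2, hb2]
    exact hx.1.trans hD
  have hτ : |lam ⟨r, hrn⟩| ≤ c₂ * (b * g) := by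
    rwa [Real.sqrt_mul hp0.le] at hlamr1
  obtain ⟨hl0, hτl, hεl, hβl⟩ := scalar_side hc₁ hs ha1 hb0 hg1 (by linarith) h3 hla hε hτ hLK hnc hH
  have hl00 : |lam ⟨0, by omega⟩| ≤ c₄ * |lam ⟨r - 1, by omega⟩| := by
    rwa [abs_div, div_le_iff₀ hl0] at hratio
  have hsq4 : Real.sqrt (p * (4 * L)) = 2 * (b * g) := by
    rw [show p * (4 * L) = (2 * (b * g)) ^ 2 by rw [mul_pow, mul_pow, hb2, hg2]; ring]
    exact Real.sqrt_sq (by positivity)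
  choose mu' hmu' using fun i => LW_spec hP i x
  have hdet := det_bound (by omega : 0 < n) hVlam hW (fun i => LW P i x) mu' hmu' hr1 hrn hl0 rfl hτl hεl
    (α := a * ((1 + Real.exp H) * (2 * (b * g)))) (β := a * (4 * g ^ 2) / H) (u := μ₀ * (a / m))
    (by positivity) hβl ?_ ?_
  · intro i
    exact (hdet i).trans (scalar_final hc₂ hs hK (Real.exp_pos H) hc₄ ha1 hb0 hg1 hm1 hμ₀ h3
      (norm_nonneg _) (abs_nonneg _) hε hτ hHpos hl0 hεl hβl hl00)
  · intro i B hB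
    have hLB : LB P r i x ≤ B := ciSup_le hB
    have hB0 : 0 ≤ B := (norm_nonneg _).trans (hB i)
    have := row_bound (hmu' i).1 (Nz P x) i hrn.le
      (T := (1 + Real.exp H) * (2 * (b * g)) + (4 * g ^ 2) * B / H) (by positivity) (fun k hk => by
        refine (hx.2 i k hk).trans ?_
        rw [← hLd, hsq4, hg2]
        gcongr)
    refine this.trans (le_of_eq ?_)
    rw [← had]; ring
  · intro i
    rw [norm_topEig hVlam.1 hrn.le]
    have h1 : rowNorm (topEig V r hrn.le) i ≤ twoInf (topEig V r hrn.le) :=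
      le_ciSup (f := fun i => rowNorm (topEig V r hrn.le) i) (Set.finite_range _).bddAbove i
    refine (h1.trans hU).trans (le_of_eq ?_)
    rw [Real.sqrt_div hr0.le]

lemma Bconst_nonneg {ratio : ℝ} (h : 1 ≤ ratio) (r : ℕ) : 0 ≤ Bconst ratio r := by
  unfold Bconst
  have : 0 ≤ Real.logb 2 ratio := Real.logb_nonneg (by norm_num) h
  have : 0 ≤ min (r : ℝ) (1 + Real.logb 2 ratio) := le_min (by positivity) (by linarith)
  positivity

lemma exists_N (T : ℝ) : ∃ N₀ : ℕ, ∀ n : ℕ, N₀ ≤ n → T ≤ Real.log n ∧ T ≤ n := by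
  have h := (Real.tendsto_log_atTop.comp tendsto_natCast_atTop_atTop).eventually_ge_atTop T
  have h' := (tendsto_natCast_atTop_atTop (R := ℝ)).eventually_ge_atTop T
  obtain ⟨N, hN⟩ := Filter.eventually_atTop.mp (h.and h')
  exact ⟨N, fun n hn => hN n hn⟩

lemma sqrt_aux {r p L : ℝ} (hr : 0 ≤ r) (hp : 0 ≤ p) (hL : 0 ≤ L) :
    Real.sqrt r * Real.sqrt p * Real.sqrt L ≤ Real.sqrt (r * (L + r) * p) := by
  rw [← Real.sqrt_mul (by positivity), ← Real.sqrt_mul (by positivity)]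
  apply Real.sqrt_le_sqrt
  have : 0 ≤ r * r * p := by positivity
  linarith

end PartD2

set_option maxHeartbeats 1000000

/-- two-to-infinity norm bound `‖P̂ − P‖_{2,∞}` under approximate low-rankness
and incoherence. -/
theorem two_to_infty_estimation_bound
    (c c₁ c₂ c₃ c₄ : ℝ) (hc : 0 < c) (hc₁ : 0 < c₁) (hc₂ : 0 < c₂) (hc₃ : 0 < c₃)
    (hc₄ : 0 < c₄) :
    ∃ (γ C : ℝ) (N₀ : ℕ), 0 < γ ∧ 0 < C ∧
      ∀ (n : ℕ) (hN : N₀ ≤ n) (hn : 2 ≤ n)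
        (P : Matrix (Fin n) (Fin n) ℝ) (hP : IsProbMatrix P)
        (r : ℕ) (hr1 : 1 ≤ r) (hrn : r < n)
        (V : Matrix (Fin n) (Fin n) ℝ) (lam : Fin n → ℝ)
        (hVlam : IsEigenDecomp P V lam)
        (μ₀ : ℝ) (hμ₀ : 1 ≤ μ₀)
        -- density of the network
        (hnp : c * Real.log n ≤ n * pstar P)
        -- approximate low-rankness
        (hlamr : c₁ * n * pstar P / Real.sqrt r ≤ |lam ⟨r - 1, by omega⟩|)
        (hlamr1 : |lam ⟨r, hrn⟩| ≤ c₂ * Real.sqrt (pstar P * Real.log n))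
        -- incoherence
        (hU : twoInf (topEig V r (le_of_lt hrn)) ≤ μ₀ * Real.sqrt (r / n))
        (hp : c₃ * max (μ₀ ^ 2 * r * Real.log n / n) (μ₀ ^ 2 * r ^ 2 / n) ≤ pstar P)
        (hratio : |lam ⟨0, by omega⟩ / lam ⟨r - 1, by omega⟩| ≤ c₄)
        (Ω : Type) (_ : MeasurableSpace Ω) (μ : Measure Ω) (hμ : IsProbabilityMeasure μ)
        (A : Ω → Matrix (Fin n) (Fin n) ℝ) (hA : IsAdjacencyModel μ P A)
        (Phat : Ω → Matrix (Fin n) (Fin n) ℝ) (hPhat : ∀ ω, IsSpecTrunc r (A ω) (Phat ω)),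
        ENNReal.ofReal
            (1 - (Bconst (|lam ⟨0, by omega⟩ / lam ⟨r - 1, by omega⟩|) r + 2) * (n : ℝ) ^ (-γ)) ≤
          μ {ω | twoInf (Phat ω - P) ≤
              C * (μ₀ * Real.sqrt (r * (Real.log n + r) * pstar P)
                + μ₀ ^ 2 * r * Real.sqrt (pstar P))} := by
  set C0 : ℝ := Real.exp (2 / c) * (256 * Real.exp 48) with hC0
  have hC0pos : 0 < C0 := by positivity
  set K : ℝ := Real.sqrt (2 * C0) with hKd
  have hK : 0 < K := Real.sqrt_pos.mpr (by positivity)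
  have hK2 : K ^ 2 = 2 * C0 := Real.sq_sqrt (by positivity)
  set s : ℝ := Real.sqrt c₃ with hsd
  have hs : 0 < s := Real.sqrt_pos.mpr hc₃
  set H : ℝ := 64 / (c₁ * s ^ 2) with hHd
  have hH : 0 < H := by positivity
  set C : ℝ := 8 * (1 + Real.exp H) + 128 * c₄ / (H * s) + 2 * c₂ + c₄ * K + c₂ + c₂ + 2 * K + c₂ with hCd
  have hC : 0 < C := by positivity
  obtain ⟨N₀, hN₀⟩ := exists_N (1 + 1 / c + (16 * K / (c₁ * s)) ^ 2 + (16 * c₂ / (c₁ * s)) ^ 2)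
  refine ⟨1, C, N₀, one_pos, hC, ?_⟩
  intro n hN hn P hP r hr1 hrn V lam hVlam μ₀ hμ₀ hnp hlamr hlamr1 hU hp hratio Ω _ μ hμ A hA Phat hPhat
  have : Nonempty (Fin n) := ⟨⟨0, by omega⟩⟩
  obtain ⟨hTL, hTn⟩ := hN₀ n hN
  have hn0 : (0:ℝ) < n := by positivity
  have q1 : 0 < 1 / c := by positivity
  have q2 : 0 ≤ (16 * K / (c₁ * s)) ^ 2 := by positivity
  have q3 : 0 ≤ (16 * c₂ / (c₁ * s)) ^ 2 := by positivity
  have hL1 : 1 ≤ Real.log n := by linarith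
  have hr1' : (1:ℝ) ≤ r := by exact_mod_cast hr1
  have hLK : 16 * K ≤ c₁ * s * Real.sqrt (Real.log n) := by
    have : 16 * K / (c₁ * s) ≤ Real.sqrt (Real.log n) := Real.le_sqrt_of_sq_le (by linarith)
    rw [div_le_iff₀ (by positivity)] at this
    linarith
  have hnc : 16 * c₂ ≤ c₁ * s * Real.sqrt n := by
    have : 16 * c₂ / (c₁ * s) ≤ Real.sqrt n := Real.le_sqrt_of_sq_le (by linarith)
    rw [div_le_iff₀ (by positivity)] at this
    linarith
  obtain ⟨hPp, hp1⟩ := pstar_props hn hP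
  set p := pstar P with hpd
  have hcL : 1 ≤ c * Real.log n := by
    have : 1 / c ≤ Real.log n := by linarith
    rw [div_le_iff₀ hc] at this
    linarith
  have hnp1 : 1 ≤ n * p := hcL.trans hnp
  have hp0 : 0 < p := pos_of_mul_pos_right (by linarith) hn0.le
  have hD : C0 * (⌈(n:ℝ) * p⌉₊ : ℝ) ≤ K ^ 2 * (n * p) := by
    have : (⌈(n:ℝ) * p⌉₊ : ℝ) ≤ n * p + 1 := (Nat.ceil_lt_add_one (by positivity)).le
    rw [hK2]
    nlinarith
  have hp' : c₃ * (r * Real.log n / n) ≤ p := by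
    refine le_trans (mul_le_mul_of_nonneg_left ?_ hc₃.le) hp
    refine le_trans ?_ (le_max_left _ _)
    have : 1 ≤ μ₀ ^ 2 := one_le_pow₀ hμ₀
    rw [mul_assoc, mul_div_assoc (μ₀ ^ 2)]
    exact le_mul_of_one_le_left (by positivity) this
  have hlpos : 0 < |lam ⟨r - 1, by omega⟩| :=
    lt_of_lt_of_le (by have : 0 < Real.sqrt r := Real.sqrt_pos.mpr (by linarith); positivity) hlamr
  have hrat1 : 1 ≤ |lam ⟨0, by omega⟩ / lam ⟨r - 1, by omega⟩| := by
    rw [abs_div, le_div_iff₀ hlpos, one_mul]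
    exact hVlam.2.2 _ _ (Fin.mk_le_mk.mpr (Nat.zero_le _))
  have hprob := good_prob hn hP hp0 hp1 hPp hc hH hnp r
  have hmono : {ω | cfg (A ω) ∈ Good P r p H (C0 * (⌈(n:ℝ) * p⌉₊ : ℝ))} ⊆
      {ω | twoInf (Phat ω - P) ≤
              C * (μ₀ * Real.sqrt (r * (Real.log n + r) * p)
                + μ₀ ^ 2 * r * Real.sqrt p)} := by
    intro ω hω
    obtain ⟨W, mu, hW, hT⟩ := hPhat ω
    have hAω : A ω = P + Nz P (cfg (A ω)) := adj_eq hP hA ω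
    have hPh : Phat ω = (P + Nz P (cfg (A ω))) * Qp W r := by
      rw [← hAω, A_mul_Qp hW, hT]; rfl
    have hW' : IsEigenDecomp (P + Nz P (cfg (A ω))) W mu := hAω ▸ hW
    have hb := good_bound hc₁ hc₂ hc₃ hc₄ hK hHd hn hL1 hLK hnc hP hr1 hrn hVlam hμ₀ hp0 hlamr hlamr1 hU
      hp' hratio hD hω hW'
    rw [Set.mem_ofPred_eq]
    unfold twoInf
    refine ciSup_le fun i => ?_
    rw [rowNorm_eq, hPh]
    refine (hb i).trans (mul_le_mul_of_nonneg_left ?_ hC.le)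
    have h1 : Real.sqrt r * Real.sqrt p * Real.sqrt (Real.log n) ≤
        Real.sqrt (r * (Real.log n + r) * p) :=
      sqrt_aux (Nat.cast_nonneg r) hp0.le (by linarith)
    have h2 : 0 ≤ μ₀ ^ 2 * r * Real.sqrt p := by positivity
    have := mul_le_mul_of_nonneg_left h1 (by linarith : 0 ≤ μ₀)
    linarith
  refine le_trans ?_ (measure_mono hmono)
  rw [transfer hP hA, Pr_compl (bw_sum P)]
  apply ENNReal.ofReal_le_ofReal
  have hB := Bconst_nonneg hrat1 r
  rw [Real.rpow_neg_one]
  have : 2 / (n:ℝ) ≤ (Bconst (|lam ⟨0, by omega⟩ / lam ⟨r - 1, by omega⟩|) r + 2) * (n:ℝ)⁻¹ := by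
    rw [div_eq_mul_inv]
    exact mul_le_mul_of_nonneg_right (by linarith) (by positivity)
  linarith

end
end

section
/- Let γ > 0, let P be an n×n probability matrix with all expected degrees d_i = Σ_j P_ij positive, and suppose d_min = min_i d_i > 3(γ+1) log n. Let A be a random adjacency matrix generated from P, with observed degrees d̂_i = Σ_j A_ij, D = diag(d₁,…,d_n) and D̂ = diag(d̂₁,…,d̂_n). Then with probability greater than 1 − 2 n^{−γ}: ‖D̂ D^{-1} − I_n‖₂ = max_i |d̂_i/d_i − 1| < √( 3(γ+1) log n / d_min ). -/
open Matrix MeasureTheory ProbabilityTheory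

noncomputable section

/-! ### Helper lemmas -/

lemma specNorm_diagonal_aux {n : ℕ} (hn : 2 ≤ n) (v : Fin n → ℝ) :
    specNorm (Matrix.diagonal v) = ⨆ i, |v i| := by
  have h1 : specNorm (Matrix.diagonal v) = ‖v‖ := Matrix.l2_opNorm_diagonal (𝕜 := ℝ) v
  haveI : Nonempty (Fin n) := ⟨⟨0, by omega⟩⟩
  have hb : BddAbove (Set.range fun i => |v i|) := (Set.finite_range _).bddAbove
  rw [h1]
  apply le_antisymm
  · rw [pi_norm_le_iff_of_nonempty]
    intro i
    exact le_ciSup hb i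
  · exact ciSup_le fun i => norm_le_pi_norm v i

lemma exp_neg_quad_aux {t : ℝ} (h0 : 0 ≤ t) (h1 : t ≤ 1) :
    Real.exp (-t) ≤ 1 - t + t ^ 2 / 2 := by
  have h := Real.quadratic_le_exp_of_nonneg h0
  rw [Real.exp_neg, inv_le_comm₀ (Real.exp_pos _) (by nlinarith)]
  refine le_trans ?_ h
  rw [inv_le_iff_one_le_mul₀ (by nlinarith)]
  nlinarith [sq_nonneg (t ^ 2)]

lemma log_quad_aux {x : ℝ} (h0 : 0 ≤ x) (h1 : x ≤ 1) :
    3 / 8 * x ^ 2 ≤ (1 + x) * Real.log (1 + x) - x := by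
  have h2 : (0 : ℝ) < 2 + x := by linarith
  have h := Real.sum_range_le_log_div (x := x / (2 + x)) (by positivity)
    (by rw [div_lt_one h2]; linarith) 2
  have e : (1 + x / (2 + x)) / (1 - x / (2 + x)) = 1 + x := by
    have : (2 + x) - x ≠ 0 := by norm_num
    field_simp
    ring
  rw [e] at h
  simp only [Finset.sum_range_succ, Finset.sum_range_zero] at h
  norm_num at h
  have h3 : 2 * (x / (2 + x) + (x / (2 + x)) ^ 3 / 3) ≤ Real.log (1 + x) := by linarith
  have h4 : (1 + x) * (2 * (x / (2 + x) + (x / (2 + x)) ^ 3 / 3)) ≤ (1 + x) * Real.log (1 + x) :=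
    mul_le_mul_of_nonneg_left h3 (by linarith)
  have h5 : (1 + x) * (2 * (x / (2 + x) + (x / (2 + x)) ^ 3 / 3)) - x - 3 / 8 * x ^ 2
      = x ^ 2 * (24 + 4 * x - 14 * x ^ 2 - 9 * x ^ 3) / (24 * (2 + x) ^ 3) := by
    field_simp
    ring
  have h6 : 0 ≤ x ^ 2 * (24 + 4 * x - 14 * x ^ 2 - 9 * x ^ 3) / (24 * (2 + x) ^ 3) := by
    have : x ^ 2 ≤ 1 := by nlinarith
    have : x ^ 3 ≤ 1 := pow_le_one₀ h0 h1
    apply div_nonneg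
    · apply mul_nonneg (sq_nonneg _); linarith
    · positivity
  linarith

lemma small_log_aux {n : ℕ} (hn : 2 ≤ n) (h : n < 16) : (n : ℝ) - 1 < 6 * Real.log n := by
  have hl := Real.log_two_gt_d9
  have key : ∀ k m : ℕ, 2 ^ k ≤ n ^ m → (k : ℝ) * Real.log 2 ≤ m * Real.log n := by
    intro k m hk
    rw [← Real.log_pow, ← Real.log_pow]
    apply Real.log_le_log (by positivity)
    exact_mod_cast hk
  by_cases h4 : n < 4
  · have := key 1 1 (by simp only [pow_one]; omega)
    have : (n : ℝ) ≤ 3 := by exact_mod_cast (by omega : n ≤ 3)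
    push_cast at *; linarith
  by_cases h8 : n < 8
  · have := key 2 1 (by simp only [pow_one]; omega)
    have : (n : ℝ) ≤ 7 := by exact_mod_cast (by omega : n ≤ 7)
    push_cast at *; linarith
  by_cases h12 : n < 12
  · have := key 3 1 (by simp only [pow_one]; omega)
    have : (n : ℝ) ≤ 11 := by exact_mod_cast (by omega : n ≤ 11)
    push_cast at *; linarith
  · have := key 7 2 (by nlinarith)
    have : (n : ℝ) ≤ 15 := by exact_mod_cast (by omega : n ≤ 15)
    push_cast at *; linarith

lemma large_exp_aux {n : ℕ} (h : 16 ≤ n) :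
    Real.exp (-(Real.log n / 2)) + Real.exp (-(Real.log n / 8)) < 1 := by
  have hl := Real.log_two_gt_d9
  have h1 : 4 * Real.log 2 ≤ Real.log n := by
    have : Real.log ((2 : ℝ) ^ 4) ≤ Real.log n := by
      apply Real.log_le_log (by positivity)
      norm_num
      exact_mod_cast h
    rw [Real.log_pow] at this
    exact_mod_cast this
  have h2 : Real.exp (-(Real.log n / 2)) ≤ 1 / 4 := by
    calc Real.exp (-(Real.log n / 2)) ≤ Real.exp (-(2 * Real.log 2)) := by
          apply Real.exp_le_exp.2; linarith
      _ = 1 / 4 := by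
          rw [Real.exp_neg, mul_comm, Real.exp_mul, Real.exp_log (by norm_num)]; norm_num
  have h3 : Real.exp (-(Real.log n / 8)) ^ 2 ≤ 1 / 2 := by
    rw [← Real.exp_nat_mul]
    calc Real.exp (((2 : ℕ) : ℝ) * (-(Real.log n / 8))) ≤ Real.exp (-(Real.log 2)) := by
          apply Real.exp_le_exp.2; push_cast; linarith
      _ = 1 / 2 := by
          rw [Real.exp_neg, Real.exp_log (by norm_num)]; norm_num
  have h4 : Real.exp (-(Real.log n / 8)) < 3 / 4 := by
    by_contra hc
    push Not at hc
    nlinarith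
  linarith

section model

variable {n : ℕ} {Ω : Type} [MeasurableSpace Ω] {μ : Measure Ω} [IsProbabilityMeasure μ]
  {P : Matrix (Fin n) (Fin n) ℝ} {A : Ω → Matrix (Fin n) (Fin n) ℝ}

/-- The ordered pair of two distinct indices. -/
def sortPair (i : Fin n) (j : {j : Fin n // j ≠ i}) : {q : Fin n × Fin n // q.1 < q.2} :=
  if h : i < j.1 then ⟨(i, j.1), h⟩ else ⟨(j.1, i), lt_of_le_of_ne (not_lt.1 h) j.2⟩

lemma sortPair_injective (i : Fin n) : Function.Injective (sortPair i) := by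
  rintro ⟨j, hj⟩ ⟨k, hk⟩ h
  unfold sortPair at h
  split_ifs at h <;> simp_all

lemma entry_mgf_aux (hP : IsProbMatrix P) (hA : IsAdjacencyModel μ P A) (i j : Fin n)
    (hij : j ≠ i) (t : ℝ) :
    mgf (fun ω => A ω i j) μ t ≤ Real.exp (P i j * (Real.exp t - 1)) := by
  obtain ⟨hsym, hdiag, h01, hmeas, hprob, -⟩ := hA
  have hp : μ.real {ω | A ω i j = 1} = P i j := by
    have : μ {ω | A ω i j = 1} = ENNReal.ofReal (P i j) := by
      rcases lt_or_gt_of_ne hij with h | h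
      · have e : {ω | A ω i j = 1} = {ω | A ω j i = 1} := by
          ext ω; simp only [Set.mem_setOf_eq]; rw [(hsym ω).apply]
        rw [e, hprob j i h, hP.1.apply]
      · exact hprob i j h
    rw [Measure.real, this, ENNReal.toReal_ofReal (hP.2.1 i j)]
  have hms : MeasurableSet {ω | A ω i j = 1} := hmeas i j (measurableSet_singleton 1)
  have e : (fun ω => Real.exp (t * A ω i j)) =
      fun ω => 1 + Set.indicator {ω | A ω i j = 1} (fun _ => Real.exp t - 1) ω := by
    funext ω
    by_cases h : A ω i j = 1
    · simp [Set.indicator, h]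
    · have h0 := (h01 ω i j).resolve_right h
      simp [Set.indicator, h0]
  rw [mgf, e, integral_add (integrable_const _) ((integrable_const _).indicator hms),
    integral_indicator_const _ hms, hp]
  simp only [integral_const, probReal_univ, smul_eq_mul, one_mul]
  linarith [Real.add_one_le_exp (P i j * (Real.exp t - 1))]

lemma deg_sum_aux (hA : IsAdjacencyModel μ P A) (i : Fin n) (ω : Ω) :
    ∑ j, A ω i j = ∑ j : {j : Fin n // j ≠ i}, A ω i j := by
  rw [Fintype.sum_eq_add_sum_subtype_ne _ i, hA.2.1, zero_add]

lemma deg_mgf_aux (hP : IsProbMatrix P) (hA : IsAdjacencyModel μ P A) (i : Fin n) (t : ℝ) :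
    mgf (fun ω => ∑ j, A ω i j) μ t ≤ Real.exp (deg P i * (Real.exp t - 1)) := by
  have hind := hA.2.2.2.2.2.precomp (sortPair_injective i)
  have e1 : ∀ j : {j : Fin n // j ≠ i},
      (fun ω => A ω (sortPair i j).1.1 (sortPair i j).1.2) = fun ω => A ω i j := by
    intro j
    funext ω
    unfold sortPair
    split_ifs
    · rfl
    · exact (hA.1 ω).apply _ _
  have hind2 : iIndepFun (fun (j : {j : Fin n // j ≠ i}) => fun ω => A ω i j) μ := by
    have e2 : (fun (j : {j : Fin n // j ≠ i}) => fun ω => A ω i j) =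
        fun j => fun ω => A ω (sortPair i j).1.1 (sortPair i j).1.2 := by
      funext j; exact (e1 j).symm
    rw [e2]
    exact hind
  have e3 : (fun ω => ∑ j, A ω i j) =
      ∑ j ∈ (Finset.univ : Finset {j : Fin n // j ≠ i}), fun ω => A ω i j := by
    funext ω
    rw [Finset.sum_apply, deg_sum_aux hA]
  have e4 : deg P i = ∑ j : {j : Fin n // j ≠ i}, P i j := by
    rw [deg, Fintype.sum_eq_add_sum_subtype_ne _ i, hP.2.2.2, zero_add]
  rw [e3, hind2.mgf_sum (fun j => hA.2.2.2.1 i j), e4, Finset.sum_mul, Real.exp_sum]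
  exact Finset.prod_le_prod (fun _ _ => mgf_nonneg) fun j _ => entry_mgf_aux hP hA i j j.2 t

lemma deg_bounds_aux (hA : IsAdjacencyModel μ P A) (i : Fin n) (ω : Ω) :
    0 ≤ ∑ j, A ω i j ∧ ∑ j, A ω i j ≤ (n : ℝ) - 1 := by
  have h0 : ∀ j, 0 ≤ A ω i j ∧ A ω i j ≤ 1 := by
    intro j
    rcases hA.2.2.1 ω i j with h | h <;> simp [h]
  refine ⟨Finset.sum_nonneg fun j _ => (h0 j).1, ?_⟩
  rw [← Finset.add_sum_erase _ _ (Finset.mem_univ i), hA.2.1, zero_add]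
  calc ∑ j ∈ Finset.univ.erase i, A ω i j ≤ ∑ j ∈ Finset.univ.erase i, (1 : ℝ) :=
        Finset.sum_le_sum fun j _ => (h0 j).2
    _ = (n : ℝ) - 1 := by
        have := i.pos
        rw [Finset.sum_const, Finset.card_erase_of_mem (Finset.mem_univ i)]
        simp [Nat.cast_sub (show 1 ≤ n by omega)]

lemma deg_integrable_aux (hA : IsAdjacencyModel μ P A) (i : Fin n) (t : ℝ) :
    Integrable (fun ω => Real.exp (t * ∑ j, A ω i j)) μ := by
  have hm : Measurable fun ω => ∑ j, A ω i j :=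
    Finset.measurable_sum _ fun j _ => hA.2.2.2.1 i j
  apply Integrable.of_bound (C := Real.exp (|t| * n))
  · exact (Real.measurable_exp.comp (hm.const_mul t)).aestronglyMeasurable
  · refine Filter.Eventually.of_forall fun ω => ?_
    rw [Real.norm_eq_abs, Real.abs_exp]
    apply Real.exp_le_exp.2
    have := deg_bounds_aux hA i ω
    calc t * ∑ j, A ω i j ≤ |t| * ∑ j, A ω i j :=
          mul_le_mul_of_nonneg_right (le_abs_self t) this.1
      _ ≤ |t| * n := mul_le_mul_of_nonneg_left (by linarith) (abs_nonneg t)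

lemma upper_tail_aux (hP : IsProbMatrix P) (hA : IsAdjacencyModel μ P A) (i : Fin n)
    (hd : 0 < deg P i) {δ : ℝ} (h0 : 0 ≤ δ) (h1 : δ ≤ 1) :
    μ.real {ω | (1 + δ) * deg P i ≤ ∑ j, A ω i j} ≤ Real.exp (-(3 / 8 * (δ ^ 2 * deg P i))) := by
  have hlog : 0 ≤ Real.log (1 + δ) := Real.log_nonneg (by linarith)
  refine (measure_ge_le_exp_mul_mgf _ hlog (deg_integrable_aux hA i _)).trans ?_
  refine (mul_le_mul_of_nonneg_left (deg_mgf_aux hP hA i _) (Real.exp_pos _).le).trans ?_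
  rw [← Real.exp_add, Real.exp_log (by linarith)]
  apply Real.exp_le_exp.2
  nlinarith [mul_le_mul_of_nonneg_left (log_quad_aux h0 h1) hd.le]

lemma lower_tail_aux (hP : IsProbMatrix P) (hA : IsAdjacencyModel μ P A) (i : Fin n)
    (hd : 0 < deg P i) {δ : ℝ} (h0 : 0 ≤ δ) (h1 : δ ≤ 1) :
    μ.real {ω | ∑ j, A ω i j ≤ (1 - δ) * deg P i} ≤ Real.exp (-(1 / 2 * (δ ^ 2 * deg P i))) := by
  refine (measure_le_le_exp_mul_mgf (t := -δ) _ (by linarith) (deg_integrable_aux hA i _)).trans ?_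
  refine (mul_le_mul_of_nonneg_left (deg_mgf_aux hP hA i _) (Real.exp_pos _).le).trans ?_
  rw [← Real.exp_add]
  apply Real.exp_le_exp.2
  nlinarith [mul_le_mul_of_nonneg_left (exp_neg_quad_aux h0 h1) hd.le]

end model

/-- concentration of the observed degrees, `‖D̂D⁻¹ − I‖₂ < √(3(γ+1)log n/d_min)`. -/
theorem degree_concentration
    (n : ℕ) (hn : 2 ≤ n) (γ : ℝ) (hγ : 0 < γ)
    (P : Matrix (Fin n) (Fin n) ℝ) (hP : IsProbMatrix P)
    (hd : ∀ i, 0 < deg P i)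
    (hdmin : 3 * (γ + 1) * Real.log n < ⨅ i, deg P i)
    (Ω : Type) (_ : MeasurableSpace Ω) (μ : Measure Ω) (hμ : IsProbabilityMeasure μ)
    (A : Ω → Matrix (Fin n) (Fin n) ℝ) (hA : IsAdjacencyModel μ P A) :
    ENNReal.ofReal (1 - 2 * (n : ℝ) ^ (-γ)) <
      μ {ω |
        specNorm (Matrix.diagonal (fun i => ∑ j, A ω i j) * degInv (deg P) - 1)
            = (⨆ i, |(∑ j, A ω i j) / deg P i - 1|) ∧
          (⨆ i, |(∑ j, A ω i j) / deg P i - 1|) <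
            Real.sqrt (3 * (γ + 1) * Real.log n / (⨅ i, deg P i))} := by
  haveI : Nonempty (Fin n) := ⟨⟨0, by omega⟩⟩
  have hn0 : (0 : ℝ) < n := by exact_mod_cast (by omega : 0 < n)
  set l := Real.log n with hl
  have hlpos : 0 < l := Real.log_pos (by exact_mod_cast (by omega : 1 < n))
  set m := ⨅ i, deg P i with hm
  set L := 3 * (γ + 1) * l with hL
  have hLpos : 0 < L := by positivity
  have hmpos : 0 < m := hLpos.trans hdmin
  have hmle : ∀ i, m ≤ deg P i := fun i => ciInf_le (Set.finite_range _).bddBelow i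
  set δ := Real.sqrt (L / m) with hδ
  have hδ2 : δ ^ 2 = L / m := Real.sq_sqrt (by positivity)
  have hδpos : 0 < δ := Real.sqrt_pos.2 (by positivity)
  have hδ1 : δ < 1 := by
    have : L / m < 1 := (div_lt_one hmpos).2 hdmin
    nlinarith
  have hδm : δ ^ 2 * m = L := by rw [hδ2]; field_simp
  have hδd : ∀ i, L ≤ δ ^ 2 * deg P i := fun i => by
    rw [← hδm]; exact mul_le_mul_of_nonneg_left (hmle i) (sq_nonneg _)
  set good := {ω |
        specNorm (Matrix.diagonal (fun i => ∑ j, A ω i j) * degInv (deg P) - 1)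
            = (⨆ i, |(∑ j, A ω i j) / deg P i - 1|) ∧
          (⨆ i, |(∑ j, A ω i j) / deg P i - 1|) < δ} with hgood
  set up : Fin n → Set Ω := fun i => {ω | (1 + δ) * deg P i ≤ ∑ j, A ω i j} with hup
  set lo : Fin n → Set Ω := fun i => {ω | ∑ j, A ω i j ≤ (1 - δ) * deg P i} with hlo
  have hcover : Set.univ ⊆ good ∪ ((⋃ i, lo i) ∪ ⋃ i, up i) := by
    intro ω _
    by_contra hc
    simp only [Set.mem_union, Set.mem_iUnion, not_or, not_exists] at hc
    obtain ⟨hc1, hc2, hc3⟩ := hc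
    apply hc1
    refine ⟨?_, ?_⟩
    · rw [← specNorm_diagonal_aux hn]
      congr 1
      rw [degInv, Matrix.diagonal_mul_diagonal, ← Matrix.diagonal_one, Matrix.diagonal_sub]
      rfl
    · obtain ⟨i, hi⟩ := exists_eq_ciSup_of_finite (f := fun i => |(∑ j, A ω i j) / deg P i - 1|)
      rw [← hi]
      have h2 : ¬ (∑ j, A ω i j ≤ (1 - δ) * deg P i) := hc2 i
      have h3 : ¬ ((1 + δ) * deg P i ≤ ∑ j, A ω i j) := hc3 i
      push Not at h2 h3
      rw [abs_lt]
      have h4 := (lt_div_iff₀ (hd i)).2 h2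
      have h5 := (div_lt_iff₀ (hd i)).2 h3
      constructor <;> linarith
  have hcard : (n : ℝ) = Real.exp l := (Real.exp_log hn0).symm
  have hlo_le : μ.real (⋃ i, lo i) ≤ Real.exp (l - 1 / 2 * L) := by
    refine (measureReal_iUnion_fintype_le _).trans ?_
    calc ∑ i, μ.real (lo i) ≤ ∑ i : Fin n, Real.exp (-(1 / 2 * L)) := by
          apply Finset.sum_le_sum
          intro i _
          refine (lower_tail_aux hP hA i (hd i) hδpos.le hδ1.le).trans ?_
          apply Real.exp_le_exp.2
          linarith [hδd i]
      _ = Real.exp (l - 1 / 2 * L) := by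
          rw [Finset.sum_const, Finset.card_univ, Fintype.card_fin, nsmul_eq_mul, hcard,
            ← Real.exp_add, sub_eq_add_neg]
  have hup_le : μ.real (⋃ i, up i) ≤ Real.exp (l - 3 / 8 * L) := by
    refine (measureReal_iUnion_fintype_le _).trans ?_
    calc ∑ i, μ.real (up i) ≤ ∑ i : Fin n, Real.exp (-(3 / 8 * L)) := by
          apply Finset.sum_le_sum
          intro i _
          refine (upper_tail_aux hP hA i (hd i) hδpos.le hδ1.le).trans ?_
          apply Real.exp_le_exp.2
          linarith [hδd i]
      _ = Real.exp (l - 3 / 8 * L) := by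
          rw [Finset.sum_const, Finset.card_univ, Fintype.card_fin, nsmul_eq_mul, hcard,
            ← Real.exp_add, sub_eq_add_neg]
  have hγl : 0 < γ * l := mul_pos hγ hlpos
  have hLe : L = 3 * (γ * l) + 3 * l := by rw [hL]; ring
  have hpow : (n : ℝ) ^ (-γ) = Real.exp (-(γ * l)) := by
    rw [Real.rpow_def_of_pos hn0]; congr 1; rw [hl]; ring
  have hbad1 : μ.real (⋃ i, lo i) + μ.real (⋃ i, up i) < 2 * (n : ℝ) ^ (-γ) := by
    have a1 : Real.exp (l - 1 / 2 * L) < Real.exp (-(γ * l)) :=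
      Real.exp_lt_exp.2 (by linarith)
    have a2 : Real.exp (l - 3 / 8 * L) < Real.exp (-(γ * l)) :=
      Real.exp_lt_exp.2 (by linarith)
    rw [hpow]; linarith
  have hbad2 : μ.real (⋃ i, lo i) + μ.real (⋃ i, up i) < 1 := by
    by_cases h16 : n < 16
    · have hempty : (⋃ i, up i) = ∅ := by
        rw [Set.iUnion_eq_empty]
        intro i
        rw [Set.eq_empty_iff_forall_notMem]
        intro ω hω
        have h1 : (1 + δ) * deg P i ≤ ∑ j, A ω i j := hω
        have h2 := (deg_bounds_aux hA i ω).2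
        have h3 := small_log_aux hn h16
        have h4 : (1 + δ) * m ≤ (1 + δ) * deg P i :=
          mul_le_mul_of_nonneg_left (hmle i) (by linarith)
        have h5 : L ≤ δ * m := by
          rw [← hδm]
          nlinarith [mul_pos hδpos hmpos]
        linarith
      rw [hempty, measureReal_empty, add_zero]
      refine hlo_le.trans_lt ?_
      rw [Real.exp_lt_one_iff]
      linarith
    · have h := large_exp_aux (not_lt.1 h16)
      have a1 : Real.exp (l - 1 / 2 * L) ≤ Real.exp (-(l / 2)) :=
        Real.exp_le_exp.2 (by linarith)
      have a2 : Real.exp (l - 3 / 8 * L) ≤ Real.exp (-(l / 8)) :=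
        Real.exp_le_exp.2 (by linarith)
      linarith
  have hsum : 1 ≤ μ.real good + (μ.real (⋃ i, lo i) + μ.real (⋃ i, up i)) := by
    calc (1 : ℝ) = μ.real Set.univ := probReal_univ.symm
      _ ≤ μ.real (good ∪ ((⋃ i, lo i) ∪ ⋃ i, up i)) := measureReal_mono hcover
      _ ≤ μ.real good + μ.real ((⋃ i, lo i) ∪ ⋃ i, up i) := measureReal_union_le _ _
      _ ≤ _ := by gcongr; exact measureReal_union_le _ _
  rw [← ofReal_measureReal (μ := μ) (s := good), ENNReal.ofReal_lt_ofReal_iff (by linarith)]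
  linarith
end
end

section
/- Let P be an n×n symmetric nonnegative matrix with zero diagonal and positive expected degrees d_i = Σ_j P_ij, and let D = diag(d₁,…,d_n), d_min = min_i d_i, d_max = max_i d_i. Suppose node i is a periphery node in the sense that the i-th row of P D^{-1} is constant off the diagonal: (P D^{-1})_{ij} = d_i / Σ_{k≠i} d_k for all j ≠ i, and (P D^{-1})_{ii} = 0. Then ‖P_{i,*} D^{-1} H‖₂ = √((n−1)/n) · d_i / Σ_{k≠i} d_k, and consequently ‖P_{i,*} D^{-1} H‖₂ < d_max / ((n−1) d_min). -/
open Matrix MeasureTheory ProbabilityTheory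

noncomputable section

/-- the score of a configuration-type periphery node. -/
theorem periphery_score_config
    (n : ℕ) (hn : 2 ≤ n)
    (P : Matrix (Fin n) (Fin n) ℝ) (hsymm : P.IsSymm) (hnonneg : ∀ i j, 0 ≤ P i j)
    (hdiag : ∀ i, P i i = 0) (hd : ∀ i, 0 < deg P i)
    (i : Fin n)
    (hrow : ∀ j, j ≠ i →
      (P * degInv (deg P)) i j = deg P i / ∑ k ∈ Finset.univ.erase i, deg P k)
    (hrowdiag : (P * degInv (deg P)) i i = 0) :
    rowNorm (P * degInv (deg P) * centerH n) i
        = Real.sqrt (((n : ℝ) - 1) / n) * (deg P i / ∑ k ∈ Finset.univ.erase i, deg P k) ∧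
      rowNorm (P * degInv (deg P) * centerH n) i <
        (⨆ k, deg P k) / (((n : ℝ) - 1) * ⨅ k, deg P k) := by
  set S := ∑ k ∈ Finset.univ.erase i, deg P k with hS
  set M := P * degInv (deg P) with hM
  have hn' : (2 : ℝ) ≤ n := by exact_mod_cast hn
  have hn0 : (n : ℝ) ≠ 0 := by positivity
  haveI : Nonempty (Fin n) := ⟨i⟩
  have hcard : ((Finset.univ.erase i).card : ℝ) = (n : ℝ) - 1 := by
    rw [Finset.card_erase_of_mem (Finset.mem_univ i), Finset.card_univ, Fintype.card_fin,
      Nat.cast_sub (by omega)]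
    simp
  have hinf : 0 < ⨅ k, deg P k := by
    obtain ⟨k, hk⟩ := exists_eq_ciInf_of_finite (f := fun k => deg P k)
    rw [← hk]
    exact hd k
  have hSle : ((n : ℝ) - 1) * (⨅ k, deg P k) ≤ S := by
    rw [← hcard, ← nsmul_eq_mul]
    exact Finset.card_nsmul_le_sum _ _ _
      (fun k _ => ciInf_le (Set.finite_range _).bddBelow k)
  have hpos : 0 < ((n : ℝ) - 1) * (⨅ k, deg P k) := mul_pos (by linarith) hinf
  have hSpos : 0 < S := lt_of_lt_of_le hpos hSle
  have hcpos : 0 < deg P i / S := div_pos (hd i) hSpos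
  have hsum : ∑ k, M i k = ((n : ℝ) - 1) * (deg P i / S) := by
    rw [← Finset.add_sum_erase _ _ (Finset.mem_univ i), hrowdiag, zero_add,
      Finset.sum_congr rfl (fun k hk => hrow k (Finset.ne_of_mem_erase hk)),
      Finset.sum_const, nsmul_eq_mul, hcard]
  have hent : ∀ j, (M * centerH n) i j = M i j - ((n : ℝ) - 1) * (deg P i / S) / n := by
    intro j
    rw [centerH, Matrix.mul_sub, Matrix.mul_one, Matrix.sub_apply, Matrix.mul_smul,
      Matrix.smul_apply, Matrix.mul_apply]
    simp only [Matrix.of_apply, mul_one, smul_eq_mul]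
    rw [hsum]
    ring
  have hmain : rowNorm (M * centerH n) i = Real.sqrt (((n : ℝ) - 1) / n) * (deg P i / S) := by
    have h2 : ∑ j, ((M * centerH n) i j) ^ 2 = (((n : ℝ) - 1) / n) * (deg P i / S) ^ 2 := by
      rw [← Finset.add_sum_erase _ _ (Finset.mem_univ i), hent i, hrowdiag,
        Finset.sum_congr rfl (fun k hk => by
          rw [hent k, hrow k (Finset.ne_of_mem_erase hk)]),
        Finset.sum_const, nsmul_eq_mul, hcard]
      generalize deg P i / S = c
      field_simp
      ring
    rw [rowNorm, h2, Real.sqrt_mul' _ (sq_nonneg _), Real.sqrt_sq hcpos.le]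
  refine ⟨hmain, ?_⟩
  rw [hmain]
  have hsq : Real.sqrt (((n : ℝ) - 1) / n) < 1 := by
    rw [Real.sqrt_lt' one_pos, div_lt_iff₀ (by linarith)]
    linarith
  calc _ < 1 * (deg P i / S) := mul_lt_mul_of_pos_right hsq hcpos
    _ = deg P i / S := one_mul _
    _ ≤ _ := by
      have hle : deg P i ≤ ⨆ k, deg P k := le_ciSup (Set.finite_range _).bddAbove i
      exact div_le_div₀ ((hd i).le.trans hle) hle hpos hSle
end
end
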